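/- arXiv:math/0303098 — 2 statements merged into one kernel-verified Lean document; each statement's English description precedes it below -/
import Mathlib

section
/- Let B⊆V be a linearly independent subset with |B|≥3 such that Gr(B) is connected. Then B is equivalent to a linearly independent set whose graph is a tree of type D_{m,k} for some m≥2, k≥1 if and only if there is no subset X⊆B which is equivalent to a linearly independent set whose graph is E₆. -/
open scoped BigOperators

/-- A `ZMod 2`-valued bilinear form on `V`. -/
abbrev BForm (V : Type*) [AddCommGroup V] [Module (ZMod 2) V] :=
  V →ₗ[ZMod 2] V →ₗ[ZMod 2] ZMod 2

variable {V : Type*} [AddCommGroup V] [Module (ZMod 2) V]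

/-- `g` is the transvection `τ_b : x ↦ x + Ω(x,b)·b` for some `b ∈ B`. -/
def IsTransvection (Ω : BForm V) (B : Set V) (g : V ≃ₗ[ZMod 2] V) : Prop :=
  ∃ b ∈ B, ∀ x : V, g x = x + Ω x b • b

/-- The group `Γ_B` generated by the transvections `τ_b`, `b ∈ B`. -/
def Gamma (Ω : BForm V) (B : Set V) : Subgroup (V ≃ₗ[ZMod 2] V) :=
  Subgroup.closure {g | IsTransvection Ω B g}

/-- `x` and `y` lie in the same `Γ_B`-orbit. -/
def SameOrbit (Ω : BForm V) (B : Set V) (x y : V) : Prop :=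
  ∃ g ∈ Gamma Ω B, g x = y

/-- The graph `Gr(X)` on vertex set `X`, with `b, b'` adjacent iff `Ω(b,b') = 1` or `Ω(b',b) = 1`. -/
def Gr (Ω : BForm V) (X : Set V) : SimpleGraph X :=
  SimpleGraph.fromRel fun a b => Ω a.1 b.1 = 1

/-- One basic move: `B' = φ_{c,a}(B)`, replacing `c` by `c + a`. -/
def MoveRel (Ω : BForm V) (B B' : Set V) : Prop :=
  ∃ a c, a ∈ B ∧ c ∈ B ∧ a ≠ c ∧ Ω a c = 1 ∧ B' = insert (c + a) (B \ {c})

/-- `B` and `B'` are equivalent: related by a finite sequence of basic moves. -/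
def EquivSets (Ω : BForm V) : Set V → Set V → Prop :=
  Relation.ReflTransGen (MoveRel Ω)

/-- The kernel `V₀` of the form `Ω`. -/
def V0set (Ω : BForm V) : Set V := {x | ∀ v : V, Ω x v = 0}

/-- `Δ`, the `Γ_B`-orbit containing `B` (when `Gr(B)` is connected). -/
def Delta (Ω : BForm V) (B : Set V) : Set V :=
  {x | ∃ b ∈ B, SameOrbit Ω B b x}

/-- `V₀₀₀`: vectors of `V₀` of the form `x₁ + x₂` with `x₁, x₂ ∈ Δ`. -/
def V000set (Ω : BForm V) (B : Set V) : Set V :=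
  {y | y ∈ V0set Ω ∧ ∃ x₁ ∈ Delta Ω B, ∃ x₂ ∈ Delta Ω B, y = x₁ + x₂}

/-- `U₀₀₀` for `U = span(B)`: vectors of `U₀` of the form `x₁ + x₂` with `x₁, x₂ ∈ Δ`. -/
def U000set (Ω : BForm V) (B : Set V) : Set V :=
  {y | y ∈ Submodule.span (ZMod 2) B ∧ (∀ u ∈ Submodule.span (ZMod 2) B, Ω y u = 0) ∧
    ∃ x₁ ∈ Delta Ω B, ∃ x₂ ∈ Delta Ω B, y = x₁ + x₂}

/-- `x = x₁ + ⋯ + x_s` with all `x_i ∈ Δ` and `Ω(x_i, x_j) = 0`: a `Δ`-decomposition. -/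
def HasDeltaDecomp (Ω : BForm V) (B : Set V) (x : V) (s : ℕ) : Prop :=
  1 ≤ s ∧ ∃ f : Fin s → V, (∀ i, f i ∈ Delta Ω B) ∧
    (∀ i j, i ≠ j → Ω (f i) (f j) = 0) ∧ x = ∑ i, f i

/-- `d(x)`: minimal length of a `Δ`-decomposition of `x`. -/
noncomputable def dval (Ω : BForm V) (B : Set V) (x : V) : ℕ :=
  sInf {s | HasDeltaDecomp Ω B x s}

/-- `Q` is the quadratic form associated with `Ω` and `S` (`Q(b)=1` on `S`, polarization `Ω`). -/
def IsQuadForm (Ω : BForm V) (S : Set V) (Q : V → ZMod 2) : Prop :=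
  (∀ b ∈ S, Q b = 1) ∧ ∀ u v : V, Q (u + v) = Q u + Q v + Ω u v

/-- The tree of type `D_{m,k}`: path `a₁ — ⋯ — a_m` with leaves `c₁, …, c_k` attached to `a_m`. -/
def DmkGraph (m k : ℕ) : SimpleGraph (Fin m ⊕ Fin k) :=
  SimpleGraph.fromRel fun x y =>
    match x, y with
    | Sum.inl i, Sum.inl j => i.val + 1 = j.val
    | Sum.inl i, Sum.inr _ => i.val + 1 = m
    | _, _ => False

/-- The Dynkin tree `E₆`. -/
def E6Graph : SimpleGraph (Fin 6) :=
  SimpleGraph.fromRel fun i j => (i.val, j.val) ∈ [(0,1),(1,2),(2,3),(3,4),(2,5)]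

/-- Two triangles sharing a common edge: four vertices, five edges. -/
def TwoTrianglesGraph : SimpleGraph (Fin 4) :=
  SimpleGraph.fromRel fun i j => (i.val, j.val) ∈ [(0,1),(0,2),(0,3),(1,2),(1,3)]

/-- The cycle of length `n`. -/
def CycleGraph (n : ℕ) : SimpleGraph (Fin n) :=
  SimpleGraph.fromRel fun i j => j.val = (i.val + 1) % n

/-- Membership in the family `F`: type `D_{2,2}`, two triangles sharing an edge,
or a cycle of length at least `4`. -/
def InF {α : Type*} (G : SimpleGraph α) : Prop :=
  Nonempty (G ≃g DmkGraph 2 2) ∨ Nonempty (G ≃g TwoTrianglesGraph) ∨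
    ∃ n, 4 ≤ n ∧ Nonempty (G ≃g CycleGraph n)

/-- `B` is equivalent to a set whose graph is a tree of type `D_{m,k}`. -/
def EquivToDmkTree (Ω : BForm V) (B : Set V) (m k : ℕ) : Prop :=
  ∃ B' : Set V, EquivSets Ω B B' ∧ Nonempty (Gr Ω B' ≃g DmkGraph m k)

/-- `X` is equivalent to a set whose graph is `E₆`. -/
def EquivToE6 (Ω : BForm V) (X : Set V) : Prop :=
  ∃ X' : Set V, EquivSets Ω X X' ∧ Nonempty (Gr Ω X' ≃g E6Graph)

/-- Some subset of `B` is equivalent to a set whose graph is `E₆`. -/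
def HasE6Subgraph (Ω : BForm V) (B : Set V) : Prop :=
  ∃ X ⊆ B, EquivToE6 Ω X

/-- `B` is a basis of `V` (as a set). -/
def IsBasisSet (B : Set V) : Prop :=
  LinearIndependent (ZMod 2) (Subtype.val : B → V) ∧ Submodule.span (ZMod 2) B = ⊤

/-- `B` is equivalent to a set whose graph is a tree containing `E₆` as an induced subgraph. -/
def EquivToE6Tree (Ω : BForm V) (B : Set V) : Prop :=
  ∃ B' : Set V, EquivSets Ω B B' ∧ (Gr Ω B').IsTree ∧
    ∃ X ⊆ B', Nonempty (Gr Ω X ≃g E6Graph)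

/-- `A` is a maximal complete subgraph (maximal clique) of `G`. -/
def IsMaxClique {α : Type*} (G : SimpleGraph α) (A : Set α) : Prop :=
  G.IsClique A ∧ ∀ A', G.IsClique A' → A ⊆ A' → A' = A

namespace TransvectionTrees

variable {Ω : BForm V} {q : V → ZMod 2}

/-- `q` is a quadratic function with polarization `Ω`. -/
def Polarizes (Ω : BForm V) (q : V → ZMod 2) : Prop :=
  ∀ u v : V, q (u + v) = q u + q v + Ω u v

theorem eq_zero_of_ne_one {x : ZMod 2} (h : x ≠ 1) : x = 0 := by
  revert h; revert x; decide

theorem eq_one_of_ne_zero {x : ZMod 2} (h : x ≠ 0) : x = 1 := by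
  revert h; revert x; decide

theorem zmod_two_cases (x : ZMod 2) : x = 0 ∨ x = 1 := by
  revert x; decide

theorem vadd_self (v : V) : v + v = 0 := ZModModule.add_self v

theorem add_add_self (u v : V) : u + v + v = u := by
  rw [add_assoc, vadd_self, add_zero]

theorem Polarizes.map_zero (hq : Polarizes Ω q) : q 0 = 0 := by
  have := hq 0 0
  simpa [CharTwo.add_self_eq_zero] using this

theorem Polarizes.alternating (hq : Polarizes Ω q) (v : V) : Ω v v = 0 := by
  have := hq v v
  rw [vadd_self, hq.map_zero, CharTwo.add_self_eq_zero, zero_add] at this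
  exact this.symm

theorem Polarizes.symm (hq : Polarizes Ω q) (u v : V) : Ω u v = Ω v u := by
  have h1 := hq u v
  have h2 := hq v u
  rw [add_comm v u, h1, add_comm (q v)] at h2
  exact add_left_cancel h2

/-- Linear independence of a subset. -/
abbrev Indep (B : Set V) : Prop := LinearIndepOn (ZMod 2) id B

/-- The span over the two-element field. -/
abbrev spn (B : Set V) : Submodule (ZMod 2) V := Submodule.span (ZMod 2) B

theorem Indep.notMem_span {R : Set V} {b : V} (h : Indep (insert b R)) (hb : b ∉ R) :
    b ∉ spn R :=
  ((linearIndepOn_id_insert hb).1 h).2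

theorem Indep.insert_of {R : Set V} {b : V} (h : Indep R) (hb : b ∉ spn R) :
    Indep (insert b R) := LinearIndepOn.id_insert h hb

theorem notMem_of_notMem_span {R : Set V} {b : V} (hb : b ∉ spn R) : b ∉ R :=
  fun h => hb (Submodule.subset_span h)

theorem Indep.subset {R B : Set V} (h : Indep B) (hR : R ⊆ B) : Indep R :=
  LinearIndepOn.mono h hR

theorem add_notMem_span {R : Set V} {b x : V} (hb : b ∉ spn R) (hx : x ∈ R) :
    b + x ∉ spn R := by
  intro h
  apply hb
  have := (spn R).add_mem h (Submodule.subset_span hx)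
  rwa [add_add_self] at this

/-- A basic move on a linearly independent set, with the unchanged part made explicit. -/
def Move (Ω : BForm V) (B B' : Set V) : Prop :=
  ∃ R a c, Indep R ∧ c ∉ spn R ∧ a ∈ R ∧ Ω a c = 1 ∧ B = insert c R ∧ B' = insert (c + a) R

theorem MoveRel.move {B B' : Set V} (hB : Indep B) (h : MoveRel Ω B B') : Move Ω B B' := by
  obtain ⟨a, c, ha, hc, hac, h1, rfl⟩ := h
  have hins : insert c (B \ {c}) = B := by simp [hc]
  refine ⟨B \ {c}, a, c, hB.subset Set.sdiff_subset, ?_, ⟨ha, hac⟩, h1, hins.symm, rfl⟩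
  apply Indep.notMem_span
  · rwa [hins]
  · simp

theorem Move.moveRel {B B' : Set V} (h : Move Ω B B') : MoveRel Ω B B' := by
  obtain ⟨R, a, c, -, hc, ha, h1, rfl, rfl⟩ := h
  have hcR := notMem_of_notMem_span hc
  refine ⟨a, c, Set.mem_insert_of_mem _ ha, Set.mem_insert _ _, ?_, h1, ?_⟩
  · rintro rfl; exact hcR ha
  · rw [Set.insert_sdiff_of_mem _ (Set.mem_singleton _), Set.sdiff_singleton_eq_self hcR]

theorem Move.symm (hq : Polarizes Ω q) {B B' : Set V} (h : Move Ω B B') : Move Ω B' B := by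
  obtain ⟨R, a, c, hR, hc, ha, h1, rfl, rfl⟩ := h
  refine ⟨R, a, c + a, hR, add_notMem_span hc ha, ha, ?_, rfl, ?_⟩
  · rw [map_add, hq.alternating, add_zero, h1]
  · rw [add_add_self]

theorem Move.indep_right {B B' : Set V} (h : Move Ω B B') : Indep B' := by
  obtain ⟨R, a, c, hR, hc, ha, h1, rfl, rfl⟩ := h
  exact hR.insert_of (add_notMem_span hc ha)

theorem Move.span_eq {B B' : Set V} (h : Move Ω B B') : spn B' = spn B := by
  obtain ⟨R, a, c, hR, hc, ha, h1, rfl, rfl⟩ := h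
  have haR : a ∈ spn R := Submodule.subset_span ha
  apply le_antisymm <;> rw [spn, Submodule.span_le, Set.insert_subset_iff]
  · refine ⟨(spn _).add_mem (Submodule.subset_span (Set.mem_insert _ _)) ?_, ?_⟩
    · exact Submodule.subset_span (Set.mem_insert_of_mem _ ha)
    · exact (Set.subset_insert _ _).trans Submodule.subset_span
  · refine ⟨?_, (Set.subset_insert _ _).trans Submodule.subset_span⟩
    have : c + a + a ∈ spn (insert (c + a) R) :=
      (spn _).add_mem (Submodule.subset_span (Set.mem_insert _ _))
        (Submodule.subset_span (Set.mem_insert_of_mem _ ha))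
    rwa [add_add_self] at this

theorem Move.ncard_eq [Finite V] {B B' : Set V} (h : Move Ω B B') : B'.ncard = B.ncard := by
  obtain ⟨R, a, c, hR, hc, ha, h1, rfl, rfl⟩ := h
  rw [Set.ncard_insert_of_notMem (notMem_of_notMem_span hc),
    Set.ncard_insert_of_notMem (notMem_of_notMem_span (add_notMem_span hc ha))]

theorem q_add_eq_one (hq : Polarizes Ω q) {a c : V} (ha : q a = 1) (hc : q c = 1)
    (h : Ω a c = 1) : q (c + a) = 1 := by
  rw [add_comm, hq, ha, hc, h]; decide

theorem Move.q_eq_one (hq : Polarizes Ω q) {B B' : Set V} (h : Move Ω B B')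
    (hB : ∀ b ∈ B, q b = 1) : ∀ b ∈ B', q b = 1 := by
  obtain ⟨R, a, c, hR, hc, ha, h1, rfl, rfl⟩ := h
  rintro b (rfl | hb)
  · exact q_add_eq_one hq (hB a (Set.mem_insert_of_mem _ ha)) (hB c (Set.mem_insert _ _)) h1
  · exact hB b (Set.mem_insert_of_mem _ hb)

/-- Connectedness of `Gr Ω X`, phrased by cuts. -/
def Conn (Ω : BForm V) (X : Set V) : Prop :=
  ∀ p : V → Prop, (∃ x ∈ X, p x) → (∃ x ∈ X, ¬ p x) →
    ∃ x ∈ X, ∃ y ∈ X, p x ∧ ¬ p y ∧ Ω x y = 1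

theorem Move.conn (hq : Polarizes Ω q) {B B' : Set V} (h : Move Ω B B')
    (hB : Conn Ω B) : Conn Ω B' := by
  classical
  obtain ⟨R, a, c, hR, hc, ha, h1, rfl, rfl⟩ := h
  have hcR := notMem_of_notMem_span hc
  intro p hp hn
  by_contra! hcon
  have hcon' : ∀ x ∈ insert (c + a) R, ∀ y ∈ insert (c + a) R, p x → ¬ p y → Ω x y = 0 :=
    fun x hx y hy h1 h2 => eq_zero_of_ne_one (hcon x hx y hy h1 h2)
  have hac : Ω a (c + a) = 1 := by rw [map_add, hq.alternating, add_zero, h1]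
  have haR : a ∈ insert (c + a) R := Set.mem_insert_of_mem _ ha
  have hcR' : c + a ∈ insert (c + a) R := Set.mem_insert _ _
  have hside : p (c + a) ↔ p a := by
    constructor
    · intro h; by_contra h'
      have := hcon' _ hcR' _ haR h h'
      rw [hq.symm, hac] at this; exact absurd this (by decide)
    · intro h; by_contra h'
      have := hcon' _ haR _ hcR' h h'
      rw [hac] at this; exact absurd this (by decide)
  have hne : ∀ x ∈ R, x ≠ c := fun x hx hxc => hcR (hxc ▸ hx)
  have hp' : ∃ x ∈ insert c R, if x = c then p a else p x := by
    obtain ⟨x, rfl | hx, h⟩ := hp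
    · exact ⟨c, Set.mem_insert _ _, by simpa using hside.1 h⟩
    · exact ⟨x, Set.mem_insert_of_mem _ hx, by simpa [hne x hx] using h⟩
  have hn' : ∃ x ∈ insert c R, ¬ if x = c then p a else p x := by
    obtain ⟨x, rfl | hx, h⟩ := hn
    · exact ⟨c, Set.mem_insert _ _, by simpa using fun h' => h (hside.2 h')⟩
    · exact ⟨x, Set.mem_insert_of_mem _ hx, by simpa [hne x hx] using h⟩
  obtain ⟨x, hx, y, hy, hpx, hpy, hxy⟩ := hB (fun x => if x = c then p a else p x) hp' hn'
  rcases hx with rfl | hx <;> rcases hy with rfl | hy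
  · exact hpy hpx
  · rw [if_pos rfl] at hpx
    rw [if_neg (hne y hy)] at hpy
    have e1 := hcon' _ haR _ (Set.mem_insert_of_mem _ hy) hpx hpy
    have e2 := hcon' _ hcR' _ (Set.mem_insert_of_mem _ hy) (hside.2 hpx) hpy
    rw [map_add, LinearMap.add_apply, e1, add_zero, hxy] at e2
    exact absurd e2 (by decide)
  · rw [if_neg (hne x hx)] at hpx
    rw [if_pos rfl] at hpy
    have e1 := hcon' _ (Set.mem_insert_of_mem _ hx) _ haR hpx hpy
    have e2 := hcon' _ (Set.mem_insert_of_mem _ hx) _ hcR' hpx (fun h => hpy (hside.1 h))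
    rw [map_add, e1, add_zero, hxy] at e2
    exact absurd e2 (by decide)
  · rw [if_neg (hne x hx)] at hpx
    rw [if_neg (hne y hy)] at hpy
    exact hcon _ (Set.mem_insert_of_mem _ hx) _ (Set.mem_insert_of_mem _ hy) hpx hpy hxy

theorem conn_of_connected (hq : Polarizes Ω q) {B : Set V} (h : (Gr Ω B).Connected) :
    Conn Ω B := by
  rintro p ⟨x, hx, hpx⟩ ⟨y, hy, hpy⟩
  obtain ⟨w⟩ := h.preconnected ⟨x, hx⟩ ⟨y, hy⟩
  obtain ⟨d, -, h1, h2⟩ := w.exists_boundary_dart {z | p z.1} hpx hpy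
  refine ⟨d.fst.1, d.fst.2, d.snd.1, d.snd.2, h1, h2, ?_⟩
  have hadj := d.adj
  unfold Gr at hadj
  rcases ((SimpleGraph.fromRel_adj _ _ _).1 hadj).2 with h | h
  · exact h
  · rw [hq.symm]; exact h

/-- The number of vectors in the span of `X` at which `q` takes the value one. -/
noncomputable def onesInSpan (q : V → ZMod 2) (X : Set V) : ℕ :=
  {x | x ∈ spn X ∧ q x = 1}.ncard

/-- A numerical characterization of the bases equivalent to `E₆`. -/
structure IsE6Type (Ω : BForm V) (q : V → ZMod 2) (X : Set V) : Prop where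
  ncard_eq : X.ncard = 6
  conn : Conn Ω X
  ones_eq : onesInSpan q X = 36

/-- `B` contains a subset of type `E₆`. -/
def HasE6Type (Ω : BForm V) (q : V → ZMod 2) (B : Set V) : Prop :=
  ∃ X ⊆ B, IsE6Type Ω q X

theorem IsE6Type.move [Finite V] (hq : Polarizes Ω q) {B B' : Set V} (h : Move Ω B B')
    (hB : IsE6Type Ω q B) : IsE6Type Ω q B' :=
  ⟨h.ncard_eq.trans hB.ncard_eq, h.conn hq hB.conn, by
    rw [onesInSpan, h.span_eq]; exact hB.ones_eq⟩

/-- Linearly independent sets on which `q` is identically one. -/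
structure IsGood (q : V → ZMod 2) (B : Set V) : Prop where
  indep : Indep B
  q_eq : ∀ b ∈ B, q b = 1

theorem IsGood.subset {B R : Set V} (h : IsGood q B) (hR : R ⊆ B) : IsGood q R :=
  ⟨h.indep.subset hR, fun b hb => h.q_eq b (hR hb)⟩

theorem IsGood.move (hq : Polarizes Ω q) {B B' : Set V} (hB : IsGood q B) (h : Move Ω B B') :
    IsGood q B' := ⟨h.indep_right, h.q_eq_one hq hB.q_eq⟩

theorem IsGood.induction (hq : Polarizes Ω q) {P : Set V → Prop}
    (hP : ∀ B B', IsGood q B → Move Ω B B' → P B → P B') {B B' : Set V} (hB : IsGood q B)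
    (h : EquivSets Ω B B') (h0 : P B) : IsGood q B' ∧ P B' := by
  induction h with
  | refl => exact ⟨hB, h0⟩
  | tail _ hm ih =>
    have hmv := MoveRel.move ih.1.indep hm
    exact ⟨ih.1.move hq hmv, hP _ _ ih.1 hmv ih.2⟩

theorem IsGood.equiv (hq : Polarizes Ω q) {B B' : Set V} (hB : IsGood q B)
    (h : EquivSets Ω B B') : IsGood q B' :=
  (hB.induction hq (P := fun _ => True) (fun _ _ _ _ _ => trivial) h trivial).1

theorem EquivSets.symm (hq : Polarizes Ω q) {B B' : Set V} (hB : IsGood q B)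
    (h : EquivSets Ω B B') : EquivSets Ω B' B :=
  (hB.induction hq (P := fun X => EquivSets Ω X B)
    (fun _ _ _ hm hX => Relation.ReflTransGen.head (hm.symm hq).moveRel hX) h
    Relation.ReflTransGen.refl).2

theorem exists_polarizes (hΩ : ∀ x : V, Ω x x = 0) {B : Set V} (hB : Indep B) :
    ∃ q : V → ZMod 2, Polarizes Ω q ∧ IsGood q B := by
  classical
  let b := Module.Basis.extend hB
  let _ : LinearOrder (hB.extend (Set.subset_univ B)) := linearOrderOfSTO WellOrderingRel
  let β : BForm V := b.constr (ZMod 2) fun i => b.constr (ZMod 2) fun j =>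
    if i < j then Ω (b i) (b j) else if i = j then 1 else 0
  have hβ : ∀ i j, β (b i) (b j) = if i < j then Ω (b i) (b j) else if i = j then 1 else 0 := by
    intro i j
    simp only [β, Module.Basis.constr_basis]
  have hsymm : ∀ u v, Ω u v = Ω v u := by
    intro u v
    have h := hΩ (u + v)
    simp only [map_add, LinearMap.add_apply, hΩ, zero_add, add_zero] at h
    exact (CharTwo.add_eq_zero.1 h).symm
  have hsum : β + β.flip = Ω := by
    refine b.ext fun i => b.ext fun j => ?_
    rw [LinearMap.add_apply, LinearMap.add_apply, LinearMap.flip_apply, hβ, hβ]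
    rcases lt_trichotomy i j with h | rfl | h
    · simp [h, h.not_gt, h.ne']
    · simp [hΩ, CharTwo.add_self_eq_zero]
    · simp [h, h.not_gt, h.ne', hsymm]
  refine ⟨fun x => β x x, fun u v => ?_, hB, fun x hx => ?_⟩
  · rw [← hsum]
    simp only [map_add, LinearMap.add_apply, LinearMap.flip_apply]
    ring
  · have hx' : x ∈ hB.extend (Set.subset_univ B) := hB.subset_extend _ hx
    have hbx : b ⟨x, hx'⟩ = x := Module.Basis.extend_apply_self hB ⟨x, hx'⟩
    have := hβ ⟨x, hx'⟩ ⟨x, hx'⟩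
    rw [hbx] at this
    simpa using this

/-- The values `Ω y w` for `w` in a list, as the binary digits of a number. -/
def mask (Ω : BForm V) (y : V) : List V → ℕ
  | [] => 0
  | w :: ws => (Ω y w).val + 2 * mask Ω y ws

/-- The Gram matrix of a list, encoded by its rows above the diagonal. -/
def rows (Ω : BForm V) : List V → List ℕ
  | [] => []
  | w :: ws => mask Ω w ws :: rows Ω ws

/-- All sums of sublists. -/
def sums : List V → List V
  | [] => [0]
  | w :: ws => sums ws ++ (sums ws).map (w + ·)

/-- Counts the vectors `x` in the span of a list with Gram matrix `L` such that `q (y + x) = 1`,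
where `q y` is `e` and `f` encodes the values of `Ω y`. -/
noncomputable def oneCount (L : List Nat) : Nat → Nat → Nat :=
  List.rec (fun e _ => e) (fun r _ ih e f =>
    Nat.add (ih e (Nat.div f 2))
      (ih (Nat.mod (Nat.add (Nat.succ e) f) 2) (Nat.xor (Nat.div f 2) r))) L

theorem oneCount_nil (e f : ℕ) : oneCount [] e f = e := rfl

theorem oneCount_cons (r : ℕ) (L : List ℕ) (e f : ℕ) : oneCount (r :: L) e f =
    oneCount L e (f / 2) + oneCount L ((e + 1 + f) % 2) ((f / 2) ^^^ r) := rfl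

theorem mask_zero (ws : List V) : mask Ω 0 ws = 0 := by
  induction ws with
  | nil => rfl
  | cons w ws ih => simp [mask, ih]

theorem val_add_two_mul_xor (a b : ZMod 2) (m n : ℕ) :
    (a + b).val + 2 * (m ^^^ n) = (a.val + 2 * m) ^^^ (b.val + 2 * n) := by
  have key : ∀ (c : ZMod 2) (k : ℕ), c.val + 2 * k = Nat.bit (decide (c = 1)) k := by
    intro c k
    rcases zmod_two_cases c with rfl | rfl
    · simp [Nat.bit]
    · rw [Nat.bit]; simp [ZMod.val_one, add_comm]
  rw [key, key, key, Nat.xor_bit]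
  congr 1
  revert a b; decide

theorem mask_add (y w : V) (ws : List V) :
    mask Ω (y + w) ws = mask Ω y ws ^^^ mask Ω w ws := by
  induction ws with
  | nil => simp [mask]
  | cons v ws ih =>
    simp only [mask, map_add, LinearMap.add_apply, ih]
    exact val_add_two_mul_xor _ _ _ _

theorem mask_lt (y : V) (ws : List V) : mask Ω y ws < 2 ^ ws.length := by
  induction ws with
  | nil => simp [mask]
  | cons w ws ih =>
    have := ZMod.val_lt (Ω y w)
    simp only [mask, List.length_cons, pow_succ]
    omega

theorem oneCount_rows (hq : Polarizes Ω q) {ws : List V} (h : ∀ w ∈ ws, q w = 1) (y : V) :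
    oneCount (rows Ω ws) (q y).val (mask Ω y ws) =
      (sums ws).countP fun x => q (y + x) = 1 := by
  induction ws generalizing y with
  | nil =>
    rcases zmod_two_cases (q y) with h | h <;> simp [rows, sums, oneCount_nil, h, ZMod.val_one]
  | cons w ws ih =>
    have hw : q w = 1 := h w (by simp)
    have ih' := ih fun x hx => h x (by simp [hx])
    have hlt := ZMod.val_lt (Ω y w)
    have e1 : mask Ω y (w :: ws) / 2 = mask Ω y ws := by
      rw [mask]; omega
    have e2 : ((q y).val + 1 + mask Ω y (w :: ws)) % 2 = (q (y + w)).val := by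
      rw [mask, hq, hw]
      have : ∀ s t : ZMod 2, (s.val + 1 + t.val) % 2 = (s + 1 + t).val := by decide
      rw [← this]; omega
    rw [rows, oneCount_cons, e1, e2, ← mask_add, ih', ih', sums, List.countP_append,
      List.countP_map]
    congr 2
    funext x
    simp [add_assoc]

theorem setOf_mem_cons {α : Type*} (w : α) (ws : List α) : {x | x ∈ w :: ws} = insert w {x | x ∈ ws} := by
  ext; simp

theorem mem_sums {ws : List V} {x : V} : x ∈ sums ws ↔ x ∈ spn {x | x ∈ ws} := by
  induction ws generalizing x with
  | nil => simp [sums]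
  | cons w ws ih =>
    rw [setOf_mem_cons, spn, Submodule.mem_span_insert, sums, List.mem_append, List.mem_map]
    constructor
    · rintro (h | ⟨z, h, rfl⟩)
      · exact ⟨0, x, ih.1 h, by simp⟩
      · exact ⟨1, z, ih.1 h, by simp⟩
    · rintro ⟨a, z, hz, rfl⟩
      rcases zmod_two_cases a with rfl | rfl
      · left; simpa using ih.2 hz
      · right; exact ⟨z, ih.2 hz, by simp⟩

theorem nodup_sums {ws : List V} (hn : ws.Nodup) (h : Indep {x | x ∈ ws}) : (sums ws).Nodup := by
  induction ws with
  | nil => simp [sums]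
  | cons w ws ih =>
    rw [setOf_mem_cons] at h
    obtain ⟨hw, hn⟩ := List.nodup_cons.1 hn
    have hws : Indep {x | x ∈ ws} := h.subset (Set.subset_insert _ _)
    have hw' : w ∉ spn {x | x ∈ ws} := h.notMem_span hw
    rw [sums, List.nodup_append']
    refine ⟨ih hn hws, (List.nodup_map_iff (add_right_injective w)).2 (ih hn hws), ?_⟩
    intro x hx hx'
    obtain ⟨z, hz, rfl⟩ := List.mem_map.1 hx'
    rw [mem_sums] at hx hz
    apply hw'
    have := (spn {x | x ∈ ws}).add_mem hx hz
    rwa [add_add_self] at this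

theorem onesInSpan_eq (hq : Polarizes Ω q) {ws : List V} (hn : ws.Nodup)
    (h : IsGood q {x | x ∈ ws}) : onesInSpan q {x | x ∈ ws} = oneCount (rows Ω ws) 0 0 := by
  classical
  have h0 := oneCount_rows hq (ws := ws) h.q_eq 0
  rw [hq.map_zero, mask_zero, ZMod.val_zero] at h0
  rw [h0, onesInSpan, List.countP_eq_length_filter,
    ← List.toFinset_card_of_nodup ((nodup_sums hn h.indep).filter _), ← Set.ncard_coe_finset]
  congr 1
  ext x
  simp [mem_sums]

/-- `oneCount` for a Gram matrix given without its last row, which is zero. -/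
noncomputable def fastCount (L : List Nat) : Nat → Nat → Nat :=
  List.rec (fun e f => Nat.add e (Nat.mod (Nat.add (Nat.succ e) f) 2)) (fun r _ ih e f =>
    Nat.add (ih e (Nat.div f 2))
      (ih (Nat.mod (Nat.add (Nat.succ e) f) 2) (Nat.xor (Nat.div f 2) r))) L

theorem fastCount_eq (L : List ℕ) (e f : ℕ) : fastCount L e f = oneCount (L ++ [0]) e f := by
  induction L generalizing e f with
  | nil => rfl
  | cons r L ih =>
    rw [List.cons_append, oneCount_cons, ← ih, ← ih]
    rfl

/-- Deletes the `k`-th binary digit. -/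
def delDigit (k m : Nat) : Nat := m % 2 ^ k + m / 2 ^ (k + 1) * 2 ^ k

/-- The `k`-th binary digit. -/
def digit (m k : Nat) : Nat := m / 2 ^ k % 2

/-- Degree of a vertex in the graph on five vertices with the given rows. -/
def degOf (m0 m1 m2 m3 : Nat) : Nat → Nat
  | 0 => digit m0 0 + digit m0 1 + digit m0 2 + digit m0 3
  | 1 => digit m0 0 + digit m1 0 + digit m1 1 + digit m1 2
  | 2 => digit m0 1 + digit m1 0 + digit m2 0 + digit m2 1
  | 3 => digit m0 2 + digit m1 1 + digit m2 0 + digit m3 0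
  | _ => digit m0 3 + digit m1 2 + digit m2 1 + digit m3 0

/-- The five vertices are ordered by increasing degree. -/
def degSorted (m0 m1 m2 m3 : Nat) : Bool :=
  Nat.ble (degOf m0 m1 m2 m3 0) (degOf m0 m1 m2 m3 1) &&
  Nat.ble (degOf m0 m1 m2 m3 1) (degOf m0 m1 m2 m3 2) &&
  Nat.ble (degOf m0 m1 m2 m3 2) (degOf m0 m1 m2 m3 3) &&
  Nat.ble (degOf m0 m1 m2 m3 3) (degOf m0 m1 m2 m3 4)

/-- Adding a vertex with neighbourhood `c` gives `36` ones and creates a vertex of degree two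
at or next to the new vertex. -/
noncomputable def extendsToE6 (m0 m1 m2 m3 c : Nat) : Bool :=
  Nat.beq (fastCount [c, m0, m1, m2, m3] 0 0) 36 &&
  Nat.ble 2 (digit c 0 * (1 + degOf m0 m1 m2 m3 0) + (digit c 1 * (1 + degOf m0 m1 m2 m3 1) +
    (digit c 2 * (1 + degOf m0 m1 m2 m3 2) + (digit c 3 * (1 + degOf m0 m1 m2 m3 3) +
    digit c 4 * (1 + degOf m0 m1 m2 m3 4)))))

/-- Adding to a graph on four vertices an edge whose ends have neighbourhoods `a` and `c` gives
`36` ones and the edge is not a component. -/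
noncomputable def edgeExtends (a c m0 m1 m2 : Nat) : Bool :=
  !(Nat.beq (Nat.add a c) 0) && Nat.beq (fastCount [2 * a + 1, c, m0, m1, m2] 0 0) 36

/-- `edgeExtends` holds after the deletion of one of the five vertices. -/
noncomputable def edgeExtendsSome (m0 m1 m2 m3 c a : Nat) : Bool :=
  edgeExtends (delDigit 0 a) (delDigit 0 c) m1 m2 m3 ||
  edgeExtends (delDigit 1 a) (delDigit 1 c) (delDigit 0 m0) m2 m3 ||
  edgeExtends (delDigit 2 a) (delDigit 2 c) (delDigit 1 m0) (delDigit 0 m1) m3 ||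
  edgeExtends (delDigit 3 a) (delDigit 3 c) (delDigit 2 m0) (delDigit 1 m1) (delDigit 0 m2) ||
  edgeExtends (delDigit 4 a) (delDigit 4 c) (delDigit 3 m0) (delDigit 2 m1) (delDigit 1 m2)

/-- Packs a list of Booleans into a number. -/
def packBools : List Bool → Nat
  | [] => 0
  | b :: L => b.toNat + 2 * packBools L

theorem testBit_packBools (L : List Bool) (i : ℕ) :
    (packBools L).testBit i = (L[i]?).getD false := by
  induction L generalizing i with
  | nil => simp [packBools]
  | cons b L ih =>
    have : packBools (b :: L) = Nat.bit b (packBools L) := by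
      cases b <;> simp [packBools, Nat.bit, add_comm]
    rw [this]
    cases i with
    | zero => simp
    | succ i => rw [Nat.testBit_bit_succ, ih]; simp

/-- The exchange property for a fixed graph on five vertices, given the packed list of
neighbourhoods satisfying `extendsToE6`. -/
noncomputable def exchangeCheckAux (m0 m1 m2 m3 E : Nat) : Bool :=
  (List.range 32).all fun c => !(E.testBit c) || (List.range 32).all fun a =>
    E.testBit a || E.testBit (Nat.xor a c) || edgeExtendsSome m0 m1 m2 m3 c a

/-- The exchange property for a fixed graph on five vertices. -/
noncomputable def exchangeCheck (m0 m1 m2 m3 : Nat) : Bool :=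
  !degSorted m0 m1 m2 m3 ||
    exchangeCheckAux m0 m1 m2 m3 (packBools ((List.range 32).map (extendsToE6 m0 m1 m2 m3)))

set_option maxRecDepth 100000 in
theorem exchangeCheck_all : ((List.range 16).all fun m0 => (List.range 8).all fun m1 =>
    (List.range 4).all fun m2 => (List.range 2).all fun m3 => exchangeCheck m0 m1 m2 m3) = true := by
  decide +kernel

theorem exchange_of_masks {m0 m1 m2 m3 c a : ℕ} (h0 : m0 < 16) (h1 : m1 < 8) (h2 : m2 < 4)
    (h3 : m3 < 2) (hc : c < 32) (ha : a < 32) (hs : degSorted m0 m1 m2 m3 = true)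
    (hE : extendsToE6 m0 m1 m2 m3 c = true) :
    extendsToE6 m0 m1 m2 m3 a = true ∨ extendsToE6 m0 m1 m2 m3 (a ^^^ c) = true ∨
      edgeExtendsSome m0 m1 m2 m3 c a = true := by
  have h := exchangeCheck_all
  simp only [List.all_eq_true, List.mem_range] at h
  have h := h m0 h0 m1 h1 m2 h2 m3 h3
  have hbit : ∀ x < 32, (packBools ((List.range 32).map (extendsToE6 m0 m1 m2 m3))).testBit x =
      extendsToE6 m0 m1 m2 m3 x := by
    intro x hx
    rw [testBit_packBools, List.getElem?_map, List.getElem?_range hx]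
    rfl
  rw [exchangeCheck, hs, Bool.not_true, Bool.false_or, exchangeCheckAux] at h
  simp only [List.all_eq_true, List.mem_range] at h
  have h := h c hc
  rw [hbit c hc, hE, Bool.not_true, Bool.false_or] at h
  simp only [List.all_eq_true, List.mem_range] at h
  have h := h a ha
  have hx : Nat.xor a c < 32 := Nat.xor_lt_two_pow (n := 5) ha hc
  rw [hbit a ha, hbit _ hx, Bool.or_eq_true, Bool.or_eq_true, or_assoc] at h
  exact h

/-- Some element of `X` is adjacent to two others. -/
def HasFork (Ω : BForm V) (X : Set V) : Prop :=
  ∃ u ∈ X, ∃ v ∈ X, ∃ w ∈ X, v ≠ w ∧ Ω u v = 1 ∧ Ω u w = 1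

theorem oneCount_compl (L : List ℕ) {e : ℕ} (he : e < 2) (f : ℕ) :
    oneCount L e f + oneCount L (1 - e) f = 2 ^ L.length := by
  induction L generalizing e f with
  | nil => simp only [oneCount_nil, List.length_nil]; omega
  | cons r L ih =>
    have h2 : (1 - e + 1 + f) % 2 = 1 - (e + 1 + f) % 2 := by omega
    have i1 := ih he (f / 2)
    have i2 := ih (e := (e + 1 + f) % 2) (Nat.mod_lt _ (by norm_num)) ((f / 2) ^^^ r)
    rw [oneCount_cons, oneCount_cons, h2, List.length_cons, pow_succ]
    omega

theorem ones_pair_ne : ∀ a b c d e : ZMod 2,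
    oneCount [a.val, 0, 1 + 2 * (1 + 2 * b.val), c.val + 2 * d.val, e.val, 0] 0 0 ≠ 36 := by
  decide +kernel

theorem ones_triple_ne : ∀ a b c d e f : ZMod 2,
    oneCount [a.val + 2 * b.val, c.val, 0, d.val + 2 * e.val, f.val, 0] 0 0 ≠ 36 := by
  decide +kernel

theorem exists_list_of_set {α : Type*} [Finite α] (X : Set α) :
    ∃ ws : List α, ws.Nodup ∧ X = {x | x ∈ ws} ∧ ws.length = X.ncard := by
  classical
  have := Fintype.ofFinite α
  refine ⟨X.toFinset.toList, Finset.nodup_toList _, by ext; simp, ?_⟩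
  rw [Finset.length_toList, Set.ncard_eq_toFinset_card']

theorem mask_eq_zero {y : V} {ws : List V} (h : ∀ w ∈ ws, Ω y w = 0) : mask Ω y ws = 0 := by
  induction ws with
  | nil => rfl
  | cons w ws ih =>
    rw [mask, h w (by simp), ih fun x hx => h x (by simp [hx])]; rfl

theorem conn_of_hasFork [Finite V] (hq : Polarizes Ω q) {X : Set V} (hX : IsGood q X)
    (hcard : X.ncard = 6) (h36 : onesInSpan q X = 36) (hf : HasFork Ω X) : Conn Ω X := by
  have main : ∀ p : V → Prop, (∃ x ∈ X, p x) → (∃ x ∈ X, ¬ p x) →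
      (∀ x ∈ X, ∀ y ∈ X, p x → ¬ p y → Ω x y = 0) → {x ∈ X | p x}.ncard ≤ 3 → False := by
    rintro p ⟨x0, hx0, hpx0⟩ - hcut h3
    have hsplit : {x ∈ X | p x} ∪ {x ∈ X | ¬ p x} = X := by
      ext x; by_cases hp : p x <;> simp [hp]
    have hdisj : Disjoint {x ∈ X | p x} {x ∈ X | ¬ p x} :=
      Set.disjoint_left.2 fun x h h' => h'.2 h.2
    have hsum := Set.ncard_union_eq hdisj
    rw [hsplit, hcard] at hsum
    have hpos : 0 < {x ∈ X | p x}.ncard := (Set.ncard_pos).2 ⟨x0, hx0, hpx0⟩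
    obtain h1 | h2 | h3 : {x ∈ X | p x}.ncard = 1 ∨ {x ∈ X | p x}.ncard = 2 ∨
      {x ∈ X | p x}.ncard = 3 := by omega
    · obtain ⟨x, hx⟩ := Set.ncard_eq_one.1 h1
      have hxX : x ∈ {x ∈ X | p x} := by rw [hx]; simp
      obtain ⟨ws, hn, hws, hlen⟩ := exists_list_of_set {x ∈ X | ¬ p x}
      have hmem : ∀ w, w ∈ ws ↔ (w ∈ X ∧ ¬ p w) := fun w => by
        have : w ∈ {x ∈ X | ¬ p x} ↔ w ∈ {x | x ∈ ws} := by rw [hws]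
        exact this.symm
      have hXl : X = {z | z ∈ x :: ws} := by
        rw [setOf_mem_cons, ← hws, ← Set.singleton_union, ← hx, hsplit]
      have hnd : (x :: ws).Nodup := List.nodup_cons.2 ⟨fun h => ((hmem x).1 h).2 hxX.2, hn⟩
      have e := onesInSpan_eq hq hnd (hXl ▸ hX)
      rw [← hXl, h36, rows, mask_eq_zero fun w hw => hcut x hxX.1 w ((hmem w).1 hw).1 hxX.2
        ((hmem w).1 hw).2, oneCount_cons] at e
      have hl : (rows Ω ws).length = 5 := by
        have : ∀ l : List V, (rows Ω l).length = l.length := by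
          intro l; induction l with
          | nil => rfl
          | cons _ _ ih => simp [rows, ih]
        rw [this]; omega
      have := oneCount_compl (rows Ω ws) (e := 0) (by norm_num) 0
      rw [hl] at this
      norm_num at e this
      omega
    · obtain ⟨x, y, hxy, hA⟩ := Set.ncard_eq_two.1 h2
      have hxA : x ∈ {x ∈ X | p x} := by rw [hA]; simp
      have hyA : y ∈ {x ∈ X | p x} := by rw [hA]; simp
      have hA' : ∀ z ∈ X, p z → z = x ∨ z = y := fun z hz hp => by
        have : z ∈ {x ∈ X | p x} := ⟨hz, hp⟩
        rwa [hA] at this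
      obtain ⟨u, hu, v, hv, w, hw, hvw, huv, huw⟩ := hf
      have hne : ∀ s t, Ω s t = 1 → s ≠ t := by
        rintro s t hst rfl
        rw [hq.alternating] at hst; exact absurd hst (by decide)
      have hside : ∀ s ∈ X, ∀ t ∈ X, Ω s t = 1 → (p s ↔ p t) := by
        intro s hs t ht hst
        by_cases h1 : p s <;> by_cases h2 : p t <;> simp only [h1, h2]
        · have := hcut s hs t ht h1 h2
          rw [hst] at this; exact absurd this (by decide)
        · have := hcut t ht s hs h2 h1
          rw [hq.symm, hst] at this; exact absurd this (by decide)
      have hpu : ¬ p u := by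
        intro hpu
        have h1 := hA' u hu hpu
        have h2 := hA' v hv ((hside u hu v hv huv).1 hpu)
        have h3 := hA' w hw ((hside u hu w hw huw).1 hpu)
        have n1 := hne _ _ huv
        have n2 := hne _ _ huw
        grind
      have hpv : ¬ p v := fun h => hpu ((hside u hu v hv huv).2 h)
      have hpw : ¬ p w := fun h => hpu ((hside u hu w hw huw).2 h)
      have hn1 := hne _ _ huv
      have hn2 := hne _ _ huw
      have hsub : ({u, v, w} : Set V) ⊆ {x ∈ X | ¬ p x} := by
        rintro z (rfl | rfl | rfl)
        exacts [⟨hu, hpu⟩, ⟨hv, hpv⟩, ⟨hw, hpw⟩]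
      have hc3 : ({u, v, w} : Set V).ncard = 3 := Set.ncard_eq_three.2 ⟨u, v, w, hn1, hn2, hvw, rfl⟩
      have hd := Set.ncard_sdiff_add_ncard_of_subset hsub
      obtain ⟨t, ht⟩ := Set.ncard_eq_one.1
        (show ({x ∈ X | ¬ p x} \ {u, v, w}).ncard = 1 by omega)
      have htm : t ∈ ({x ∈ X | ¬ p x} \ {u, v, w} : Set V) := by rw [ht]; simp
      obtain ⟨⟨htX, hpt⟩, htn⟩ := htm
      simp only [Set.mem_insert_iff, Set.mem_singleton_iff, not_or] at htn
      have hXl : X = {z | z ∈ [x, y, u, v, w, t]} := by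
        ext z
        simp only [Set.mem_ofPred_eq, List.mem_cons, List.not_mem_nil, or_false]
        constructor
        · intro hz
          by_cases hp : p z
          · rcases hA' z hz hp with h | h <;> simp [h]
          · by_cases hz' : z ∈ ({u, v, w} : Set V)
            · simp only [Set.mem_insert_iff, Set.mem_singleton_iff] at hz'
              tauto
            · have : z ∈ ({x ∈ X | ¬ p x} \ {u, v, w} : Set V) := ⟨⟨hz, hp⟩, hz'⟩
              rw [ht, Set.mem_singleton_iff] at this
              tauto
        · rintro (rfl | rfl | rfl | rfl | rfl | rfl)
          exacts [hxA.1, hyA.1, hu, hv, hw, htX]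
      have hpq : ∀ s t, p s → ¬ p t → s ≠ t := by
        rintro s t h1 h2 rfl; exact h2 h1
      have hnd : [x, y, u, v, w, t].Nodup := by
        have hx := hpq x
        have hy := hpq y
        have a1 := hxA.2
        have a2 := hyA.2
        simp only [List.nodup_cons, List.mem_cons, List.not_mem_nil, not_or]
        grind
      have e := onesInSpan_eq hq hnd (hXl ▸ hX)
      rw [← hXl, h36] at e
      have cx : ∀ z ∈ X, ¬ p z → Ω x z = 0 := fun z hz hp => hcut x hxA.1 z hz hxA.2 hp
      have cy : ∀ z ∈ X, ¬ p z → Ω y z = 0 := fun z hz hp => hcut y hyA.1 z hz hyA.2 hp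
      simp only [rows, mask, cx u hu hpu, cx v hv hpv, cx w hw hpw, cx t htX hpt, cy u hu hpu,
        cy v hv hpv, cy w hw hpw, cy t htX hpt, huv, huw, ZMod.val_zero, ZMod.val_one, mul_zero,
        add_zero] at e
      exact ones_pair_ne _ _ _ _ _ e.symm
    · obtain ⟨x, y, z, hxy, hxz, hyz, hA⟩ := Set.ncard_eq_three.1 h3
      obtain ⟨u, v, w, huv, huw, hvw, hA'⟩ := Set.ncard_eq_three.1
        (show {x ∈ X | ¬ p x}.ncard = 3 by omega)
      have m1 : ∀ s ∈ ({x, y, z} : Set V), s ∈ X ∧ p s := fun s hs => by rwa [← hA] at hs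
      have m2 : ∀ s ∈ ({u, v, w} : Set V), s ∈ X ∧ ¬ p s := fun s hs => by rwa [← hA'] at hs
      have hXl : X = {s | s ∈ [x, y, z, u, v, w]} := by
        rw [← hsplit, hA, hA']
        ext s
        simp only [Set.mem_union, Set.mem_insert_iff, Set.mem_singleton_iff, Set.mem_ofPred_eq,
          List.mem_cons, List.not_mem_nil]
        tauto
      have c0 : ∀ s ∈ ({x, y, z} : Set V), ∀ t ∈ ({u, v, w} : Set V), Ω s t = 0 :=
        fun s hs t ht => hcut s (m1 s hs).1 t (m2 t ht).1 (m1 s hs).2 (m2 t ht).2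
      have n0 : ∀ s ∈ ({x, y, z} : Set V), ∀ t ∈ ({u, v, w} : Set V), s ≠ t := by
        rintro s hs t ht rfl; exact (m2 s ht).2 (m1 s hs).2
      simp only [Set.mem_insert_iff, Set.mem_singleton_iff, forall_eq_or_imp, forall_eq] at c0 n0
      have hnd : [x, y, z, u, v, w].Nodup := by
        simp only [List.nodup_cons, List.mem_cons, List.not_mem_nil, not_or]
        grind
      have e := onesInSpan_eq hq hnd (hXl ▸ hX)
      rw [← hXl, h36] at e
      simp only [rows, mask, c0, ZMod.val_zero, mul_zero, add_zero] at e
      exact ones_triple_ne _ _ _ _ _ _ e.symm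
  intro p hp hn
  by_contra! hcon
  have hcut : ∀ x ∈ X, ∀ y ∈ X, p x → ¬ p y → Ω x y = 0 :=
    fun x hx y hy h1 h2 => eq_zero_of_ne_one (hcon x hx y hy h1 h2)
  have hsplit : {x ∈ X | p x} ∪ {x ∈ X | ¬ p x} = X := by
    ext x; by_cases hp : p x <;> simp [hp]
  have hdisj : Disjoint {x ∈ X | p x} {x ∈ X | ¬ p x} :=
    Set.disjoint_left.2 fun x h h' => h'.2 h.2
  have hsum := Set.ncard_union_eq hdisj
  rw [hsplit, hcard] at hsum
  rcases le_or_gt {x ∈ X | p x}.ncard 3 with h | h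
  · exact main p hp hn hcut h
  · refine main (fun x => ¬ p x) hn (by simpa using hp) ?_ (by omega)
    intro x hx y hy h1 h2
    rw [hq.symm]
    exact hcut y hy x hx (not_not.1 h2) h1

/-- The number of neighbours of `z` in `Z`. -/
def degIn (Ω : BForm V) (Z : Finset V) (z : V) : ℕ := ∑ w ∈ Z, (Ω z w).val

/-- A weight which is at least two if and only if `c` belongs to a fork or a path of length two
in `insert c Z`. -/
def forkWeight (Ω : BForm V) (Z : Finset V) (c : V) : ℕ :=
  ∑ z ∈ Z, (Ω c z).val * (1 + degIn Ω Z z)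

theorem eq_one_of_val_ne_zero {x : ZMod 2} (h : x.val ≠ 0) : x = 1 := by
  revert h; revert x; decide

theorem two_le_forkWeight {Z : Finset V} {c : V} (hc : c ∉ Z)
    (hcard : 2 ≤ Z.card) (h : Conn Ω (insert c (Z : Set V))) : 2 ≤ forkWeight Ω Z c := by
  classical
  have hne : ∀ z ∈ Z, z ≠ c := fun z hz hzc => hc (hzc ▸ hz)
  obtain ⟨z1, hz1⟩ : Z.Nonempty := Finset.card_pos.1 (by omega)
  obtain ⟨x, -, z, hz, rfl, hzx, hxz⟩ := h (· = c) ⟨c, Set.mem_insert _ _, rfl⟩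
    ⟨z1, Set.mem_insert_of_mem _ hz1, hne z1 hz1⟩
  have hz : z ∈ Z := hz.resolve_left hzx
  obtain ⟨z2, hz2, hz2z⟩ := Finset.exists_mem_ne (s := Z) (by omega) z
  obtain ⟨s, -, t, ht, hs, htn, hst⟩ := h (fun y => y = x ∨ y = z) ⟨x, Set.mem_insert _ _, .inl rfl⟩
    ⟨z2, Set.mem_insert_of_mem _ hz2, by simp [hne z2 hz2, hz2z]⟩
  rw [not_or] at htn
  have htZ : t ∈ Z := ht.resolve_left htn.1
  rw [forkWeight, ← Finset.add_sum_erase _ _ hz, hxz, ZMod.val_one, one_mul]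
  rcases hs with rfl | rfl
  · have : (Ω s t).val * (1 + degIn Ω Z t) ≤
        ∑ w ∈ Z.erase z, (Ω s w).val * (1 + degIn Ω Z w) :=
      Finset.single_le_sum (f := fun w => (Ω s w).val * (1 + degIn Ω Z w))
        (fun _ _ => Nat.zero_le _) (Finset.mem_erase.2 ⟨htn.2, htZ⟩)
    rw [hst, ZMod.val_one] at this
    omega
  · have : (Ω s t).val ≤ degIn Ω Z s :=
      Finset.single_le_sum (f := fun w => (Ω s w).val) (fun _ _ => Nat.zero_le _) htZ
    rw [hst, ZMod.val_one] at this
    omega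

theorem hasFork_of_two_le_forkWeight (hq : Polarizes Ω q) {Z : Finset V} {c : V} (hc : c ∉ Z)
    (h : 2 ≤ forkWeight Ω Z c) : HasFork Ω (insert c (Z : Set V)) := by
  classical
  obtain ⟨z, hz, hz0⟩ := Finset.exists_ne_zero_of_sum_ne_zero (s := Z)
    (f := fun z => (Ω c z).val * (1 + degIn Ω Z z)) (by rw [forkWeight] at h; omega)
  have hcz : Ω c z = 1 := eq_one_of_val_ne_zero (left_ne_zero_of_mul hz0)
  have hzc : Ω z c = 1 := by rw [hq.symm]; exact hcz
  by_cases hd : degIn Ω Z z = 0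
  · rw [forkWeight, ← Finset.add_sum_erase _ _ hz, hcz, hd, ZMod.val_one] at h
    obtain ⟨t, ht, ht0⟩ := Finset.exists_ne_zero_of_sum_ne_zero (s := Z.erase z)
      (f := fun z => (Ω c z).val * (1 + degIn Ω Z z)) (by omega)
    obtain ⟨htz, htZ⟩ := Finset.mem_erase.1 ht
    exact ⟨c, Set.mem_insert _ _, z, Set.mem_insert_of_mem _ hz, t, Set.mem_insert_of_mem _ htZ,
      htz.symm, hcz, eq_one_of_val_ne_zero (left_ne_zero_of_mul ht0)⟩
  · obtain ⟨t, ht, ht0⟩ := Finset.exists_ne_zero_of_sum_ne_zero hd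
    exact ⟨z, Set.mem_insert_of_mem _ hz, c, Set.mem_insert _ _, t, Set.mem_insert_of_mem _ ht,
      fun h => hc (h ▸ ht), hzc, eq_one_of_val_ne_zero ht0⟩

theorem delDigit_mask (k : ℕ) (y : V) (ws : List V) :
    delDigit k (mask Ω y ws) = mask Ω y (ws.eraseIdx k) := by
  induction k generalizing ws with
  | zero =>
    cases ws with
    | nil => simp [delDigit, mask]
    | cons w ws =>
      have := ZMod.val_lt (Ω y w)
      simp only [delDigit, mask, List.eraseIdx_zero, List.tail_cons]
      norm_num
      omega
  | succ k ih =>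
    cases ws with
    | nil => simp [delDigit, mask]
    | cons w ws =>
      have hlt := ZMod.val_lt (Ω y w)
      rw [List.eraseIdx_cons_succ, mask, mask, ← ih, delDigit, delDigit]
      have e1 : ((Ω y w).val + 2 * mask Ω y ws) / 2 = mask Ω y ws := by omega
      have e2 : ((Ω y w).val + 2 * mask Ω y ws) % 2 = (Ω y w).val := by omega
      rw [pow_succ' 2 (k + 1), ← Nat.div_div_eq_div_mul, e1, pow_succ' 2 k, Nat.mod_mul, e1, e2]
      ring

theorem isE6Type_of_list [Finite V] (hq : Polarizes Ω q) {ws : List V} (hn : ws.Nodup)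
    (hl : ws.length = 6) (hg : IsGood q {x | x ∈ ws}) (h36 : oneCount (rows Ω ws) 0 0 = 36)
    (hf : HasFork Ω {x | x ∈ ws}) : IsE6Type Ω q {x | x ∈ ws} := by
  classical
  have hcard : {x | x ∈ ws}.ncard = 6 := by
    rw [← hl, ← List.toFinset_card_of_nodup hn, ← Set.ncard_coe_finset]
    congr 1; ext; simp
  have h36' := (onesInSpan_eq hq hn hg).trans h36
  exact ⟨hcard, conn_of_hasFork hq hg hcard h36' hf, h36'⟩

theorem isE6Type_of_edgeExtends [Finite V] (hq : Polarizes Ω q) {a c w0 w1 w2 w3 : V}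
    (hn : [a, c, w0, w1, w2, w3].Nodup) (hg : IsGood q {x | x ∈ [a, c, w0, w1, w2, w3]})
    (h1 : Ω a c = 1)
    (h : edgeExtends (mask Ω a [w0, w1, w2, w3]) (mask Ω c [w0, w1, w2, w3])
      (mask Ω w0 [w1, w2, w3]) (mask Ω w1 [w2, w3]) (mask Ω w2 [w3]) = true) :
    IsE6Type Ω q {x | x ∈ [a, c, w0, w1, w2, w3]} := by
  rw [edgeExtends, Bool.and_eq_true, Nat.beq_eq, fastCount_eq] at h
  obtain ⟨hne, h36⟩ := h
  refine isE6Type_of_list hq hn rfl hg ?_ ?_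
  · rw [rows, mask, h1, ZMod.val_one, add_comm]
    exact h36
  · have key : ∀ y, mask Ω y [w0, w1, w2, w3] ≠ 0 → ∃ w ∈ [w0, w1, w2, w3], Ω y w = 1 := by
      intro y hy
      by_contra! hcon
      exact hy (mask_eq_zero fun w hw => eq_zero_of_ne_one (hcon w hw))
    have hor : mask Ω a [w0, w1, w2, w3] ≠ 0 ∨ mask Ω c [w0, w1, w2, w3] ≠ 0 := by
      by_contra! hcon
      rw [hcon.1, hcon.2] at hne
      exact absurd hne (by decide)
    rw [List.nodup_cons, List.nodup_cons] at hn
    rcases hor with h | h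
    · obtain ⟨w, hw, e⟩ := key a h
      exact ⟨a, by simp, c, by simp, w, List.mem_cons_of_mem _ (List.mem_cons_of_mem _ hw),
        fun h => hn.2.1 (h ▸ hw), h1, e⟩
    · obtain ⟨w, hw, e⟩ := key c h
      exact ⟨c, by simp, a, by simp, w, List.mem_cons_of_mem _ (List.mem_cons_of_mem _ hw),
        fun h => hn.1 (h ▸ List.mem_cons_of_mem _ hw), by rw [hq.symm]; exact h1, e⟩

theorem exists_sorted_list {α : Type*} [DecidableEq α] (Z : Finset α) (d : α → ℕ) :
    ∃ ws : List α, ws.Nodup ∧ ws.toFinset = Z ∧ ws.Pairwise fun x y => d x ≤ d y := by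
  refine ⟨Z.toList.insertionSort fun x y => d x ≤ d y, ?_, ?_, ?_⟩
  · exact (List.perm_insertionSort _ _).nodup_iff.2 Z.nodup_toList
  · rw [List.toFinset_eq_of_perm _ _ (List.perm_insertionSort _ _), Finset.toList_toFinset]
  · have : Std.Total fun x y => d x ≤ d y := ⟨fun x y => le_total _ _⟩
    have : IsTrans α fun x y => d x ≤ d y := ⟨fun x y z => le_trans⟩
    exact List.pairwise_insertionSort _ _

theorem exchange [Finite V] (hq : Polarizes Ω q) {Z : Set V} {a c : V}
    (hg : IsGood q (insert a (insert c Z))) (hg' : IsGood q (insert (c + a) Z))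
    (hcard : Z.ncard = 5) (haZ : a ∉ Z) (hcZ : c ∉ Z)
    (hac : a ≠ c) (h1 : Ω a c = 1) (hE : IsE6Type Ω q (insert c Z)) :
    IsE6Type Ω q (insert a Z) ∨ IsE6Type Ω q (insert (c + a) Z) ∨
      ∃ z ∈ Z, IsE6Type Ω q (insert a (insert c (Z \ {z}))) := by
  classical
  have := Fintype.ofFinite V
  have hcaZ : c + a ∉ Z := by
    intro h
    have hc : c ∉ spn (insert a Z) := by
      refine Indep.notMem_span ?_ (by simp [hac.symm, hcZ])
      rw [Set.insert_comm]; exact hg.indep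
    apply hc
    have := (spn (insert a Z)).add_mem (Submodule.subset_span (Set.mem_insert_of_mem _ h))
      (Submodule.subset_span (Set.mem_insert a Z))
    rwa [add_add_self] at this
  obtain ⟨Zf, rfl⟩ : ∃ Zf : Finset V, (Zf : Set V) = Z := ⟨Z.toFinset, by simp⟩
  obtain ⟨ws, hn, hws, hs⟩ := exists_sorted_list Zf (degIn Ω Zf)
  have hlen : ws.length = 5 := by
    rw [← List.toFinset_card_of_nodup hn, hws, ← Set.ncard_coe_finset, hcard]
  match ws, hlen with
  | [z0, z1, z2, z3, z4], _ =>
  have hset : ∀ x, insert x (Zf : Set V) = {y | y ∈ [x, z0, z1, z2, z3, z4]} := by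
    intro x; ext y; simp [← hws]
  have hnd : ∀ x, x ∉ (Zf : Set V) → [x, z0, z1, z2, z3, z4].Nodup := by
    intro x hx
    refine List.nodup_cons.2 ⟨?_, hn⟩
    rwa [← List.mem_toFinset, hws]
  have hsum : ∀ f : V → ℕ, ∑ z ∈ Zf, f z = f z0 + (f z1 + (f z2 + (f z3 + f z4))) := by
    intro f
    rw [← hws, List.sum_toFinset _ hn]
    simp
  have v01 := ZMod.val_lt (Ω z0 z1)
  have v02 := ZMod.val_lt (Ω z0 z2)
  have v03 := ZMod.val_lt (Ω z0 z3)
  have v04 := ZMod.val_lt (Ω z0 z4)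
  have v12 := ZMod.val_lt (Ω z1 z2)
  have v13 := ZMod.val_lt (Ω z1 z3)
  have v14 := ZMod.val_lt (Ω z1 z4)
  have v23 := ZMod.val_lt (Ω z2 z3)
  have v24 := ZMod.val_lt (Ω z2 z4)
  have v34 := ZMod.val_lt (Ω z3 z4)
  have d0 : degIn Ω Zf z0 = degOf (mask Ω z0 [z1, z2, z3, z4]) (mask Ω z1 [z2, z3, z4])
      (mask Ω z2 [z3, z4]) (mask Ω z3 [z4]) 0 := by
    simp only [degIn, hsum, hq.alternating, degOf, digit, mask, ZMod.val_zero]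
    omega
  have d1 : degIn Ω Zf z1 = degOf (mask Ω z0 [z1, z2, z3, z4]) (mask Ω z1 [z2, z3, z4])
      (mask Ω z2 [z3, z4]) (mask Ω z3 [z4]) 1 := by
    simp only [degIn, hsum, hq.alternating, degOf, digit, mask, ZMod.val_zero, hq.symm z1 z0]
    omega
  have d2 : degIn Ω Zf z2 = degOf (mask Ω z0 [z1, z2, z3, z4]) (mask Ω z1 [z2, z3, z4])
      (mask Ω z2 [z3, z4]) (mask Ω z3 [z4]) 2 := by
    simp only [degIn, hsum, hq.alternating, degOf, digit, mask, ZMod.val_zero, hq.symm z2 z0,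
      hq.symm z2 z1]
    omega
  have d3 : degIn Ω Zf z3 = degOf (mask Ω z0 [z1, z2, z3, z4]) (mask Ω z1 [z2, z3, z4])
      (mask Ω z2 [z3, z4]) (mask Ω z3 [z4]) 3 := by
    simp only [degIn, hsum, hq.alternating, degOf, digit, mask, ZMod.val_zero, hq.symm z3 z0,
      hq.symm z3 z1, hq.symm z3 z2]
    omega
  have d4 : degIn Ω Zf z4 = degOf (mask Ω z0 [z1, z2, z3, z4]) (mask Ω z1 [z2, z3, z4])
      (mask Ω z2 [z3, z4]) (mask Ω z3 [z4]) 4 := by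
    simp only [degIn, hsum, hq.alternating, degOf, digit, mask, ZMod.val_zero, hq.symm z4 z0,
      hq.symm z4 z1, hq.symm z4 z2, hq.symm z4 z3]
    omega
  have hsorted : degSorted (mask Ω z0 [z1, z2, z3, z4]) (mask Ω z1 [z2, z3, z4])
      (mask Ω z2 [z3, z4]) (mask Ω z3 [z4]) = true := by
    simp only [List.pairwise_cons, List.mem_cons, List.not_mem_nil, or_false, forall_eq_or_imp,
      forall_eq] at hs
    simp only [degSorted, Bool.and_eq_true, Nat.ble_eq, ← d0, ← d1, ← d2, ← d3, ← d4]
    tauto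
  have hiff : ∀ x, extendsToE6 (mask Ω z0 [z1, z2, z3, z4]) (mask Ω z1 [z2, z3, z4])
      (mask Ω z2 [z3, z4]) (mask Ω z3 [z4]) (mask Ω x [z0, z1, z2, z3, z4]) = true ↔
      oneCount (rows Ω [x, z0, z1, z2, z3, z4]) 0 0 = 36 ∧ 2 ≤ forkWeight Ω Zf x := by
    intro x
    rw [extendsToE6, Bool.and_eq_true, Nat.beq_eq, Nat.ble_eq, fastCount_eq, forkWeight, hsum,
      d0, d1, d2, d3, d4]
    have x0 := ZMod.val_lt (Ω x z0)
    have x1 := ZMod.val_lt (Ω x z1)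
    have x2 := ZMod.val_lt (Ω x z2)
    have x3 := ZMod.val_lt (Ω x z3)
    have x4 := ZMod.val_lt (Ω x z4)
    have e0 : digit (mask Ω x [z0, z1, z2, z3, z4]) 0 = (Ω x z0).val := by
      simp only [digit, mask]; omega
    have e1 : digit (mask Ω x [z0, z1, z2, z3, z4]) 1 = (Ω x z1).val := by
      simp only [digit, mask]; omega
    have e2 : digit (mask Ω x [z0, z1, z2, z3, z4]) 2 = (Ω x z2).val := by
      simp only [digit, mask]; omega
    have e3 : digit (mask Ω x [z0, z1, z2, z3, z4]) 3 = (Ω x z3).val := by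
      simp only [digit, mask]; omega
    have e4 : digit (mask Ω x [z0, z1, z2, z3, z4]) 4 = (Ω x z4).val := by
      simp only [digit, mask]; omega
    rw [e0, e1, e2, e3, e4]
    exact Iff.rfl
  have hext : ∀ x, x ∉ (Zf : Set V) → IsGood q (insert x (Zf : Set V)) →
      extendsToE6 (mask Ω z0 [z1, z2, z3, z4]) (mask Ω z1 [z2, z3, z4])
      (mask Ω z2 [z3, z4]) (mask Ω z3 [z4]) (mask Ω x [z0, z1, z2, z3, z4]) = true →
      IsE6Type Ω q (insert x (Zf : Set V)) := by
    intro x hx hgx h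
    obtain ⟨h36, hw⟩ := (hiff x).1 h
    have hf := hasFork_of_two_le_forkWeight hq (mod_cast hx) hw
    rw [hset] at hgx hf ⊢
    exact isE6Type_of_list hq (hnd x hx) rfl hgx h36 hf
  have hgc : IsGood q (insert c (Zf : Set V)) := hg.subset (Set.subset_insert _ _)
  have hga : IsGood q (insert a (Zf : Set V)) :=
    hg.subset (Set.insert_subset_insert (Set.subset_insert _ _))
  have hEc : extendsToE6 (mask Ω z0 [z1, z2, z3, z4]) (mask Ω z1 [z2, z3, z4])
      (mask Ω z2 [z3, z4]) (mask Ω z3 [z4]) (mask Ω c [z0, z1, z2, z3, z4]) = true := by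
    refine (hiff c).2 ⟨?_, two_le_forkWeight (mod_cast hcZ) ?_ hE.conn⟩
    · rw [← onesInSpan_eq hq (hnd c hcZ) (hset c ▸ hgc), ← hset]
      exact hE.ones_eq
    · rw [← Set.ncard_coe_finset, hcard]; norm_num
  rcases exchange_of_masks (mask_lt z0 [z1, z2, z3, z4]) (mask_lt z1 [z2, z3, z4])
    (mask_lt z2 [z3, z4]) (mask_lt z3 [z4]) (mask_lt c [z0, z1, z2, z3, z4])
    (mask_lt a [z0, z1, z2, z3, z4]) hsorted hEc with h | h | h
  · exact .inl (hext a haZ hga h)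
  · rw [← mask_add, add_comm] at h
    exact .inr (.inl (hext _ hcaZ hg' h))
  · right; right
    have hmem : ∀ y, y ∈ Zf ↔ y ∈ [z0, z1, z2, z3, z4] := by
      intro y; rw [← hws, List.mem_toFinset]
    have hfinal : ∀ z w0 w1 w2 w3 : V, [z, w0, w1, w2, w3].Perm [z0, z1, z2, z3, z4] →
        edgeExtends (mask Ω a [w0, w1, w2, w3]) (mask Ω c [w0, w1, w2, w3])
          (mask Ω w0 [w1, w2, w3]) (mask Ω w1 [w2, w3]) (mask Ω w2 [w3]) = true →
        ∃ z ∈ (Zf : Set V), IsE6Type Ω q (insert a (insert c ((Zf : Set V) \ {z}))) := by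
      intro z w0 w1 w2 w3 hp he
      have hmem' : ∀ y, y ∈ (Zf : Set V) ↔ y ∈ [z, w0, w1, w2, w3] := by
        intro y; rw [hp.mem_iff, ← hmem, Finset.mem_coe]
      have hn' := hp.nodup_iff.2 hn
      have hzw := (List.nodup_cons.1 hn').1
      have hsub : ∀ y ∈ [w0, w1, w2, w3], y ∈ (Zf : Set V) := fun y hy =>
        (hmem' y).2 (List.mem_cons_of_mem _ hy)
      have heq : insert a (insert c ((Zf : Set V) \ {z})) =
          {x | x ∈ [a, c, w0, w1, w2, w3]} := by
        rw [setOf_mem_cons, setOf_mem_cons]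
        congr 2
        ext y
        rw [Set.mem_sdiff, hmem', Set.mem_singleton_iff, List.mem_cons, Set.mem_ofPred_eq]
        constructor
        · rintro ⟨h | h, h'⟩
          exacts [absurd h h', h]
        · intro h
          exact ⟨.inr h, fun e => hzw (e ▸ h)⟩
      refine ⟨z, (hmem' z).2 (by simp), ?_⟩
      rw [heq]
      refine isE6Type_of_edgeExtends hq ?_ ?_ h1 he
      · refine List.nodup_cons.2 ⟨?_, List.nodup_cons.2 ⟨fun h => hcZ (hsub c h),
          (List.nodup_cons.1 hn').2⟩⟩
        rintro (_ | ⟨_, h⟩)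
        · exact hac rfl
        · exact haZ (hsub a h)
      · rw [← heq]
        exact hg.subset (Set.insert_subset_insert (Set.insert_subset_insert Set.sdiff_subset))
    simp only [edgeExtendsSome, Bool.or_eq_true, delDigit_mask, List.eraseIdx_zero,
      List.eraseIdx_cons_succ, List.tail_cons] at h
    rcases h with (((h | h) | h) | h) | h
    · exact hfinal _ _ _ _ _ (List.Perm.refl _) h
    · exact hfinal z1 z0 z2 z3 z4 (by grind) h
    · exact hfinal z2 z0 z1 z3 z4 (by grind) h
    · exact hfinal z3 z0 z1 z2 z4 (by grind) h
    · exact hfinal z4 z0 z1 z2 z3 (by grind) h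

theorem HasE6Type.move [Finite V] (hq : Polarizes Ω q) {B B' : Set V} (hB : IsGood q B)
    (h : Move Ω B B') (hE : HasE6Type Ω q B) : HasE6Type Ω q B' := by
  have hB' := hB.move hq h
  obtain ⟨R, a, c, hR, hc, ha, h1, rfl, rfl⟩ := h
  have hcR := notMem_of_notMem_span hc
  obtain ⟨X, hX, hXE⟩ := hE
  by_cases hcX : c ∈ X
  swap
  · exact ⟨X, fun x hx => Set.mem_insert_of_mem _
      ((hX hx).resolve_left fun h => hcX (h ▸ hx)), hXE⟩
  have hins : insert c (X \ {c}) = X := by simp [hcX]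
  have hZR : X \ {c} ⊆ R := fun x hx => (hX hx.1).resolve_left hx.2
  have hcZ : c ∉ X \ {c} := by simp
  generalize X \ {c} = Z at hins hZR hcZ
  subst hins
  by_cases haZ : a ∈ Z
  · refine ⟨insert (c + a) Z, Set.insert_subset_insert hZR, hXE.move hq ?_⟩
    exact ⟨Z, a, c, hR.subset hZR, fun h => hc (Submodule.span_mono hZR h), haZ, h1, rfl, rfl⟩
  have hZ5 : Z.ncard = 5 := by
    have := hXE.ncard_eq
    rw [Set.ncard_insert_of_notMem hcZ] at this
    omega
  have hac : a ≠ c := fun h => hcR (h ▸ ha)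
  have haZR : insert a Z ⊆ R := Set.insert_subset ha hZR
  have hacZ : insert a (insert c Z) ⊆ insert c R := by
    rw [Set.insert_comm]
    exact Set.insert_subset_insert haZR
  rcases exchange hq (hB.subset hacZ) (hB'.subset (Set.insert_subset_insert hZR)) hZ5 haZ hcZ hac h1
    hXE with h | h | ⟨z, hz, h⟩
  · exact ⟨_, haZR.trans (Set.subset_insert _ _), h⟩
  · exact ⟨_, Set.insert_subset_insert hZR, h⟩
  · have hsub : insert a (Z \ {z}) ⊆ R := (Set.insert_subset_insert Set.sdiff_subset).trans haZR
    refine ⟨insert (c + a) (insert a (Z \ {z})), Set.insert_subset_insert hsub,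
      h.move hq ⟨insert a (Z \ {z}), a, c, hR.subset hsub,
        fun h => hc (Submodule.span_mono hsub h), Set.mem_insert _ _, h1, Set.insert_comm _ _ _,
        rfl⟩⟩

/-- A family with the Gram matrix of the tree `D_{m,k}`: the path is `a 0, …, a (m - 1)` and the
leaves attached to its end form the set `C`. -/
structure IsDShape (Ω : BForm V) (m : ℕ) (a : ℕ → V) (C : Set V) : Prop where
  injOn : ∀ i < m, ∀ j < m, a i = a j → i = j
  notMem : ∀ i < m, a i ∉ C
  nonempty : C.Nonempty
  path : ∀ i < m, ∀ j < m, Ω (a i) (a j) = if i + 1 = j ∨ j + 1 = i then 1 else 0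
  leaf : ∀ i < m, ∀ c ∈ C, Ω (a i) c = if i + 1 = m then 1 else 0
  leaves : ∀ c ∈ C, ∀ d ∈ C, Ω c d = 0
  pos : 1 ≤ m
  small : m = 1 → C.Subsingleton

/-- The vertex set of a tree of type `D_{m,k}`. -/
def dSet {α : Type*} (m : ℕ) (a : ℕ → α) (C : Set α) : Set α := a '' Set.Iio m ∪ C

/-- `x` lies at distance `k` from the end of the path. -/
def AtLevel {α : Type*} (m : ℕ) (a : ℕ → α) (C : Set α) (k : ℕ) (x : α) : Prop :=
  (k < m ∧ x = a k) ∨ (k = m ∧ x ∈ C)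

theorem mem_dSet {α : Type*} {m : ℕ} {a : ℕ → α} {C : Set α} {x : α} :
    x ∈ dSet m a C ↔ ∃ k, AtLevel m a C k x := by
  constructor
  · rintro (⟨k, hk, rfl⟩ | h)
    · exact ⟨k, .inl ⟨hk, rfl⟩⟩
    · exact ⟨m, .inr ⟨rfl, h⟩⟩
  · rintro ⟨k, ⟨hk, rfl⟩ | ⟨-, h⟩⟩
    · exact .inl ⟨k, hk, rfl⟩
    · exact .inr h

theorem AtLevel.mem {α : Type*} {m : ℕ} {a : ℕ → α} {C : Set α} {k : ℕ} {x : α} (h : AtLevel m a C k x) :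
    x ∈ dSet m a C := mem_dSet.2 ⟨k, h⟩

theorem AtLevel.le {α : Type*} {m : ℕ} {a : ℕ → α} {C : Set α} {k : ℕ} {x : α} (h : AtLevel m a C k x) :
    k ≤ m := by
  rcases h with h | h <;> omega

theorem IsDShape.exists_atLevel {m : ℕ} {a : ℕ → V} {C : Set V} (h : IsDShape Ω m a C) {k : ℕ}
    (hk : k ≤ m) : ∃ x, AtLevel m a C k x := by
  rcases hk.lt_or_eq with hk | rfl
  · exact ⟨a k, .inl ⟨hk, rfl⟩⟩
  · obtain ⟨c, hc⟩ := h.nonempty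
    exact ⟨c, .inr ⟨rfl, hc⟩⟩

theorem IsDShape.apply_atLevel (hq : Polarizes Ω q) {m : ℕ} {a : ℕ → V} {C : Set V}
    (h : IsDShape Ω m a C) {k l : ℕ} {x y : V} (hx : AtLevel m a C k x)
    (hy : AtLevel m a C l y) : Ω x y = if k + 1 = l ∨ l + 1 = k then 1 else 0 := by
  rcases hx with ⟨hk, rfl⟩ | ⟨rfl, hx⟩ <;> rcases hy with ⟨hl, rfl⟩ | ⟨rfl, hy⟩
  · exact h.path k hk l hl
  · rw [h.leaf k hk y hy]
    congr 1
    rw [eq_iff_iff]; omega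
  · rw [hq.symm, h.leaf l hl x hx]
    congr 1
    rw [eq_iff_iff]; omega
  · rw [h.leaves x hx y hy, if_neg (by omega)]

/-- Replacing `b` by `b + x` for an element `x` of `R` adjacent to `b`. -/
def Step (Ω : BForm V) (R : Set V) (b b' : V) : Prop := ∃ x ∈ R, Ω b x = 1 ∧ b' = b + x

/-- Reachability by steps. -/
abbrev Reach (Ω : BForm V) (R : Set V) : V → V → Prop := Relation.ReflTransGen (Step Ω R)

theorem Reach.equiv (hq : Polarizes Ω q) {R : Set V} (hR : Indep R) {b b' : V}
    (h : Reach Ω R b b') (hb : b ∉ spn R) :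
    b' ∉ spn R ∧ EquivSets Ω (insert b R) (insert b' R) := by
  induction h with
  | refl => exact ⟨hb, Relation.ReflTransGen.refl⟩
  | tail _ hs ih =>
    obtain ⟨x, hx, h1, rfl⟩ := hs
    refine ⟨add_notMem_span ih.1 hx, ih.2.tail (Move.moveRel ?_)⟩
    exact ⟨R, x, _, hR, ih.1, hx, by rw [hq.symm]; exact h1, rfl, rfl⟩

theorem swap_potential {n : ℕ} (s : Fin (n + 2) → ZMod 2) (k l : Fin (n + 1)) :
    s (Equiv.swap k.castSucc k.succ l.castSucc) + s (Equiv.swap k.castSucc k.succ l.succ) =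
      s l.castSucc + s l.succ + (s k.castSucc + s k.succ) *
        if k.val + 1 = l.val ∨ l.val + 1 = k.val then 1 else 0 := by
  have h2 : ∀ x y z : ZMod 2, x + y = z + y + (z + x) := by decide
  have h2' : ∀ x y z : ZMod 2, x + y = x + z + (z + y) := by decide
  by_cases hkl : k = l
  · subst hkl
    rw [Equiv.swap_apply_left, Equiv.swap_apply_right, if_neg (by omega), mul_zero, add_zero,
      add_comm]
  have hkl' : k.val ≠ l.val := fun h => hkl (Fin.ext h)
  by_cases h1 : k.val + 1 = l.val
  · have e : l.castSucc = k.succ := Fin.ext (by simp [h1])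
    rw [e, Equiv.swap_apply_right, Equiv.swap_apply_of_ne_of_ne, if_pos (.inl h1), mul_one]
    · rw [h2 (s k.castSucc), add_comm (s k.succ) (s k.castSucc)]
    · intro h; have := congrArg Fin.val h; simp at this; omega
    · intro h; have := congrArg Fin.val h; simp at this; omega
  by_cases h3 : l.val + 1 = k.val
  · have e : l.succ = k.castSucc := Fin.ext (by simp [h3])
    rw [e, Equiv.swap_apply_left, Equiv.swap_apply_of_ne_of_ne, if_pos (.inr h3), mul_one]
    · exact h2' _ _ _
    · intro h; have := congrArg Fin.val h; simp at this; omega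
    · intro h; have := congrArg Fin.val h; simp at this; omega
  · rw [Equiv.swap_apply_of_ne_of_ne, Equiv.swap_apply_of_ne_of_ne, if_neg (by tauto), mul_zero,
      add_zero]
    all_goals
      intro h; have := congrArg Fin.val h; simp at this; omega

/-- `s` is a potential for the values of `Ω b` on a tree of type `D_{m,k}`. -/
def IsPotential (Ω : BForm V) (m : ℕ) (a : ℕ → V) (C : Set V) (b : V)
    (s : Fin (m + 2) → ZMod 2) : Prop :=
  ∀ (k : Fin (m + 1)) (x : V), AtLevel m a C k x → Ω b x = s k.castSucc + s k.succ

theorem IsPotential.exists_perm (hq : Polarizes Ω q) {m : ℕ} {a : ℕ → V} {C : Set V}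
    (h : IsDShape Ω m a C) (σ : Equiv.Perm (Fin (m + 2))) {b : V} {s : Fin (m + 2) → ZMod 2}
    (hs : IsPotential Ω m a C b s) :
    ∃ b', Reach Ω (dSet m a C) b b' ∧ IsPotential Ω m a C b' (s ∘ σ) := by
  have hσ : σ ∈ Submonoid.closure
      (Set.range fun i : Fin (m + 1) => Equiv.swap i.castSucc i.succ) := by
    rw [Equiv.Perm.mclosure_swap_castSucc_succ]; trivial
  induction hσ using Submonoid.closure_induction generalizing b s with
  | mem σ hσ =>
    obtain ⟨k, rfl⟩ := hσ
    obtain ⟨x, hx⟩ := h.exists_atLevel (k := k) (by omega)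
    have hbx := hs k x hx
    rcases zmod_two_cases (Ω b x) with h0 | h1
    · refine ⟨b, .refl, fun l y hy => ?_⟩
      rw [hs l y hy, Function.comp_apply, Function.comp_apply, swap_potential, ← hbx, h0, zero_mul,
        add_zero]
    · refine ⟨b + x, .single ⟨x, hx.mem, h1, rfl⟩, fun l y hy => ?_⟩
      rw [Function.comp_apply, Function.comp_apply, swap_potential, ← hbx, h1, one_mul, map_add,
        LinearMap.add_apply, hs l y hy, h.apply_atLevel hq hx hy]
  | one => exact ⟨b, .refl, by simpa using hs⟩
  | mul σ τ _ _ ih1 ih2 =>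
    obtain ⟨b1, r1, h1⟩ := ih1 hs
    obtain ⟨b2, r2, h2⟩ := ih2 h1
    exact ⟨b2, r1.trans r2, h2⟩

theorem exists_perm_threshold {n : ℕ} (s : Fin n → ZMod 2) :
    ∃ (t : ℕ) (σ : Equiv.Perm (Fin n)), t ≤ n ∧ ∀ j, s (σ j) = if j.val < t then 1 else 0 := by
  classical
  have hle : Fintype.card {j // s j = 1} ≤ n := by
    simpa using Fintype.card_subtype_le fun j => s j = 1
  have hcard : Fintype.card {j : Fin n // j.val < Fintype.card {j // s j = 1}} =
      Fintype.card {j // s j = 1} := by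
    rw [Fintype.card_subtype]
    rw [Fin.card_filter_val_lt]
    omega
  let e := Fintype.equivOfCardEq hcard
  refine ⟨_, e.extendSubtype, hle, fun j => ?_⟩
  split_ifs with hj
  · exact e.extendSubtype_mem j hj
  · exact eq_zero_of_ne_one (e.extendSubtype_not_mem j hj)

theorem IsPotential.exists_threshold (hq : Polarizes Ω q) {m : ℕ} {a : ℕ → V} {C : Set V}
    (h : IsDShape Ω m a C) {b : V} {s : Fin (m + 2) → ZMod 2} (hs : IsPotential Ω m a C b s) :
    ∃ t ≤ m + 2, ∃ b', Reach Ω (dSet m a C) b b' ∧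
      ∀ k x, AtLevel m a C k x → Ω b' x = if k + 1 = t then 1 else 0 := by
  obtain ⟨t, σ, ht, hσ⟩ := exists_perm_threshold s
  obtain ⟨b', hr, hb'⟩ := hs.exists_perm hq h σ
  refine ⟨t, ht, b', hr, fun k x hx => ?_⟩
  have := hb' ⟨k, by have := hx.le; omega⟩ x hx
  rw [this, Function.comp_apply, Function.comp_apply, hσ, hσ]
  simp only [Fin.val_castSucc, Fin.val_succ]
  rcases lt_trichotomy (k + 1) t with h | h | h
  · rw [if_pos (by omega), if_pos (by omega), if_neg (by omega)]; decide
  · rw [if_pos (by omega), if_neg (by omega), if_pos (by omega)]; decide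
  · rw [if_neg (by omega), if_neg (by omega), if_neg (by omega)]; decide

theorem exists_reverse_threshold (hq : Polarizes Ω q) {m : ℕ} {a : ℕ → V} {C : Set V}
    (h : IsDShape Ω m a C) {b : V} {t : ℕ} (ht : t ≤ m + 2)
    (hb : ∀ k x, AtLevel m a C k x → Ω b x = if k + 1 = t then 1 else 0) :
    ∃ b', Reach Ω (dSet m a C) b b' ∧
      ∀ k x, AtLevel m a C k x → Ω b' x = if k + 1 = m + 2 - t then 1 else 0 := by
  have hs : IsPotential Ω m a C b fun j => if t ≤ j.val then 1 else 0 := by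
    intro k x hx
    rw [hb k x hx]
    simp only [Fin.val_castSucc, Fin.val_succ]
    rcases lt_trichotomy (k.val + 1) t with h | h | h
    · rw [if_neg (by omega), if_neg (by omega), if_neg (by omega)]; decide
    · rw [if_pos (by omega), if_neg (by omega), if_pos (by omega)]; decide
    · rw [if_neg (by omega), if_pos (by omega), if_pos (by omega)]; decide
  obtain ⟨b', hr, hb'⟩ := hs.exists_perm hq h Fin.revPerm
  refine ⟨b', hr, fun k x hx => ?_⟩
  have hk := hx.le
  have := hb' ⟨k, by omega⟩ x hx
  rw [this]
  simp only [Function.comp_apply, Fin.revPerm_apply, Fin.val_rev, Fin.val_castSucc, Fin.val_succ]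
  rcases lt_trichotomy (k + 1) (m + 2 - t) with h | h | h
  · rw [if_pos (by omega), if_pos (by omega), if_neg (by omega)]; decide
  · rw [if_pos (by omega), if_neg (by omega), if_pos (by omega)]; decide
  · rw [if_neg (by omega), if_neg (by omega), if_neg (by omega)]; decide

theorem exists_isPotential {m : ℕ} {a : ℕ → V} {C : Set V} (h : IsDShape Ω m a C) {b : V}
    (hb : ∀ c ∈ C, ∀ d ∈ C, Ω b c = Ω b d) :
    ∃ s, IsPotential Ω m a C b s := by
  obtain ⟨c, hc⟩ := h.nonempty
  refine ⟨fun j => ∑ i ∈ Finset.range j.val, if i < m then Ω b (a i) else Ω b c, ?_⟩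
  intro k x hx
  simp only [Fin.val_castSucc, Fin.val_succ]
  rw [Finset.sum_range_succ, ← add_assoc, CharTwo.add_self_eq_zero, zero_add]
  rcases hx with ⟨hk, rfl⟩ | ⟨hk, hx⟩
  · rw [if_pos hk]
  · rw [if_neg (by omega)]; exact hb x hx c hc

theorem Reach.exists_adj {R : Set V} {b b' : V} (hq : Polarizes Ω q) (h : Reach Ω R b b')
    (hb : ∃ x ∈ R, Ω b x = 1) : ∃ x ∈ R, Ω b' x = 1 := by
  induction h with
  | refl => exact hb
  | tail _ hs _ =>
    obtain ⟨x, hx, h1, rfl⟩ := hs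
    refine ⟨x, hx, ?_⟩
    rw [map_add, LinearMap.add_apply, h1, hq.alternating, add_zero]

/-- Adjacency in the tree `E₆`. -/
def e6Adj (i j : Fin 6) : Bool :=
  (i.val, j.val) ∈ [(0, 1), (1, 2), (2, 3), (3, 4), (2, 5)] ||
    (j.val, i.val) ∈ [(0, 1), (1, 2), (2, 3), (3, 4), (2, 5)]

/-- Six vectors with the Gram matrix of `E₆`. -/
def IsE6Tuple (Ω : BForm V) (x : Fin 6 → V) : Prop :=
  ∀ i j, Ω (x i) (x j) = if e6Adj i j then 1 else 0

theorem isE6Tuple_of (hq : Polarizes Ω q) {x0 x1 x2 x3 x4 x5 : V} (h01 : Ω x0 x1 = 1)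
    (h12 : Ω x1 x2 = 1) (h23 : Ω x2 x3 = 1) (h34 : Ω x3 x4 = 1) (h25 : Ω x2 x5 = 1)
    (h02 : Ω x0 x2 = 0) (h03 : Ω x0 x3 = 0) (h04 : Ω x0 x4 = 0) (h05 : Ω x0 x5 = 0)
    (h13 : Ω x1 x3 = 0) (h14 : Ω x1 x4 = 0) (h15 : Ω x1 x5 = 0) (h24 : Ω x2 x4 = 0)
    (h35 : Ω x3 x5 = 0) (h45 : Ω x4 x5 = 0) : IsE6Tuple Ω ![x0, x1, x2, x3, x4, x5] := by
  have upper : ∀ i j, i < j → Ω (![x0, x1, x2, x3, x4, x5] i) (![x0, x1, x2, x3, x4, x5] j) =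
      if e6Adj i j then 1 else 0 := by
    intro i j hij
    fin_cases i <;> fin_cases j <;> first | exact absurd hij (by decide) | assumption
  intro i j
  rcases lt_trichotomy i j with h | rfl | h
  · exact upper i j h
  · rw [hq.alternating]
    revert i; decide
  · rw [hq.symm, upper j i h, e6Adj, e6Adj, Bool.or_comm]

/-- `B` is equivalent to a tree of type `D_{m,k}` with `m ≥ 2`, or to a set containing a copy of
`E₆`. -/
def ReachesTree (Ω : BForm V) (B : Set V) : Prop :=
  ∃ B', EquivSets Ω B B' ∧ ((∃ m a C, 2 ≤ m ∧ IsDShape Ω m a C ∧ B' = dSet m a C) ∨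
    ∃ x, IsE6Tuple Ω x ∧ Set.range x ⊆ B')

theorem reachesTree_prepend (hq : Polarizes Ω q) {m : ℕ} {a : ℕ → V} {C : Set V}
    (h : IsDShape Ω m a C) {b : V} (hbR : b ∉ dSet m a C)
    (hb : ∀ k x, AtLevel m a C k x → Ω b x = if k + 1 = 1 then 1 else 0) :
    ReachesTree Ω (insert b (dSet m a C)) := by
  have hba : ∀ i < m, b ≠ a i := fun i hi e => hbR (e ▸ .inl ⟨i, hi, rfl⟩)
  have hpos := h.pos
  refine ⟨_, .refl, .inl ⟨m + 1, fun i => Nat.casesOn i b a, C, by omega, ⟨?_, ?_, h.nonempty, ?_,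
    ?_, h.leaves, by omega, fun h' => by omega⟩, ?_⟩⟩
  · rintro (_ | i) hi (_ | j) hj e
    · rfl
    · exact absurd e (hba j (by omega))
    · exact absurd e.symm (hba i (by omega))
    · rw [h.injOn i (by omega) j (by omega) e]
  · rintro (_ | i) hi
    · exact fun hC => hbR (.inr hC)
    · exact h.notMem i (by omega)
  · have key : ∀ j < m, Ω b (a j) = if 0 + 1 = j + 1 ∨ j + 1 + 1 = 0 then 1 else 0 := by
      intro j hj
      rw [hb j _ (.inl ⟨hj, rfl⟩)]
      congr 1; rw [eq_iff_iff]; omega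
    rintro (_ | i) hi (_ | j) hj
    · simpa using hq.alternating b
    · exact key j (by omega)
    · change Ω (a i) b = _
      rw [hq.symm, key i (by omega)]
      congr 1; rw [eq_iff_iff]; omega
    · change Ω (a i) (a j) = _
      rw [h.path i (by omega) j (by omega)]
      congr 1; rw [eq_iff_iff]; omega
  · rintro (_ | i) hi c hc
    · change Ω b c = _
      rw [hb m c (.inr ⟨rfl, hc⟩)]
      congr 1; rw [eq_iff_iff]; omega
    · change Ω (a i) c = _
      rw [h.leaf i (by omega) c hc]
      congr 1; rw [eq_iff_iff]; omega
  · ext x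
    simp only [dSet, Set.mem_insert_iff, Set.mem_union, Set.mem_image, Set.mem_Iio]
    constructor
    · rintro (rfl | ⟨i, hi, rfl⟩ | hx)
      · exact .inl ⟨0, by omega, rfl⟩
      · exact .inl ⟨i + 1, by omega, rfl⟩
      · exact .inr hx
    · rintro (⟨_ | i, hi, rfl⟩ | hx)
      · exact .inl rfl
      · exact .inr (.inl ⟨i, by omega, rfl⟩)
      · exact .inr (.inr hx)

theorem reachesTree_addLeaf (hq : Polarizes Ω q) {m : ℕ} {a : ℕ → V} {C : Set V}
    (h : IsDShape Ω m a C) (hm : 2 ≤ m) {b : V} (hbR : b ∉ dSet m a C)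
    (hb : ∀ k x, AtLevel m a C k x → Ω b x = if k + 1 = m then 1 else 0) :
    ReachesTree Ω (insert b (dSet m a C)) := by
  have hbC : ∀ c ∈ C, Ω b c = 0 := fun c hc => by
    rw [hb m c (.inr ⟨rfl, hc⟩), if_neg (by omega)]
  refine ⟨_, .refl, .inl ⟨m, a, insert b C, hm, ⟨h.injOn, ?_, ⟨b, Set.mem_insert _ _⟩, h.path,
    ?_, ?_, h.pos, fun h' => by omega⟩, (Set.union_insert).symm⟩⟩
  · rintro i hi (e | hC)
    · exact hbR (.inl ⟨i, hi, e⟩)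
    · exact h.notMem i hi hC
  · rintro i hi c (rfl | hc)
    · rw [hq.symm, hb i _ (.inl ⟨hi, rfl⟩)]
    · exact h.leaf i hi c hc
  · rintro c (rfl | hc) d (rfl | hd)
    · exact hq.alternating _
    · exact hbC d hd
    · rw [hq.symm]; exact hbC c hc
    · exact h.leaves c hc d hd

theorem range_vec_six_subset {α : Type*} {x0 x1 x2 x3 x4 x5 : α} {B : Set α} (h0 : x0 ∈ B)
    (h1 : x1 ∈ B) (h2 : x2 ∈ B) (h3 : x3 ∈ B) (h4 : x4 ∈ B) (h5 : x5 ∈ B) :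
    Set.range ![x0, x1, x2, x3, x4, x5] ⊆ B := by
  rintro _ ⟨i, rfl⟩
  fin_cases i <;> assumption

theorem reachesTree_middle (hq : Polarizes Ω q) {m : ℕ} {a : ℕ → V} {C : Set V}
    (h : IsDShape Ω m a C) {b : V} {t : ℕ} (h3 : 3 ≤ t) (htm : t + 1 ≤ m)
    (hb : ∀ k x, AtLevel m a C k x → Ω b x = if k + 1 = t then 1 else 0) :
    ReachesTree Ω (insert b (dSet m a C)) := by
  obtain ⟨x0, l0⟩ := h.exists_atLevel (k := t - 3) (by omega)
  obtain ⟨x1, l1⟩ := h.exists_atLevel (k := t - 2) (by omega)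
  obtain ⟨x2, l2⟩ := h.exists_atLevel (k := t - 1) (by omega)
  obtain ⟨x3, l3⟩ := h.exists_atLevel (k := t) (by omega)
  obtain ⟨x4, l4⟩ := h.exists_atLevel (k := t + 1) (by omega)
  have hb' : ∀ k x, AtLevel m a C k x → Ω x b = if k + 1 = t then 1 else 0 := fun k x hx => by
    rw [hq.symm, hb k x hx]
  refine ⟨_, .refl, .inr ⟨![x0, x1, x2, x3, x4, b], isE6Tuple_of hq ?_ ?_ ?_ ?_ ?_ ?_ ?_ ?_ ?_ ?_
    ?_ ?_ ?_ ?_ ?_, range_vec_six_subset (.inr l0.mem) (.inr l1.mem) (.inr l2.mem) (.inr l3.mem)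
    (.inr l4.mem) (.inl rfl)⟩⟩
  · rw [h.apply_atLevel hq l0 l1, if_pos (by omega)]
  · rw [h.apply_atLevel hq l1 l2, if_pos (by omega)]
  · rw [h.apply_atLevel hq l2 l3, if_pos (by omega)]
  · rw [h.apply_atLevel hq l3 l4, if_pos (by omega)]
  · rw [hb' _ _ l2, if_pos (by omega)]
  · rw [h.apply_atLevel hq l0 l2, if_neg (by omega)]
  · rw [h.apply_atLevel hq l0 l3, if_neg (by omega)]
  · rw [h.apply_atLevel hq l0 l4, if_neg (by omega)]
  · rw [hb' _ _ l0, if_neg (by omega)]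
  · rw [h.apply_atLevel hq l1 l3, if_neg (by omega)]
  · rw [h.apply_atLevel hq l1 l4, if_neg (by omega)]
  · rw [hb' _ _ l1, if_neg (by omega)]
  · rw [h.apply_atLevel hq l2 l4, if_neg (by omega)]
  · rw [hb' _ _ l3, if_neg (by omega)]
  · rw [hb' _ _ l4, if_neg (by omega)]

theorem ReachesTree.of_equiv {B B' : Set V} (h : EquivSets Ω B B') (h' : ReachesTree Ω B') :
    ReachesTree Ω B := by
  obtain ⟨B'', h1, h2⟩ := h'
  exact ⟨B'', h.trans h1, h2⟩

theorem reachesTree_of_balanced (hq : Polarizes Ω q) {m : ℕ} {a : ℕ → V} {C : Set V}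
    (h : IsDShape Ω m a C) (hR : Indep (dSet m a C)) {b : V} (hb : b ∉ spn (dSet m a C))
    (hadj : ∃ x ∈ dSet m a C, Ω b x = 1) (hbal : ∀ c ∈ C, ∀ d ∈ C, Ω b c = Ω b d) :
    ReachesTree Ω (insert b (dSet m a C)) := by
  obtain ⟨s, hs⟩ := exists_isPotential h hbal
  obtain ⟨t, ht, b1, r1, h1⟩ := hs.exists_threshold hq h
  obtain ⟨b2, r12, h2⟩ := exists_reverse_threshold hq h ht h1
  have r2 : Reach Ω (dSet m a C) b b2 := r1.trans r12
  obtain ⟨hb1, e1⟩ := Reach.equiv hq hR r1 hb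
  obtain ⟨hb2, e2⟩ := Reach.equiv hq hR r2 hb
  have hb1 := notMem_of_notMem_span hb1
  have hb2 := notMem_of_notMem_span hb2
  obtain ⟨x, hx, hbx⟩ := Reach.exists_adj hq r1 hadj
  obtain ⟨k, hk⟩ := mem_dSet.1 hx
  have hkm := hk.le
  rw [h1 k x hk] at hbx
  have hkt : k + 1 = t := by
    by_contra hne
    rw [if_neg hne] at hbx
    exact absurd hbx (by decide)
  have hpos := h.pos
  obtain hc | hc | hc | hc | hc : t = 1 ∨ t = m + 1 ∨ (2 ≤ m ∧ t = m) ∨ (2 ≤ m ∧ t = 2) ∨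
    (3 ≤ t ∧ t + 1 ≤ m) := by omega
  · exact .of_equiv e1 (reachesTree_prepend hq h hb1 (hc ▸ h1))
  · have e : m + 2 - t = 1 := by omega
    exact .of_equiv e2 (reachesTree_prepend hq h hb2 (e ▸ h2))
  · exact .of_equiv e1 (reachesTree_addLeaf hq h hc.1 hb1 (by rw [← hc.2]; rwa [hc.2] at h1 ⊢))
  · have e : m + 2 - t = m := by omega
    rw [e] at h2
    exact .of_equiv e2 (reachesTree_addLeaf hq h hc.1 hb2 h2)
  · exact .of_equiv e1 (reachesTree_middle hq h hc.1 hc.2 h1)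

/-- If `b` tells two leaves apart, then it can be moved away from the three last path vertices. -/
theorem exists_reach_zero (hq : Polarizes Ω q) {R : Set V} {A1 A2 A3 c d : V} (m1 : A1 ∈ R)
    (m2 : A2 ∈ R) (m3 : A3 ∈ R) (mc : c ∈ R) (md : d ∈ R) (h12 : Ω A1 A2 = 1) (h23 : Ω A2 A3 = 1)
    (h13 : Ω A1 A3 = 0) (h1c : Ω A1 c = 0) (h1d : Ω A1 d = 0) (h2c : Ω A2 c = 0)
    (h2d : Ω A2 d = 0) (h3c : Ω A3 c = 1) (h3d : Ω A3 d = 1) (hcd : Ω c d = 0) {b : V}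
    (hb : Ω b c ≠ Ω b d) :
    ∃ b', Reach Ω R b b' ∧ Ω b' A1 = 0 ∧ Ω b' A2 = 0 ∧ Ω b' A3 = 0 ∧ Ω b' c ≠ Ω b' d := by
  have h21 := (hq.symm A2 A1).trans h12
  have h32 := (hq.symm A3 A2).trans h23
  have h31 := (hq.symm A3 A1).trans h13
  have hc1 := (hq.symm c A1).trans h1c
  have hd1 := (hq.symm d A1).trans h1d
  have hc2 := (hq.symm c A2).trans h2c
  have hd2 := (hq.symm d A2).trans h2d
  have hc3 := (hq.symm c A3).trans h3c
  have hd3 := (hq.symm d A3).trans h3d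
  have hdc := (hq.symm d c).trans hcd
  let P (x1 x2 x3 : ZMod 2) : Prop := ∀ b, Ω b A1 = x1 → Ω b A2 = x2 → Ω b A3 = x3 →
    Ω b c ≠ Ω b d →
    ∃ b', Reach Ω R b b' ∧ Ω b' A1 = 0 ∧ Ω b' A2 = 0 ∧ Ω b' A3 = 0 ∧ Ω b' c ≠ Ω b' d
  have s000 : P 0 0 0 := fun b h1 h2 h3 hy => ⟨b, .refl, h1, h2, h3, hy⟩
  have leaf : ∀ x1 x2 x3, P x1 x2 (x3 + 1) → P x1 x2 x3 := by
    intro x1 x2 x3 hP b h1 h2 h3 hy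
    have : Ω b c = 1 ∨ Ω b d = 1 := by
      rcases zmod_two_cases (Ω b c) with h | h
      · exact .inr (eq_one_of_ne_zero fun h' => hy (h.trans h'.symm))
      · exact .inl h
    rcases this with h | h
    · obtain ⟨b', r, hf⟩ := hP (b + c) (by simp [h1, hc1]) (by simp [h2, hc2])
        (by simp [h3, hc3]) (by simpa [hq.alternating, hcd] using hy)
      exact ⟨b', .head ⟨c, mc, h, rfl⟩ r, hf⟩
    · obtain ⟨b', r, hf⟩ := hP (b + d) (by simp [h1, hd1]) (by simp [h2, hd2])
        (by simp [h3, hd3]) (by simpa [hq.alternating, hdc] using hy)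
      exact ⟨b', .head ⟨d, md, h, rfl⟩ r, hf⟩
  have step1 : ∀ x2 x3, P 1 (x2 + 1) x3 → P 1 x2 x3 := by
    intro x2 x3 hP b h1 h2 h3 hy
    obtain ⟨b', r, hf⟩ := hP (b + A1) (by simp [h1, hq.alternating]) (by simp [h2, h12])
      (by simp [h3, h13]) (by simpa [h1c, h1d] using hy)
    exact ⟨b', .head ⟨A1, m1, h1, rfl⟩ r, hf⟩
  have step2 : ∀ x1 x3, P (x1 + 1) 1 (x3 + 1) → P x1 1 x3 := by
    intro x1 x3 hP b h1 h2 h3 hy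
    obtain ⟨b', r, hf⟩ := hP (b + A2) (by simp [h1, h21]) (by simp [h2, hq.alternating])
      (by simp [h3, h23]) (by simpa [h2c, h2d] using hy)
    exact ⟨b', .head ⟨A2, m2, h2, rfl⟩ r, hf⟩
  have step3 : ∀ x1 x2, P x1 (x2 + 1) 1 → P x1 x2 1 := by
    intro x1 x2 hP b h1 h2 h3 hy
    obtain ⟨b', r, hf⟩ := hP (b + A3) (by simp [h1, h31]) (by simp [h2, h32])
      (by simp [h3, hq.alternating]) (by simpa [h3c, h3d] using hy)
    exact ⟨b', .head ⟨A3, m3, h3, rfl⟩ r, hf⟩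
  have s001 : P 0 0 1 := leaf _ _ _ s000
  have s011 : P 0 1 1 := step3 _ _ s001
  have s110 : P 1 1 0 := step2 _ _ s011
  have s100 : P 1 0 0 := step1 _ _ s110
  have s101 : P 1 0 1 := leaf _ _ _ s100
  have s111 : P 1 1 1 := step1 _ _ s101
  have s010 : P 0 1 0 := step2 _ _ s111
  rcases zmod_two_cases (Ω b A1) with h1 | h1 <;> rcases zmod_two_cases (Ω b A2) with h2 | h2 <;>
    rcases zmod_two_cases (Ω b A3) with h3 | h3
  · exact s000 b h1 h2 h3 hb
  · exact s001 b h1 h2 h3 hb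
  · exact s010 b h1 h2 h3 hb
  · exact s011 b h1 h2 h3 hb
  · exact s100 b h1 h2 h3 hb
  · exact s101 b h1 h2 h3 hb
  · exact s110 b h1 h2 h3 hb
  · exact s111 b h1 h2 h3 hb

theorem reachesTree_of_unbalanced (hq : Polarizes Ω q) {m : ℕ} {a : ℕ → V} {C : Set V}
    (h : IsDShape Ω m a C) (hR : Indep (dSet m a C)) {b : V} (hb : b ∉ spn (dSet m a C))
    (hm : 3 ≤ m) {c d : V} (hc : c ∈ C) (hd : d ∈ C) (hcd : Ω b c ≠ Ω b d) :
    ReachesTree Ω (insert b (dSet m a C)) := by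
  have l1 : AtLevel m a C (m - 3) (a (m - 3)) := .inl ⟨by omega, rfl⟩
  have l2 : AtLevel m a C (m - 2) (a (m - 2)) := .inl ⟨by omega, rfl⟩
  have l3 : AtLevel m a C (m - 1) (a (m - 1)) := .inl ⟨by omega, rfl⟩
  have lc : ∀ {c}, c ∈ C → AtLevel m a C m c := fun hc => .inr ⟨rfl, hc⟩
  generalize a (m - 3) = A1 at l1
  generalize a (m - 2) = A2 at l2
  generalize a (m - 1) = A3 at l3
  have h12 : Ω A1 A2 = 1 := by rw [h.apply_atLevel hq l1 l2, if_pos (by omega)]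
  have h13 : Ω A1 A3 = 0 := by rw [h.apply_atLevel hq l1 l3, if_neg (by omega)]
  have h23 : Ω A2 A3 = 1 := by rw [h.apply_atLevel hq l2 l3, if_pos (by omega)]
  have h1c : ∀ c ∈ C, Ω A1 c = 0 := fun c hc => by
    rw [h.apply_atLevel hq l1 (lc hc), if_neg (by omega)]
  have h2c : ∀ c ∈ C, Ω A2 c = 0 := fun c hc => by
    rw [h.apply_atLevel hq l2 (lc hc), if_neg (by omega)]
  have h3c : ∀ c ∈ C, Ω A3 c = 1 := fun c hc => by
    rw [h.apply_atLevel hq l3 (lc hc), if_pos (by omega)]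
  obtain ⟨b', r, hb1, hb2, hb3, hy⟩ := exists_reach_zero hq l1.mem l2.mem l3.mem (lc hc).mem
    (lc hd).mem h12 h23 h13 (h1c c hc) (h1c d hd) (h2c c hc) (h2c d hd) (h3c c hc) (h3c d hd)
    (h.leaves c hc d hd) hcd
  have fin : ∀ c ∈ C, ∀ d ∈ C, Ω b' c = 1 → Ω b' d = 0 →
      ReachesTree Ω (insert b' (dSet m a C)) := fun c hc d hd h1 h0 =>
    ⟨_, .refl, .inr ⟨![A1, A2, A3, c, b', d], isE6Tuple_of hq h12 h23 (h3c c hc)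
      ((hq.symm _ _).trans h1) (h3c d hd) h13 (h1c c hc) ((hq.symm _ _).trans hb1) (h1c d hd)
      (h2c c hc) ((hq.symm _ _).trans hb2) (h2c d hd) ((hq.symm _ _).trans hb3)
      (h.leaves c hc d hd) h0, range_vec_six_subset (.inr l1.mem) (.inr l2.mem) (.inr l3.mem)
      (.inr (lc hc).mem) (.inl rfl) (.inr (lc hd).mem)⟩⟩
  refine .of_equiv (Reach.equiv hq hR r hb).2 ?_
  rcases zmod_two_cases (Ω b' c) with h0 | h1
  · exact fin d hd c hc (eq_one_of_ne_zero fun h' => hy (h0.trans h'.symm)) h0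
  · exact fin c hc d hd h1 (eq_zero_of_ne_one fun h' => hy (h1.trans h'.symm))

theorem isDShape_star (hq : Polarizes Ω q) {A : V} {L : Set V} (hA : ∀ x ∈ L, Ω A x = 1)
    (hL : ∀ x ∈ L, ∀ y ∈ L, Ω x y = 0) {c d : V} (hc : c ∈ L) (hd : d ∈ L) (hcd : d ≠ c) :
    IsDShape Ω 2 (fun i => if i = 0 then c else A) (L \ {c}) := by
  have hAc : A ≠ c := fun h => by
    have := hA c hc
    rw [h, hq.alternating] at this
    exact absurd this (by decide)
  have hAL : A ∉ L := fun h => by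
    have := hA A h
    rw [hq.alternating] at this
    exact absurd this (by decide)
  have hcA : Ω c A = 1 := (hq.symm _ _).trans (hA c hc)
  refine ⟨?_, ?_, ⟨d, hd, hcd⟩, ?_, ?_, fun x hx y hy => hL x hx.1 y hy.1, by omega, by omega⟩
  · intro i hi j hj e
    interval_cases i <;> interval_cases j <;> simp_all
  · intro i hi
    interval_cases i <;> simp [hAL]
  · intro i hi j hj
    interval_cases i <;> interval_cases j <;> simp [hA c hc, hcA, hq.alternating]
  · intro i hi x hx
    interval_cases i
    · simpa using hL c hc x hx.1
    · simpa using hA x hx.1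

theorem dSet_star {α : Type*} {A : α} {L : Set α} {c : α} (hc : c ∈ L) :
    dSet 2 (fun i => if i = 0 then c else A) (L \ {c}) = insert A L := by
  ext x
  simp only [dSet, Set.mem_union, Set.mem_image, Set.mem_Iio, Set.mem_sdiff, Set.mem_singleton_iff,
    Set.mem_insert_iff]
  constructor
  · rintro (⟨i, hi, rfl⟩ | hx)
    · interval_cases i <;> simp [hc]
    · exact .inr hx.1
  · rintro (rfl | hx)
    · exact .inl ⟨1, by omega, rfl⟩
    · by_cases e : x = c
      · exact .inl ⟨0, by omega, by simp [e]⟩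
      · exact .inr ⟨hx, e⟩

theorem reachesTree_star_of_zero [Finite V] (hq : Polarizes Ω q) {A b c d : V} {L : Set V}
    (hI : Indep (insert b (insert A L))) (hA : ∀ x ∈ L, Ω A x = 1)
    (hL : ∀ x ∈ L, ∀ y ∈ L, Ω x y = 0) (hc : c ∈ L) (hd : d ∈ L) (hbc : Ω b c = 1)
    (hbd : Ω b d = 0) (hbA : Ω b A = 0) : ReachesTree Ω (insert b (insert A L)) := by
  have hdc : d ≠ c := by rintro rfl; rw [hbc] at hbd; exact absurd hbd (by decide)
  have hAL : A ∉ L := fun h => by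
    have := hA A h
    rw [hq.alternating] at this
    exact absurd this (by decide)
  have hbL : b ∉ L := fun h => by
    have := hA b h
    rw [hq.symm, hbA] at this
    exact absurd this (by decide)
  have hbneA : b ≠ A := by
    rintro rfl
    rw [hA d hd] at hbd
    exact absurd hbd (by decide)
  have hbR : b ∉ insert A L := by
    rintro (h | h)
    exacts [hbneA h, hbL h]
  induction hN : {x ∈ L | x ≠ c ∧ Ω b x = 1}.ncard using Nat.strong_induction_on generalizing L with
  | _ N ih =>
  by_cases h0 : ∃ l ∈ L, l ≠ c ∧ Ω b l = 1
  · obtain ⟨l, hl, hlc, hbl⟩ := h0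
    have hld : l ≠ d := by rintro rfl; rw [hbl] at hbd; exact absurd hbd (by decide)
    have hlA : l ≠ A := by rintro rfl; exact hAL hl
    have hlb : l ≠ b := by rintro rfl; exact hbL hl
    set R := insert b (insert A (L \ {l})) with hRdef
    have hins : insert l R = insert b (insert A L) := by
      rw [hRdef, Set.insert_comm l b, Set.insert_comm l A, Set.insert_sdiff_singleton,
        Set.insert_eq_of_mem hl]
    have hlR : l ∉ R := by
      rintro (h | h | h)
      exacts [hlb h, hlA h, h.2 rfl]
    have hR : Indep R := hI.subset (hins ▸ Set.subset_insert _ _)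
    have hls : l ∉ spn R := Indep.notMem_span (hins ▸ hI) hlR
    have mA : A ∈ R := .inr (.inl rfl)
    have mc : c ∈ R := .inr (.inr ⟨hc, hlc.symm⟩)
    have md : d ∈ R := .inr (.inr ⟨hd, hld.symm⟩)
    have hlA1 : Ω l A = 1 := (hq.symm _ _).trans (hA l hl)
    have hcA1 : Ω c A = 1 := (hq.symm _ _).trans (hA c hc)
    have hdA1 : Ω d A = 1 := (hq.symm _ _).trans (hA d hd)
    have two : (1 : ZMod 2) + 1 = 0 := by decide
    have r : Reach Ω R l (l + A + d + c + A) := by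
      refine .head ⟨A, mA, hlA1, rfl⟩ (.head ⟨d, md, ?_, rfl⟩ (.head ⟨c, mc, ?_, rfl⟩
        (.single ⟨A, mA, ?_, rfl⟩)))
      · simp [hL l hl d hd, hA d hd]
      · simp [hL l hl c hc, hA c hc, hL d hd c hc]
      · simp [hlA1, hcA1, hdA1, hq.alternating, two]
    obtain ⟨hls', he⟩ := Reach.equiv hq hR r hls
    generalize hl' : l + A + d + c + A = l' at r hls' he
    have hl'L : ∀ x ∈ L, Ω l' x = 0 := fun x hx => by
      simp [← hl', hL l hl x hx, hL d hd x hx, hL c hc x hx, hA x hx, two]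
    have hl'A : Ω l' A = 1 := by
      simp [← hl', hlA1, hcA1, hdA1, hq.alternating, two]
    have hbl' : Ω b l' = 0 := by simp [← hl', hbl, hbA, hbd, hbc, two]
    have hins' : insert l' R = insert b (insert A (insert l' (L \ {l}))) := by
      rw [hRdef, Set.insert_comm l' b, Set.insert_comm l' A]
    rw [hins, hins'] at he
    refine .of_equiv he (ih _ ?_ (hins' ▸ hR.insert_of hls') ?_ ?_ (.inr ⟨hc, hlc.symm⟩)
      (.inr ⟨hd, hld.symm⟩) ?_ ?_ ?_ rfl)
    · rw [← hN]
      refine Set.ncard_lt_ncard ?_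
      refine ⟨?_, fun hs => ?_⟩
      · rintro x ⟨rfl | hx, h1, h2⟩
        · rw [hbl'] at h2; exact absurd h2 (by decide)
        · exact ⟨hx.1, h1, h2⟩
      · obtain ⟨h | h, -⟩ := hs ⟨hl, hlc, hbl⟩
        · rw [h, hbl'] at hbl; exact absurd hbl (by decide)
        · exact h.2 rfl
    · rintro x (rfl | hx)
      · rw [hq.symm, hl'A]
      · exact hA x hx.1
    · rintro x (rfl | hx) y (rfl | hy)
      · exact hq.alternating _
      · exact hl'L y hy.1
      · rw [hq.symm]; exact hl'L x hx.1
      · exact hL x hx.1 y hy.1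
    · rintro (h | h)
      · rw [← h, hq.alternating] at hl'A; exact absurd hl'A (by decide)
      · exact hAL h.1
    · rintro (h | h)
      · exact hls' (h ▸ Submodule.subset_span (.inl rfl))
      · exact hbL h.1
    · rintro (h | h | h)
      · exact hbneA h
      · exact hls' (h ▸ Submodule.subset_span (.inl rfl))
      · exact hbL h.1
  · push Not at h0
    rw [← dSet_star (A := A) hc] at hbR ⊢
    refine reachesTree_prepend hq (isDShape_star hq hA hL hc hd hdc) hbR ?_
    rintro k x (⟨hk, rfl⟩ | ⟨rfl, hx⟩)
    · interval_cases k <;> simp [hbc, hbA]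
    · rw [if_neg (by omega)]
      exact eq_zero_of_ne_one (h0 x hx.1 hx.2)

theorem reachesTree_star [Finite V] (hq : Polarizes Ω q) {A b c d : V} {L : Set V}
    (hI : Indep (insert A L)) (hb : b ∉ spn (insert A L)) (hA : ∀ x ∈ L, Ω A x = 1)
    (hL : ∀ x ∈ L, ∀ y ∈ L, Ω x y = 0) (hc : c ∈ L) (hd : d ∈ L) (hbc : Ω b c = 1)
    (hbd : Ω b d = 0) : ReachesTree Ω (insert b (insert A L)) := by
  rcases zmod_two_cases (Ω b A) with h0 | h1
  · exact reachesTree_star_of_zero hq (hI.insert_of hb) hA hL hc hd hbc hbd h0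
  · have r : Reach Ω (insert A L) b (b + c) := .single ⟨c, .inr hc, hbc, rfl⟩
    obtain ⟨hb', he⟩ := Reach.equiv hq hI r hb
    refine .of_equiv he (reachesTree_star_of_zero hq (hI.insert_of hb') hA hL hc hd ?_ ?_ ?_)
    · simp [hbc, hq.alternating]
    · simp [hbd, hL c hc d hd]
    · simp [h1, hq.symm c A, hA c hc]; decide

/-- Adding a vector adjacent to a tree of type `D_{m,k}`. -/
theorem IsDShape.reachesTree_insert [Finite V] (hq : Polarizes Ω q) {m : ℕ} {a : ℕ → V} {C : Set V}
    (h : IsDShape Ω m a C) (hR : Indep (dSet m a C)) {b : V} (hb : b ∉ spn (dSet m a C))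
    (hadj : ∃ x ∈ dSet m a C, Ω b x = 1) : ReachesTree Ω (insert b (dSet m a C)) := by
  by_cases hbal : ∀ c ∈ C, ∀ d ∈ C, Ω b c = Ω b d
  · exact reachesTree_of_balanced hq h hR hb hadj hbal
  push Not at hbal
  obtain ⟨c, hc, d, hd, hcd⟩ := hbal
  have hpos := h.pos
  obtain hm | hm | rfl : 3 ≤ m ∨ m = 1 ∨ m = 2 := by omega
  · exact reachesTree_of_unbalanced hq h hR hb hm hc hd hcd
  · exact absurd (by rw [h.small hm hc hd]) hcd
  · have e : dSet 2 a C = insert (a 1) (insert (a 0) C) := by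
      ext x
      simp only [dSet, Set.mem_union, Set.mem_image, Set.mem_Iio, Set.mem_insert_iff]
      constructor
      · rintro (⟨i, hi, rfl⟩ | hx)
        · interval_cases i <;> simp
        · exact .inr (.inr hx)
      · rintro (rfl | rfl | hx)
        exacts [.inl ⟨1, by omega, rfl⟩, .inl ⟨0, by omega, rfl⟩, .inr hx]
    have h0 : ∀ x ∈ C, Ω (a 0) x = 0 := fun x hx => by rw [h.leaf 0 (by omega) x hx, if_neg (by omega)]
    have hA : ∀ x ∈ insert (a 0) C, Ω (a 1) x = 1 := by
      rintro x (rfl | hx)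
      · rw [h.path 1 (by omega) 0 (by omega), if_pos (by omega)]
      · rw [h.leaf 1 (by omega) x hx, if_pos (by omega)]
    have hL : ∀ x ∈ insert (a 0) C, ∀ y ∈ insert (a 0) C, Ω x y = 0 := by
      rintro x (rfl | hx) y (rfl | hy)
      · exact hq.alternating _
      · exact h0 y hy
      · rw [hq.symm]; exact h0 x hx
      · exact h.leaves x hx y hy
    rw [e] at hR hb ⊢
    rcases zmod_two_cases (Ω b c) with h0 | h1
    · exact reachesTree_star hq hR hb hA hL (.inr hd) (.inr hc)
        (eq_one_of_ne_zero fun h' => hcd (h0.trans h'.symm)) h0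
    · exact reachesTree_star hq hR hb hA hL (.inr hc) (.inr hd) h1
        (eq_zero_of_ne_one fun h' => hcd (h1.trans h'.symm))

theorem IsE6Tuple.injective {x : Fin 6 → V} (hx : IsE6Tuple Ω x) : Function.Injective x := by
  have key : ∀ i j : Fin 6, (∀ k, e6Adj i k = e6Adj j k) → i = j := by decide
  intro i j hij
  refine key i j fun k => ?_
  have h := (hx i k).symm.trans (hij ▸ hx j k)
  revert h
  cases e6Adj i k <;> cases e6Adj j k <;> decide

theorem IsE6Tuple.isE6Type [Finite V] (hq : Polarizes Ω q) {x : Fin 6 → V} (hx : IsE6Tuple Ω x)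
    (hg : IsGood q (Set.range x)) : IsE6Type Ω q (Set.range x) := by
  have hset : {y | y ∈ List.ofFn x} = Set.range x := by
    ext; rw [Set.mem_ofPred_eq, List.mem_ofFn]; rfl
  have hn : (List.ofFn x).Nodup := List.nodup_ofFn.2 hx.injective
  rw [← hset] at hg ⊢
  refine isE6Type_of_list hq hn (List.length_ofFn) hg ?_ ?_
  · have hrows : rows Ω (List.ofFn x) = [1, 1, 5, 1, 0, 0] := by
      simp [List.ofFn_succ, rows, mask, hx _ _, e6Adj, ZMod.val_one]
    rw [hrows]
    decide +kernel
  · exact ⟨x 2, by simp, x 1, by simp, x 3, by simp, hx.injective.ne (by decide), hx 2 1, hx 2 3⟩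

theorem IsDShape.ncard_dSet [Finite V] {m : ℕ} {a : ℕ → V} {C : Set V} (h : IsDShape Ω m a C) :
    (dSet m a C).ncard = m + C.ncard := by
  rw [dSet, Set.ncard_union_eq, Set.InjOn.ncard_image, Set.ncard_eq_toFinset_card']
  · simp
  · exact fun i hi j hj e => h.injOn i hi j hj e
  · rw [Set.disjoint_left]
    rintro _ ⟨i, hi, rfl⟩
    exact h.notMem i hi

theorem IsDShape.onesInSpan_ne [Finite V] (hq : Polarizes Ω q) {m : ℕ} {a : ℕ → V} {C : Set V}
    (h : IsDShape Ω m a C) (hg : IsGood q (dSet m a C)) (h6 : (dSet m a C).ncard = 6) :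
    onesInSpan q (dSet m a C) ≠ 36 := by
  rw [h.ncard_dSet] at h6
  obtain ⟨cs, hcs, rfl, hlen⟩ := exists_list_of_set C
  have hset : {x | x ∈ (List.range m).map a ++ cs} = dSet m a {x | x ∈ cs} := by
    ext x
    simp [dSet]
  have hn : ((List.range m).map a ++ cs).Nodup := by
    refine List.Nodup.append ((List.nodup_map_iff_inj_on List.nodup_range).2 ?_) hcs ?_
    · intro i hi j hj e
      exact h.injOn i (List.mem_range.1 hi) j (List.mem_range.1 hj) e
    · intro y hy hy'
      obtain ⟨i, hi, rfl⟩ := List.mem_map.1 hy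
      exact h.notMem i (List.mem_range.1 hi) hy'
  rw [← hset, onesInSpan_eq hq hn (hset ▸ hg)]
  have hm1 : m ≠ 1 := by
    intro hm
    have := Set.ncard_le_one_iff_subsingleton.2 (h.small hm)
    omega
  have hpos := h.pos
  have hcpos := (Set.ncard_pos (s := {x | x ∈ cs})).2 h.nonempty
  rw [← hlen] at h6 hcpos
  have hp := h.path
  have hl := h.leaf
  have hl' := h.leaves
  obtain rfl | rfl | rfl | rfl : m = 2 ∨ m = 3 ∨ m = 4 ∨ m = 5 := by omega
  · obtain ⟨c0, c1, c2, c3, rfl⟩ := List.length_eq_four.1 (by omega : cs.length = 4)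
    have : rows Ω ((List.range 2).map a ++ [c0, c1, c2, c3]) = [1, 15, 0, 0, 0, 0] := by
      simp [List.range_succ, rows, mask, ZMod.val_one, hp, hl, hl']
    rw [this]
    decide +kernel
  · obtain ⟨c0, c1, c2, rfl⟩ := List.length_eq_three.1 (by omega : cs.length = 3)
    have : rows Ω ((List.range 3).map a ++ [c0, c1, c2]) = [1, 1, 7, 0, 0, 0] := by
      simp [List.range_succ, rows, mask, ZMod.val_one, hp, hl, hl']
    rw [this]
    decide +kernel
  · obtain ⟨c0, c1, rfl⟩ := List.length_eq_two.1 (by omega : cs.length = 2)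
    have : rows Ω ((List.range 4).map a ++ [c0, c1]) = [1, 1, 1, 3, 0, 0] := by
      simp [List.range_succ, rows, mask, ZMod.val_one, hp, hl, hl']
    rw [this]
    decide +kernel
  · obtain ⟨c0, rfl⟩ := List.length_eq_one_iff.1 (by omega : cs.length = 1)
    have : rows Ω ((List.range 5).map a ++ [c0]) = [1, 1, 1, 1, 1, 0] := by
      simp [List.range_succ, rows, mask, ZMod.val_one, hp, hl]
    rw [this]
    decide +kernel

theorem IsGood.conn_equiv (hq : Polarizes Ω q) {B B' : Set V} (hB : IsGood q B)
    (h : EquivSets Ω B B') (hc : Conn Ω B) : Conn Ω B' :=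
  (hB.induction hq (fun _ _ _ hm => hm.conn hq) h hc).2

theorem IsGood.isE6Type_equiv [Finite V] (hq : Polarizes Ω q) {B B' : Set V} (hB : IsGood q B)
    (h : EquivSets Ω B B') (hE : IsE6Type Ω q B) : IsE6Type Ω q B' :=
  (hB.induction hq (fun _ _ _ hm => IsE6Type.move hq hm) h hE).2

theorem IsGood.hasE6Type_equiv [Finite V] (hq : Polarizes Ω q) {B B' : Set V} (hB : IsGood q B)
    (h : EquivSets Ω B B') (hE : HasE6Type Ω q B) : HasE6Type Ω q B' :=
  (hB.induction hq (fun _ _ hg hm => HasE6Type.move hq hg hm) h hE).2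

theorem IsGood.insert_equiv (hq : Polarizes Ω q) {R R' : Set V} (hR : IsGood q R)
    (h : EquivSets Ω R R') {b : V} (hb : b ∉ spn R) :
    b ∉ spn R' ∧ EquivSets Ω (insert b R) (insert b R') := by
  refine (hR.induction hq (P := fun X => b ∉ spn X ∧ EquivSets Ω (insert b R) (insert b X)) ?_ h
    ⟨hb, .refl⟩).2
  rintro B B' - hm ⟨hbB, he⟩
  refine ⟨by rwa [hm.span_eq], he.tail ?_⟩
  have hbB := notMem_of_notMem_span hbB
  obtain ⟨a, c, ha, hc, hac, h1, rfl⟩ := hm.moveRel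
  refine ⟨a, c, .inr ha, .inr hc, hac, h1, ?_⟩
  have hbc : b ∉ ({c} : Set V) := by rintro rfl; exact hbB hc
  rw [Set.insert_sdiff_of_notMem _ hbc, Set.insert_comm]

theorem Conn.insert_of_adj (hq : Polarizes Ω q) {S : Set V} (hS : Conn Ω S) {x y : V} (hx : x ∈ S)
    (hxy : Ω x y = 1) : Conn Ω (insert y S) := by
  intro p hp hn
  by_cases hp' : ∃ z ∈ S, p z
  · by_cases hn' : ∃ z ∈ S, ¬ p z
    · obtain ⟨u, hu, v, hv, h⟩ := hS p hp' hn'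
      exact ⟨u, .inr hu, v, .inr hv, h⟩
    · push Not at hn'
      obtain ⟨z, rfl | hz, hpz⟩ := hn
      · exact ⟨x, .inr hx, z, .inl rfl, hn' x hx, hpz, hxy⟩
      · exact absurd (hn' z hz) hpz
  · push Not at hp'
    obtain ⟨z, rfl | hz, hpz⟩ := hp
    · exact ⟨z, .inl rfl, x, .inr hx, hpz, hp' x hx, (hq.symm _ _).trans hxy⟩
    · exact absurd hpz (hp' z hz)

/-- A connected graph with at least two vertices has a vertex whose removal leaves it connected. -/
theorem Conn.exists_sdiff [Finite V] (hq : Polarizes Ω q) {B : Set V} (hB : Conn Ω B)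
    (h2 : 2 ≤ B.ncard) : ∃ y ∈ B, Conn Ω (B \ {y}) := by
  let F : Set (Set V) := {S | S ⊆ B ∧ S ≠ B ∧ S.Nonempty ∧ Conn Ω S}
  have hF : F.Nonempty := by
    obtain ⟨x, hx⟩ := (Set.ncard_pos (s := B)).1 (by omega)
    refine ⟨{x}, by simpa using hx, ?_, Set.singleton_nonempty x, ?_⟩
    · rintro rfl
      simp at h2
    · rintro p ⟨y, rfl, hy⟩ ⟨z, rfl, hz⟩
      exact absurd hy hz
  obtain ⟨S, hS⟩ := Set.Finite.exists_maximal (Set.toFinite F) hF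
  obtain ⟨hSB, hne, ⟨z, hz⟩, hSc⟩ := hS.prop
  have hout : ∃ y ∈ B, y ∉ S := by
    by_contra! hcon
    exact hne (hSB.antisymm hcon)
  obtain ⟨x, -, y, hyB, hxS, hyS, hxy⟩ := hB (· ∈ S) ⟨z, hSB hz, hz⟩ hout
  have hins : insert y S = B := by
    by_contra hcon
    exact hyS (hS.le_of_ge (y := insert y S) ⟨Set.insert_subset hyB hSB, hcon,
      Set.insert_nonempty _ _, hSc.insert_of_adj hq hxS hxy⟩ (Set.subset_insert _ _) (.inl rfl))
  refine ⟨y, hyB, ?_⟩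
  rwa [← hins, Set.insert_sdiff_of_mem _ (Set.mem_singleton y), Set.sdiff_singleton_eq_self hyS]

theorem reachesTree_insert_of_equiv [Finite V] (hq : Polarizes Ω q) {R : Set V} {b : V}
    (hg : IsGood q (insert b R)) (hb : b ∉ R) (hc : Conn Ω (insert b R)) {m : ℕ} {a : ℕ → V}
    {C : Set V} (h : IsDShape Ω m a C) (he : EquivSets Ω R (dSet m a C)) :
    ReachesTree Ω (insert b R) := by
  have hR := hg.subset (Set.subset_insert b R)
  obtain ⟨hb', he'⟩ := hR.insert_equiv hq he (hg.indep.notMem_span hb)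
  refine .of_equiv he' (h.reachesTree_insert hq (hR.equiv hq he).indep hb' ?_)
  obtain ⟨u, -, v, hv | hv, rfl, hvb, huv⟩ := hg.conn_equiv hq he' hc (· = b) ⟨b, .inl rfl, rfl⟩
    ⟨a 0, .inr (.inl ⟨0, h.pos, rfl⟩), fun e => notMem_of_notMem_span hb' (e ▸ .inl ⟨0, h.pos, rfl⟩)⟩
  · exact absurd hv hvb
  · exact ⟨v, hv, huv⟩

theorem exists_isDShape [Finite V] (hq : Polarizes Ω q) (n : ℕ) {B : Set V}
    (hn : B.ncard = n + 2) (hg : IsGood q B) (hc : Conn Ω B) (hE : ¬ HasE6Type Ω q B) :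
    ∃ m a C, IsDShape Ω m a C ∧ EquivSets Ω B (dSet m a C) := by
  induction n generalizing B with
  | zero =>
    obtain ⟨x, y, hxy, rfl⟩ := Set.ncard_eq_two.1 hn
    obtain ⟨u, hu, v, hv, rfl, hvx, h1⟩ := hc (· = x) ⟨x, by simp, rfl⟩ ⟨y, by simp, hxy.symm⟩
    obtain rfl : v = y := by
      rcases hv with hv | hv
      exacts [absurd hv hvx, hv]
    refine ⟨1, fun _ => u, {v}, ⟨fun i hi j hj _ => by omega, fun _ _ => hxy, ⟨v, rfl⟩, ?_, ?_, ?_,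
      le_rfl, fun _ => Set.subsingleton_singleton⟩, ?_⟩
    · intro i hi j hj
      rw [hq.alternating, if_neg (by omega)]
    · rintro i hi _ rfl
      rw [h1, if_pos (by omega)]
    · rintro _ rfl _ rfl
      exact hq.alternating _
    · have : dSet 1 (fun _ => u) {v} = {u, v} := by
        ext z
        simp [dSet, eq_comm, or_comm]
      rw [this]
      exact .refl
  | succ n ih =>
    obtain ⟨y, hy, hcy⟩ := hc.exists_sdiff hq (by omega)
    have hins : insert y (B \ {y}) = B := by simp [hy]
    obtain ⟨m, a, C, hD, he⟩ := ih (B := B \ {y})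
      (by rw [Set.ncard_sdiff_singleton_of_mem hy]; omega) (hg.subset Set.sdiff_subset) hcy
      fun ⟨X, hX, hX'⟩ => hE ⟨X, hX.trans Set.sdiff_subset, hX'⟩
    have := reachesTree_insert_of_equiv hq (hins.symm ▸ hg) (fun h => h.2 rfl) (hins.symm ▸ hc) hD he
    rw [hins] at this
    obtain ⟨B', he', ⟨m', a', C', -, hD', rfl⟩ | ⟨x, hx, hxB⟩⟩ := this
    · exact ⟨m', a', C', hD', he'⟩
    · have hg' := hg.equiv hq he'
      exact absurd (hg'.hasE6Type_equiv hq (EquivSets.symm hq hg he')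
        ⟨_, hxB, hx.isE6Type hq (hg'.subset hxB)⟩) hE

theorem IsE6Type.exists_isE6Tuple [Finite V] (hq : Polarizes Ω q) {X : Set V} (hX : IsE6Type Ω q X)
    (hg : IsGood q X) : ∃ x, IsE6Tuple Ω x ∧ EquivSets Ω X (Set.range x) := by
  obtain ⟨y, hy, hcy⟩ := hX.conn.exists_sdiff hq (by rw [hX.ncard_eq]; omega)
  have hins : insert y (X \ {y}) = X := by simp [hy]
  have h5 : (X \ {y}).ncard = 3 + 2 := by
    rw [Set.ncard_sdiff_singleton_of_mem hy, hX.ncard_eq]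
  obtain ⟨m, a, C, hD, he⟩ := exists_isDShape hq 3 h5 (hg.subset Set.sdiff_subset) hcy
    fun ⟨Y, hY, hY'⟩ => by
      have := Set.ncard_le_ncard hY
      rw [hY'.ncard_eq] at this
      omega
  have := reachesTree_insert_of_equiv hq (hins.symm ▸ hg) (fun h => h.2 rfl)
    (hins.symm ▸ hX.conn) hD he
  rw [hins] at this
  obtain ⟨B', he', h⟩ := this
  have hg' := hg.equiv hq he'
  have hE' := hg.isE6Type_equiv hq he' hX
  obtain ⟨m', a', C', -, hD', rfl⟩ | ⟨x, hx, hxB⟩ := h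
  · exact absurd hE'.ones_eq (hD'.onesInSpan_ne hq hg' hE'.ncard_eq)
  · refine ⟨x, hx, ?_⟩
    rw [Set.eq_of_subset_of_ncard_le hxB]
    · exact he'
    · rw [hE'.ncard_eq, (hx.isE6Type hq (hg'.subset hxB)).ncard_eq]

theorem gr_adj (hq : Polarizes Ω q) {X : Set V} (u v : X) :
    (Gr Ω X).Adj u v ↔ Ω u.1 v.1 = 1 := by
  rw [Gr, SimpleGraph.fromRel_adj, hq.symm v.1 u.1, or_self]
  refine ⟨fun h => h.2, fun h => ⟨?_, h⟩⟩
  rintro rfl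
  rw [hq.alternating] at h
  exact absurd h (by decide)

theorem nonempty_iso_of_range (hq : Polarizes Ω q) {ι : Type*} {G : SimpleGraph ι} {g : ι → V}
    (hg : Function.Injective g) (h : ∀ i j, Ω (g i) (g j) = 1 ↔ G.Adj i j) :
    Nonempty (Gr Ω (Set.range g) ≃g G) :=
  ⟨SimpleGraph.Iso.symm ⟨Equiv.ofInjective g hg, by
    intro i j
    rw [gr_adj hq]
    exact h i j⟩⟩

theorem exists_range_of_iso (hq : Polarizes Ω q) {ι : Type*} {G : SimpleGraph ι} {X : Set V}
    (φ : Gr Ω X ≃g G) : ∃ g : ι → V, Function.Injective g ∧ Set.range g = X ∧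
      ∀ i j, Ω (g i) (g j) = 1 ↔ G.Adj i j := by
  refine ⟨fun i => (φ.symm i).1, Subtype.val_injective.comp φ.symm.injective, ?_, fun i j => ?_⟩
  · ext x
    constructor
    · rintro ⟨i, rfl⟩
      exact (φ.symm i).2
    · intro hx
      exact ⟨φ ⟨x, hx⟩, by simp⟩
  · rw [← gr_adj hq, φ.symm.map_adj_iff]

theorem e6Graph_adj (i j : Fin 6) : E6Graph.Adj i j ↔ e6Adj i j = true := by
  rw [E6Graph, SimpleGraph.fromRel_adj]
  revert i j
  decide

theorem ite_eq_one_iff {p : Prop} [Decidable p] : (if p then (1 : ZMod 2) else 0) = 1 ↔ p := by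
  split_ifs with h <;> simp [h]

theorem IsE6Tuple.nonempty_iso (hq : Polarizes Ω q) {x : Fin 6 → V} (hx : IsE6Tuple Ω x) :
    Nonempty (Gr Ω (Set.range x) ≃g E6Graph) :=
  nonempty_iso_of_range hq hx.injective fun i j => by
    rw [hx i j, e6Graph_adj, ite_eq_one_iff]

theorem exists_isE6Tuple_of_iso (hq : Polarizes Ω q) {X : Set V} (φ : Gr Ω X ≃g E6Graph) :
    ∃ x, IsE6Tuple Ω x ∧ Set.range x = X := by
  obtain ⟨x, -, hX, h⟩ := exists_range_of_iso hq φ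
  refine ⟨x, fun i j => ?_, hX⟩
  have := h i j
  rw [e6Graph_adj] at this
  split_ifs with hij
  · exact this.2 hij
  · exact eq_zero_of_ne_one fun h' => hij (this.1 h')

/-- The distance of a vertex of the tree `D_{m,k}` from the end of its path. -/
def level {m k : ℕ} : Fin m ⊕ Fin k → Fin (m + 1)
  | .inl i => i.castSucc
  | .inr _ => Fin.last m

theorem dmkGraph_adj {m k : ℕ} (s t : Fin m ⊕ Fin k) : (DmkGraph m k).Adj s t ↔
    (level s).val + 1 = (level t).val ∨ (level t).val + 1 = (level s).val := by
  rw [DmkGraph, SimpleGraph.fromRel_adj]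
  rcases s with i | i <;> rcases t with j | j
  · simp only [level, ne_eq, Sum.inl.injEq, Fin.val_castSucc, Fin.ext_iff]
    omega
  · simp [level]
    omega
  · simp [level]
    omega
  · simp [level]

theorem IsDShape.nonempty_iso [Finite V] (hq : Polarizes Ω q) {m : ℕ} {a : ℕ → V} {C : Set V}
    (h : IsDShape Ω m a C) : Nonempty (Gr Ω (dSet m a C) ≃g DmkGraph m C.ncard) := by
  let e : Fin C.ncard ≃ C := (Finite.equivFin C).symm
  let g : Fin m ⊕ Fin C.ncard → V := Sum.elim (fun i => a i) fun j => (e j).1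
  have hlev : ∀ s, AtLevel m a C (level s).val (g s) := by
    rintro (i | j)
    · exact .inl ⟨i.2, rfl⟩
    · exact .inr ⟨rfl, (e j).2⟩
  have hrange : Set.range g = dSet m a C := by
    ext x
    constructor
    · rintro ⟨s, rfl⟩
      exact (hlev s).mem
    · rintro (⟨i, hi, rfl⟩ | hx)
      · exact ⟨.inl ⟨i, hi⟩, rfl⟩
      · exact ⟨.inr (e.symm ⟨x, hx⟩), by simp [g]⟩
  rw [← hrange]
  refine nonempty_iso_of_range hq ?_ fun s t => ?_
  · rintro (i | i) (j | j) hij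
    · exact congrArg _ (Fin.ext (h.injOn i i.2 j j.2 hij))
    · have hij : a i = (e j).1 := hij
      exact absurd (hij ▸ (e j).2) (h.notMem i i.2)
    · have hij : (e i).1 = a j := hij
      exact absurd (hij ▸ (e i).2) (h.notMem j j.2)
    · exact congrArg _ (e.injective (Subtype.ext hij))
  · rw [h.apply_atLevel hq (hlev s) (hlev t), dmkGraph_adj, ite_eq_one_iff]

/-- The sum of two coordinate vectors. -/
def pairVec {n : ℕ} (i j : Fin n) : Fin n → ZMod 2 := Pi.single i 1 + Pi.single j 1

/-- The sums of two distinct coordinate vectors. -/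
def IsPair {n : ℕ} (y : Fin n → ZMod 2) : Prop := ∃ i j, i ≠ j ∧ y = pairVec i j

theorem pairVec_comm {n : ℕ} (i j : Fin n) : pairVec i j = pairVec j i := add_comm _ _

theorem pairVec_dotProduct {n : ℕ} (i j : Fin n) (y : Fin n → ZMod 2) :
    pairVec i j ⬝ᵥ y = y i + y j := by
  simp [pairVec, add_dotProduct]

theorem pairVec_apply {n : ℕ} (i j k : Fin n) :
    pairVec i j k = (if k = i then 1 else 0) + if k = j then 1 else 0 := by
  simp [pairVec, Pi.single_apply]

theorem pairVec_add {n : ℕ} (i j k : Fin n) : pairVec i j + pairVec i k = pairVec j k := by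
  have h2 : ∀ u : Fin n → ZMod 2, u + u = 0 := vadd_self
  rw [pairVec, pairVec, pairVec, add_add_add_comm, h2, zero_add]

theorem IsPair.exists_eq {n : ℕ} {y : Fin n → ZMod 2} (hy : IsPair y) {i : Fin n} (hi : y i = 1) :
    ∃ j, i ≠ j ∧ y = pairVec i j := by
  obtain ⟨k, l, hkl, rfl⟩ := hy
  rw [pairVec_apply] at hi
  by_cases h1 : i = k
  · exact ⟨l, h1 ▸ hkl, by rw [h1]⟩
  · by_cases h2 : i = l
    · exact ⟨k, h1, by rw [h2, pairVec_comm]⟩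
    · rw [if_neg h1, if_neg h2] at hi
      exact absurd hi (by decide)

theorem IsPair.add {n : ℕ} {y z : Fin n → ZMod 2} (hy : IsPair y) (hz : IsPair z)
    (h : y ⬝ᵥ z = 1) : IsPair (y + z) := by
  have key : ∀ i, y i = 1 → z i = 1 → IsPair (y + z) := by
    intro i hi hi'
    obtain ⟨j, hij, rfl⟩ := hy.exists_eq hi
    obtain ⟨k, hik, rfl⟩ := hz.exists_eq hi'
    refine ⟨j, k, ?_, pairVec_add i j k⟩
    rintro rfl
    rw [pairVec_dotProduct, hi', pairVec_apply, if_neg hij.symm, if_pos rfl] at h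
    exact absurd h (by decide)
  obtain ⟨i, j, hij, e⟩ := hy
  rw [e, pairVec_dotProduct] at h
  rcases zmod_two_cases (z i) with h0 | h1
  · refine key j ?_ ?_
    · rw [e, pairVec_apply, if_neg hij.symm, if_pos rfl, zero_add]
    · rwa [h0, zero_add] at h
  · refine key i ?_ h1
    rw [e, pairVec_apply, if_pos rfl, if_neg hij, add_zero]

theorem IsPair.eq_of_dotProduct {n : ℕ} {y z : Fin n → ZMod 2} (hy : IsPair y) (hz : IsPair z)
    (h : y ⬝ᵥ z = 0) {i : Fin n} (hi : y i = 1) (hi' : z i = 1) : y = z := by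
  obtain ⟨j, hij, rfl⟩ := hy.exists_eq hi
  obtain ⟨k, hik, rfl⟩ := hz.exists_eq hi'
  rw [pairVec_dotProduct, hi', pairVec_apply, if_neg hij.symm, zero_add] at h
  by_cases hjk : j = k
  · rw [hjk]
  · rw [if_neg hjk] at h
    exact absurd h (by decide)

/-- A realization of `B` by pairs, with `Ω` given by the parity of intersections. -/
def HasPairRep (Ω : BForm V) (B : Set V) : Prop :=
  ∃ (n : ℕ) (f : V →ₗ[ZMod 2] Fin n → ZMod 2), (∀ b ∈ B, IsPair (f b)) ∧
    ∀ u ∈ spn B, ∀ v ∈ spn B, Ω u v = f u ⬝ᵥ f v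

theorem HasPairRep.move {B B' : Set V} (h : Move Ω B B') (hB : HasPairRep Ω B) :
    HasPairRep Ω B' := by
  obtain ⟨n, f, hf, hΩ⟩ := hB
  refine ⟨n, f, ?_, by rwa [h.span_eq]⟩
  obtain ⟨R, a, c, -, -, ha, h1, rfl, rfl⟩ := h
  rintro b (rfl | hb)
  · rw [map_add, add_comm]
    refine (hf a (.inr ha)).add (hf c (.inl rfl)) ?_
    rw [← hΩ a (Submodule.subset_span (.inr ha)) c (Submodule.subset_span (.inl rfl)), h1]
  · exact hf b (.inr hb)

theorem HasPairRep.subset {B X : Set V} (h : HasPairRep Ω B) (hX : X ⊆ B) : HasPairRep Ω X := by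
  obtain ⟨n, f, hf, hΩ⟩ := h
  have hs : spn X ≤ spn B := Submodule.span_mono hX
  exact ⟨n, f, fun b hb => hf b (hX hb), fun u hu v hv => hΩ u (hs hu) v (hs hv)⟩

theorem IsE6Tuple.not_hasPairRep {x : Fin 6 → V} (hx : IsE6Tuple Ω x) :
    ¬ HasPairRep Ω (Set.range x) := by
  rintro ⟨n, f, hf, hΩ⟩
  have hP : ∀ i, IsPair (f (x i)) := fun i => hf _ ⟨i, rfl⟩
  have hdot : ∀ i j, f (x i) ⬝ᵥ f (x j) = if e6Adj i j then 1 else 0 := fun i j => by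
    rw [← hx i j, hΩ _ (Submodule.subset_span ⟨i, rfl⟩) _ (Submodule.subset_span ⟨j, rfl⟩)]
  obtain ⟨i, j, hij, h2⟩ := hP 2
  have hnb : ∀ s, e6Adj 2 s = true → f (x s) i + f (x s) j = 1 := fun s hs => by
    rw [← pairVec_dotProduct, ← h2, hdot, if_pos hs]
  have heq : ∀ s t, e6Adj 2 s = true → e6Adj 2 t = true → f (x s) i = f (x t) i →
      f (x s) = f (x t) := by
    intro s t hs ht h
    have hst : f (x s) ⬝ᵥ f (x t) = 0 := by
      rw [hdot, if_neg]
      clear h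
      revert s t; decide
    rcases zmod_two_cases (f (x s) i) with h0 | h1
    · have h1 := hnb s hs
      have h1' := hnb t ht
      rw [← h, h0, zero_add] at h1'
      rw [h0, zero_add] at h1
      exact (hP s).eq_of_dotProduct (hP t) hst h1 h1'
    · exact (hP s).eq_of_dotProduct (hP t) hst h1 (h ▸ h1)
  have hadj : ∀ s t u, e6Adj 2 s = true → e6Adj 2 t = true → e6Adj s u = true →
      e6Adj t u = false → f (x s) i ≠ f (x t) i := by
    intro s t u hs ht hsu htu h
    have e := hdot s u
    rw [heq s t hs ht h, hdot, if_pos hsu, if_neg (by rw [htu]; decide)] at e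
    exact absurd e (by decide)
  have pigeon : ∀ y z w : ZMod 2, y ≠ z → y ≠ w → z ≠ w → False := by decide
  exact pigeon _ _ _ (hadj 1 3 0 rfl rfl rfl rfl) (hadj 1 5 0 rfl rfl rfl rfl)
    (hadj 3 5 4 rfl rfl rfl rfl)

theorem hasPairRep_of_iso (hq : Polarizes Ω q) {B : Set V} (hB : Indep B) {m k : ℕ}
    (φ : Gr Ω B ≃g DmkGraph m k) : HasPairRep Ω B := by
  obtain ⟨g, hinj, rfl, hadj⟩ := exists_range_of_iso hq φ
  have hg : LinearIndependent (ZMod 2) g := (linearIndepOn_id_range_iff hinj).1 hB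
  let ρ : Fin m ⊕ Fin k → Fin (m + 2) → ZMod 2 := fun s =>
    pairVec (level s).castSucc (level s).succ
  obtain ⟨f, hf⟩ := LinearMap.exists_extend ((Module.Basis.span hg).constr (ZMod 2) ρ)
  have hfg : ∀ s, f (g s) = ρ s := fun s => by
    have h1 : (Module.Basis.span hg s : V) = g s := by
      rw [Module.Basis.span_apply]
    have h2 := LinearMap.congr_fun hf (Module.Basis.span hg s)
    rw [Module.Basis.constr_basis] at h2
    rw [← h2, LinearMap.comp_apply, Submodule.subtype_apply, h1]
  refine ⟨m + 2, f, ?_, ?_⟩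
  · rintro _ ⟨s, rfl⟩
    exact ⟨_, _, (Fin.castSucc_lt_succ).ne, hfg s⟩
  · have hgram : ∀ s t, Ω (g s) (g t) = f (g s) ⬝ᵥ f (g t) := by
      intro s t
      have h1 : Ω (g s) (g t) = if (level s).val + 1 = (level t).val ∨
          (level t).val + 1 = (level s).val then 1 else 0 := by
        have := hadj s t
        rw [dmkGraph_adj] at this
        split_ifs with h
        · exact this.2 h
        · exact eq_zero_of_ne_one fun h' => h (this.1 h')
      rw [h1, hfg, hfg]
      simp only [ρ]
      rw [pairVec_dotProduct, pairVec_apply, pairVec_apply]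
      generalize level s = i
      generalize level t = j
      simp only [Fin.ext_iff, Fin.val_castSucc, Fin.val_succ]
      obtain h | h | h | h : i.val = j.val ∨ i.val + 1 = j.val ∨ j.val + 1 = i.val ∨
        (i.val ≠ j.val ∧ i.val + 1 ≠ j.val ∧ j.val + 1 ≠ i.val) := by omega
      · rw [if_neg (by omega), if_pos (by omega), if_neg (by omega), if_neg (by omega),
          if_pos (by omega)]
        decide
      · rw [if_pos (by omega), if_neg (by omega), if_neg (by omega), if_pos (by omega),
          if_neg (by omega)]
        decide
      · rw [if_pos (by omega), if_neg (by omega), if_pos (by omega), if_neg (by omega),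
          if_neg (by omega)]
        decide
      · rw [if_neg (by omega), if_neg (by omega), if_neg (by omega), if_neg (by omega),
          if_neg (by omega)]
        decide
    intro u hu v hv
    induction hu, hv using Submodule.span_induction₂ with
    | mem_mem u v hu hv =>
      obtain ⟨s, rfl⟩ := hu
      obtain ⟨t, rfl⟩ := hv
      exact hgram s t
    | zero_left => simp
    | zero_right => simp
    | add_left _ _ _ _ _ _ h1 h2 => simp [h1, h2, add_dotProduct]
    | add_right _ _ _ _ _ _ h1 h2 => simp [h1, h2, dotProduct_add]
    | smul_left _ _ _ _ _ h => simp [h]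
    | smul_right _ _ _ _ _ h => simp [h]

end TransvectionTrees

open TransvectionTrees

/-- A connected `B` with `|B| ≥ 3` is equivalent to a set whose graph is a tree
of type `D_{m,k}` (`m ≥ 2`, `k ≥ 1`) iff no subset of `B` is equivalent to a set whose
graph is `E₆`. -/
theorem stmt_2 {V : Type*} [AddCommGroup V] [Module (ZMod 2) V]
    [FiniteDimensional (ZMod 2) V]
    (Ω : BForm V) (hΩ : ∀ x : V, Ω x x = 0)
    (B : Set V) (hli : LinearIndependent (ZMod 2) (Subtype.val : B → V))
    (hcard : 3 ≤ B.ncard) (hconn : (Gr Ω B).Connected) :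
    (∃ m k : ℕ, 2 ≤ m ∧ 1 ≤ k ∧ EquivToDmkTree Ω B m k) ↔ ¬ HasE6Subgraph Ω B := by
  have : Finite V := Module.finite_of_finite (ZMod 2)
  obtain ⟨q, hq, hg⟩ := exists_polarizes hΩ (B := B) hli
  constructor
  · rintro ⟨m, k, -, -, B', he, ⟨φ⟩⟩ ⟨X, hXB, X', heX, ⟨ψ⟩⟩
    have hg' := hg.equiv hq he
    have hrep := (hg'.induction hq (fun _ _ _ => HasPairRep.move) (EquivSets.symm hq hg he)
      (hasPairRep_of_iso hq hg'.indep φ)).2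
    have hrepX := ((hg.subset hXB).induction hq (fun _ _ _ => HasPairRep.move) heX
      (hrep.subset hXB)).2
    obtain ⟨x, hx, rfl⟩ := exists_isE6Tuple_of_iso hq ψ
    exact hx.not_hasPairRep hrepX
  · intro hE
    have hE' : ¬ HasE6Type Ω q B := by
      rintro ⟨X, hXB, hX⟩
      obtain ⟨x, hx, he⟩ := hX.exists_isE6Tuple hq (hg.subset hXB)
      exact hE ⟨X, hXB, _, he, hx.nonempty_iso hq⟩
    have hn : B.ncard = (B.ncard - 2) + 2 := by omega
    obtain ⟨m, a, C, hD, he⟩ := exists_isDShape hq _ hn hg (conn_of_connected hq hconn) hE'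
    have hcard' : (dSet m a C).ncard = B.ncard :=
      (hg.induction hq (P := fun X => X.ncard = B.ncard)
        (fun _ _ _ hm hX => hm.ncard_eq.trans hX) he rfl).2
    rw [hD.ncard_dSet] at hcard'
    have hpos := hD.pos
    have hm : m ≠ 1 := by
      intro hm
      have := Set.ncard_le_one_iff_subsingleton.2 (hD.small hm)
      omega
    exact ⟨m, C.ncard, by omega, (Set.ncard_pos).2 hD.nonempty, _, he, hD.nonempty_iso hq⟩
end

section
/- Let B⊆V be a linearly independent subset with |B|≥3 such that Gr(B) is connected. Then B is equivalent to a linearly independent set whose graph is a tree of type D_{m,1} for some m≥2 if and only if Gr(B) has no induced subgraph isomorphic to a member of the family F. -/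
open scoped BigOperators

variable {V : Type*} [AddCommGroup V] [Module (ZMod 2) V]

/-! ### Characteristic two bookkeeping -/

lemma ZMod.two_ne_one_iff {x : ZMod 2} : x ≠ 1 ↔ x = 0 := by
  revert x; decide

lemma add_add_self_right (x y : V) : x + y + y = x := by
  rw [add_assoc, ZModModule.add_self, add_zero]

lemma alternating_swap {Ω : BForm V} (hΩ : ∀ x : V, Ω x x = 0) (x y : V) : Ω x y = Ω y x := by
  have h := hΩ (x + y)
  simp only [map_add, LinearMap.add_apply, hΩ, zero_add, add_zero] at h
  rw [← sub_eq_zero, CharTwo.sub_eq_add, add_comm, h]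

/-! ### Basic moves and linear independence -/

lemma LinearIndepOn.add_notMem_span_diff {B : Set V} (hB : LinearIndepOn (ZMod 2) id B) {a c : V}
    (ha : a ∈ B) (hc : c ∈ B) (hac : a ≠ c) :
    c + a ∉ Submodule.span (ZMod 2) (B \ {c}) := by
  intro h
  have ha' : a ∈ Submodule.span (ZMod 2) (B \ {c}) := Submodule.subset_span ⟨ha, hac⟩
  have hc' : c ∈ Submodule.span (ZMod 2) (B \ {c}) := (Submodule.add_mem_iff_left _ ha').1 h
  exact linearIndepOn_iff_notMem_span.1 hB c hc (by simpa using hc')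

lemma MoveRel.linearIndepOn {Ω : BForm V} {B B' : Set V} (h : MoveRel Ω B B')
    (hB : LinearIndepOn (ZMod 2) id B) : LinearIndepOn (ZMod 2) id B' := by
  obtain ⟨a, c, ha, hc, hac, -, rfl⟩ := h
  exact (hB.mono Set.sdiff_subset).id_insert (hB.add_notMem_span_diff ha hc hac)

lemma EquivSets.linearIndepOn {Ω : BForm V} {B B' : Set V} (h : EquivSets Ω B B')
    (hB : LinearIndepOn (ZMod 2) id B) : LinearIndepOn (ZMod 2) id B' := by
  induction h with
  | refl => exact hB
  | tail _ h ih => exact h.linearIndepOn ih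

lemma MoveRel.symm {Ω : BForm V} (hΩ : ∀ x : V, Ω x x = 0) {B B' : Set V} (h : MoveRel Ω B B')
    (hB : LinearIndepOn (ZMod 2) id B) : MoveRel Ω B' B := by
  obtain ⟨a, c, ha, hc, hac, h1, rfl⟩ := h
  have hn : c + a ∉ B \ {c} := fun h =>
    hB.add_notMem_span_diff ha hc hac (Submodule.subset_span h)
  refine ⟨a, c + a, Or.inr ⟨ha, hac⟩, Or.inl rfl, ?_, ?_, ?_⟩
  · intro h
    have : c = 0 := by simpa using h
    simp [this] at h1
  · simp [hΩ, h1]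
  · rw [add_add_self_right, Set.insert_sdiff_self_of_notMem hn, Set.insert_sdiff_singleton,
      Set.insert_eq_of_mem hc]

lemma EquivSets.symm {Ω : BForm V} (hΩ : ∀ x : V, Ω x x = 0) {B B' : Set V}
    (h : EquivSets Ω B B') (hB : LinearIndepOn (ZMod 2) id B) : EquivSets Ω B' B := by
  induction h with
  | refl => exact .refl
  | tail h₁ h₂ ih => exact .head (h₂.symm hΩ (EquivSets.linearIndepOn h₁ hB)) ih

lemma MoveRel.span_le {Ω : BForm V} {B B' : Set V} (h : MoveRel Ω B B') :
    Submodule.span (ZMod 2) B' ≤ Submodule.span (ZMod 2) B := by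
  obtain ⟨a, c, ha, hc, -, -, rfl⟩ := h
  rw [Submodule.span_le]
  rintro x (rfl | hx)
  · exact add_mem (Submodule.subset_span hc) (Submodule.subset_span ha)
  · exact Submodule.subset_span hx.1

lemma EquivSets.span_le {Ω : BForm V} {B B' : Set V} (h : EquivSets Ω B B') :
    Submodule.span (ZMod 2) B' ≤ Submodule.span (ZMod 2) B := by
  induction h with
  | refl => exact le_rfl
  | tail _ h ih => exact h.span_le.trans ih

lemma EquivSets.insert {Ω : BForm V} {B B' : Set V} (h : EquivSets Ω B B') {v : V}
    (hv : v ∉ Submodule.span (ZMod 2) B) : EquivSets Ω (insert v B) (insert v B') := by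
  induction h with
  | refl => exact .refl
  | @tail C D h₁ h₂ ih =>
    refine ih.tail ?_
    have hvC : v ∉ C := fun h => hv (EquivSets.span_le h₁ (Submodule.subset_span h))
    obtain ⟨a, c, ha, hc, hac, h1, rfl⟩ := h₂
    refine ⟨a, c, Or.inr ha, Or.inr hc, hac, h1, ?_⟩
    have hvc : v ≠ c := fun h => hvC (h ▸ hc)
    rw [Set.insert_comm, Set.insert_sdiff_of_notMem C (by simpa using hvc)]

/-! ### Graphs of sets of vectors as indexed families -/

lemma gr_adj {Ω : BForm V} (hΩ : ∀ x : V, Ω x x = 0) {X : Set V} {x y : X} :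
    (Gr Ω X).Adj x y ↔ Ω x.1 y.1 = 1 := by
  simp only [Gr, SimpleGraph.fromRel_adj, alternating_swap hΩ y.1 x.1, or_self,
    and_iff_right_iff_imp]
  rintro h rfl
  simp [hΩ] at h

lemma nonempty_gr_iso_iff {Ω : BForm V} (hΩ : ∀ x : V, Ω x x = 0) {X : Set V} {α : Type*}
    {G : SimpleGraph α} : Nonempty (Gr Ω X ≃g G) ↔
      ∃ f : α → V, Function.Injective f ∧ Set.range f = X ∧
        ∀ i j, Ω (f i) (f j) = 1 ↔ G.Adj i j := by
  constructor
  · rintro ⟨e⟩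
    refine ⟨fun i => (e.symm i).1, Subtype.val_injective.comp e.symm.injective, ?_, fun i j => ?_⟩
    · ext x
      constructor
      · rintro ⟨i, rfl⟩
        exact (e.symm i).2
      · exact fun hx => ⟨e ⟨x, hx⟩, by simp⟩
    · rw [← gr_adj hΩ, e.symm.map_adj_iff]
  · rintro ⟨f, hf, rfl, h⟩
    refine ⟨(⟨Equiv.ofInjective f hf, fun {i j} => ?_⟩ : G ≃g Gr Ω (Set.range f)).symm⟩
    rw [gr_adj hΩ]
    exact h i j

/-! ### Edge representations

A set of vectors represented by the edges of a forest on the vertices `0, …, n`. -/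

/-- `φ` identifies the span of `B` isometrically with a subspace of the coordinate space on
`0, …, n`, in such a way that every element of `B` becomes a sum of two distinct unit vectors. -/
structure EdgeRep (Ω : BForm V) (n : ℕ) (φ : V →ₗ[ZMod 2] ℕ → ZMod 2) (B : Set V) : Prop where
  pair : ∀ b ∈ B, ∃ i j, i ≤ n ∧ j ≤ n ∧ i ≠ j ∧
    φ b = Pi.single i (1 : ZMod 2) + Pi.single j (1 : ZMod 2)
  form : ∀ x ∈ Submodule.span (ZMod 2) B, ∀ y ∈ Submodule.span (ZMod 2) B,
    Ω x y = ∑ k ∈ Finset.range (n + 1), φ x k * φ y k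
  inj : ∀ x ∈ Submodule.span (ZMod 2) B, φ x = 0 → x = 0

lemma sum_single_add_single_mul {n i j k l : ℕ} (hi : i ≤ n) (hj : j ≤ n) :
    ∑ t ∈ Finset.range (n + 1),
      (Pi.single i (1 : ZMod 2) + Pi.single j (1 : ZMod 2) : ℕ → ZMod 2) t *
      (Pi.single k (1 : ZMod 2) + Pi.single l (1 : ZMod 2) : ℕ → ZMod 2) t =
      (if i = k then 1 else 0) + (if i = l then 1 else 0) +
        ((if j = k then 1 else 0) + (if j = l then 1 else 0)) := by
  have hi' : i < n + 1 := by omega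
  have hj' : j < n + 1 := by omega
  simp [Pi.single_apply, add_mul, Finset.sum_add_distrib, hi', hj']

lemma single_add_single_apply_eq_one {i j k : ℕ} (hij : i ≠ j) :
    (Pi.single i (1 : ZMod 2) + Pi.single j (1 : ZMod 2) : ℕ → ZMod 2) k = 1 ↔ k = i ∨ k = j := by
  by_cases h : k = i <;> by_cases h' : k = j <;> simp_all

namespace EdgeRep

variable {Ω : BForm V} {n : ℕ} {φ : V →ₗ[ZMod 2] ℕ → ZMod 2} {B : Set V}

lemma injOn (h : EdgeRep Ω n φ B) {x y : V} (hx : x ∈ B) (hy : y ∈ B) (hxy : φ x = φ y) :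
    x = y :=
  sub_eq_zero.1 (h.inj _ (sub_mem (Submodule.subset_span hx) (Submodule.subset_span hy))
    (by rw [map_sub, hxy, sub_self]))

lemma exists_other (h : EdgeRep Ω n φ B) {x : V} (hx : x ∈ B) {i : ℕ} (hi : φ x i = 1) :
    ∃ j, i ≤ n ∧ j ≤ n ∧ i ≠ j ∧ φ x = Pi.single i (1 : ZMod 2) + Pi.single j (1 : ZMod 2) := by
  obtain ⟨k, l, hk, hl, hkl, e⟩ := h.pair x hx
  rw [e, single_add_single_apply_eq_one hkl] at hi
  rcases hi with rfl | rfl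
  · exact ⟨l, hk, hl, hkl, e⟩
  · exact ⟨k, hl, hk, hkl.symm, by rw [e, add_comm]⟩

lemma form_eq_one_iff (h : EdgeRep Ω n φ B) {x y : V} (hx : x ∈ B) (hy : y ∈ B) (hxy : x ≠ y) :
    Ω x y = 1 ↔ ∃ k, φ x k = 1 ∧ φ y k = 1 := by
  rw [h.form x (Submodule.subset_span hx) y (Submodule.subset_span hy)]
  constructor
  · intro h1
    by_contra! hk
    have : ∀ k ∈ Finset.range (n + 1), φ x k * φ y k = 0 := by
      intro k _
      by_cases hxk : φ x k = 1
      · rw [ZMod.two_ne_one_iff.1 (hk k hxk), mul_zero]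
      · rw [ZMod.two_ne_one_iff.1 hxk, zero_mul]
    rw [Finset.sum_eq_zero this] at h1
    exact zero_ne_one h1
  · rintro ⟨k, hxk, hyk⟩
    obtain ⟨i, hk, hi, hki, ex⟩ := h.exists_other hx hxk
    obtain ⟨j, -, hj, hkj, ey⟩ := h.exists_other hy hyk
    have hij : i ≠ j := by
      rintro rfl
      exact hxy (h.injOn hx hy (ex.trans ey.symm))
    rw [ex, ey, sum_single_add_single_mul hk hi]
    simp [hkj, hki.symm, hij]

/-- Two edges with two common endpoints coincide. -/
lemma eq_of_apply_eq_one (h : EdgeRep Ω n φ B) {x y : V} (hx : x ∈ B) (hy : y ∈ B) {i j : ℕ}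
    (hij : i ≠ j) (hxi : φ x i = 1) (hxj : φ x j = 1) (hyi : φ y i = 1) (hyj : φ y j = 1) :
    x = y := by
  obtain ⟨k, -, -, hk, ex⟩ := h.exists_other hx hxi
  obtain ⟨l, -, -, hl, ey⟩ := h.exists_other hy hyi
  rw [ex, single_add_single_apply_eq_one hk] at hxj
  rw [ey, single_add_single_apply_eq_one hl] at hyj
  obtain rfl : j = k := by grind
  obtain rfl : j = l := by grind
  exact h.injOn hx hy (ex.trans ey.symm)

/-- Three pairwise adjacent edges have a common endpoint. -/
lemma exists_common (h : EdgeRep Ω n φ B) (hB : LinearIndepOn (ZMod 2) id B) {x y z : V}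
    (hx : x ∈ B) (hy : y ∈ B) (hz : z ∈ B) (hxy : x ≠ y) (hxz : x ≠ z) (hyz : y ≠ z) {k : ℕ}
    (hxk : φ x k = 1) (hyk : φ y k = 1) (hxz1 : Ω x z = 1) (hyz1 : Ω y z = 1) :
    φ z k = 1 := by
  by_contra hzk
  obtain ⟨i, hzi, hxi⟩ := ((h.form_eq_one_iff hx hz hxz).1 hxz1).imp fun _ => And.symm
  obtain ⟨j, hyj, hzj⟩ := (h.form_eq_one_iff hy hz hyz).1 hyz1
  have hki : k ≠ i := by rintro rfl; exact hzk hzi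
  have hkj : k ≠ j := by rintro rfl; exact hzk hzj
  have hij : i ≠ j := by
    rintro rfl
    exact hxy (h.eq_of_apply_eq_one hx hy hki hxk hxi hyk hyj)
  obtain ⟨i', -, -, hi', ex⟩ := h.exists_other hx hxk
  obtain ⟨j', -, -, hj', ey⟩ := h.exists_other hy hyk
  obtain ⟨l, -, -, hl, ez⟩ := h.exists_other hz hzi
  rw [ex, single_add_single_apply_eq_one hi'] at hxi
  rw [ey, single_add_single_apply_eq_one hj'] at hyj
  rw [ez, single_add_single_apply_eq_one hl] at hzj
  obtain rfl : i = i' := by grind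
  obtain rfl : j = j' := by grind
  obtain rfl : j = l := by grind
  have hzxy : z = x + y := by
    rw [← sub_eq_zero]
    refine h.inj _ (sub_mem (Submodule.subset_span hz)
      (add_mem (Submodule.subset_span hx) (Submodule.subset_span hy))) ?_
    rw [map_sub, map_add, ex, ey, ez]
    ext t
    simp only [Pi.sub_apply, Pi.add_apply, Pi.zero_apply, CharTwo.sub_eq_add]
    generalize (Pi.single k 1 : ℕ → ZMod 2) t = a
    generalize (Pi.single i 1 : ℕ → ZMod 2) t = b
    generalize (Pi.single j 1 : ℕ → ZMod 2) t = c
    revert a b c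
    decide
  refine linearIndepOn_iff_notMem_span.1 hB z hz ?_
  rw [Set.image_id, id_eq, hzxy]
  rw [hzxy] at hxz hyz
  exact add_mem (Submodule.subset_span ⟨hx, hxz⟩) (Submodule.subset_span ⟨hy, hyz⟩)

lemma moveRel (h : EdgeRep Ω n φ B) {B' : Set V} (hm : MoveRel Ω B B') : EdgeRep Ω n φ B' := by
  have hs := hm.span_le
  refine ⟨?_, fun x hx y hy => h.form x (hs hx) y (hs hy), fun x hx => h.inj x (hs hx)⟩
  obtain ⟨a, c, ha, hc, hac, h1, rfl⟩ := hm
  rintro b (rfl | hb)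
  · obtain ⟨k, hak, hck⟩ := (h.form_eq_one_iff ha hc hac).1 h1
    obtain ⟨i, -, hi, -, ea⟩ := h.exists_other ha hak
    obtain ⟨j, -, hj, -, ec⟩ := h.exists_other hc hck
    refine ⟨j, i, hj, hi, ?_, ?_⟩
    · rintro rfl
      exact hac (h.injOn ha hc (ea.trans ec.symm))
    · rw [map_add, ea, ec, add_comm (Pi.single k 1) (Pi.single j 1), add_assoc,
        ← add_assoc (Pi.single k 1), ZModModule.add_self, zero_add]
  · exact h.pair b hb.1

lemma equivSets (h : EdgeRep Ω n φ B) {B' : Set V} (hm : EquivSets Ω B B') :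
    EdgeRep Ω n φ B' := by
  induction hm with
  | refl => exact h
  | tail _ hm ih => exact ih.moveRel hm

end EdgeRep

/-! ### Paths -/

/-- The vectors `p 0, …, p (n - 1)` are distinct and consecutive ones are exactly the adjacent
pairs. -/
structure IsPathSeq (Ω : BForm V) (n : ℕ) (p : ℕ → V) : Prop where
  injOn : Set.InjOn p (Set.Iio n)
  form : ∀ i < n, ∀ j < n, Ω (p i) (p j) = if i + 1 = j ∨ j + 1 = i then 1 else 0

lemma IsPathSeq.exists_edgeRep {Ω : BForm V} {n : ℕ} {p : ℕ → V} (hp : IsPathSeq Ω n p)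
    (hli : LinearIndepOn (ZMod 2) id (p '' Set.Iio n)) :
    ∃ φ : V →ₗ[ZMod 2] ℕ → ZMod 2, EdgeRep Ω n φ (p '' Set.Iio n) ∧
      ∀ i < n, φ (p i) = Pi.single i (1 : ZMod 2) + Pi.single (i + 1) (1 : ZMod 2) := by
  obtain ⟨φ, hφ⟩ : ∃ φ : V →ₗ[ZMod 2] ℕ → ZMod 2,
      ∀ i < n, φ (p i) = Pi.single i (1 : ZMod 2) + Pi.single (i + 1) (1 : ZMod 2) := by
    let b := Module.Basis.extend hli
    classical
    let g : V → ℕ → ZMod 2 := fun x =>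
      if h : ∃ i < n, p i = x then
        Pi.single h.choose (1 : ZMod 2) + Pi.single (h.choose + 1) (1 : ZMod 2) else 0
    refine ⟨b.constr (ZMod 2) (fun x => g x.1), fun i hi => ?_⟩
    have hmem : p i ∈ hli.extend (Set.subset_univ _) :=
      hli.subset_extend _ ⟨i, hi, rfl⟩
    have hb : b ⟨p i, hmem⟩ = p i := Module.Basis.extend_apply_self _ _
    have hex : ∃ k < n, p k = p i := ⟨i, hi, rfl⟩
    rw [← hb, Module.Basis.constr_basis]
    have hch : hex.choose = i := hp.injOn hex.choose_spec.1 hi hex.choose_spec.2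
    simp only [g]
    rw [dif_pos hex, hch]
  refine ⟨φ, ⟨?_, ?_, ?_⟩, hφ⟩
  · rintro _ ⟨i, hi, rfl⟩
    have hi : i < n := hi
    exact ⟨i, i + 1, by omega, by omega, by omega, hφ i hi⟩
  · intro x hx y hy
    induction hx, hy using Submodule.span_induction₂ with
    | mem_mem x y hx hy =>
      obtain ⟨i, hi, rfl⟩ := hx
      obtain ⟨j, hj, rfl⟩ := hy
      have hi : i < n := hi
      have hj : j < n := hj
      rw [hφ i hi, hφ j hj, sum_single_add_single_mul (by omega) (by omega), hp.form i hi j hj]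
      by_cases hij : i = j
      · subst hij
        simp [CharTwo.add_self_eq_zero]
      · grind
    | zero_left y hy => simp
    | zero_right x hx => simp
    | add_left x y z hx hy hz h₁ h₂ => simp [h₁, h₂, add_mul, Finset.sum_add_distrib]
    | add_right x y z hx hy hz h₁ h₂ => simp [h₁, h₂, mul_add, Finset.sum_add_distrib]
    | smul_left r x y hx hy h => simp [h, mul_assoc, Finset.mul_sum]
    | smul_right r x y hx hy h => simp [h, mul_left_comm, Finset.mul_sum]
  · let q : ℕ → V := fun k => ∑ i ∈ Finset.range k, p i
    let ψ : V → V := fun x => ∑ k ∈ Finset.range (n + 1), φ x k • q k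
    have hψ : ∀ x ∈ Submodule.span (ZMod 2) (p '' Set.Iio n), ψ x = x := by
      intro x hx
      induction hx using Submodule.span_induction with
      | mem x hx =>
        obtain ⟨i, hi, rfl⟩ := hx
        have hi : i < n := hi
        have hi' : i < n + 1 := by omega
        simp only [ψ, hφ i hi, Pi.add_apply, Pi.single_apply, add_smul, ite_smul, one_smul,
          zero_smul, Finset.sum_add_distrib, Finset.sum_ite_eq', Finset.mem_range, hi', hi,
          Nat.add_lt_add_iff_right, if_true, q]
        rw [Finset.sum_range_succ, ← add_assoc, ZModModule.add_self, zero_add]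
      | zero => simp [ψ]
      | add x y hx hy h₁ h₂ =>
        simp only [ψ] at h₁ h₂ ⊢
        simp only [map_add, Pi.add_apply, add_smul, Finset.sum_add_distrib, h₁, h₂]
      | smul r x hx h =>
        simp only [ψ] at h ⊢
        simp only [map_smul, Pi.smul_apply, smul_assoc, ← Finset.smul_sum, h]
    intro x hx h0
    rw [← hψ x hx]
    simp [ψ, h0]

/-! ### The forbidden graphs do not have edge representations -/

lemma cycleGraph_adj {n : ℕ} {i j : Fin n} : (CycleGraph n).Adj i j ↔
    i ≠ j ∧ (j.val = (i.val + 1) % n ∨ i.val = (j.val + 1) % n) := by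
  simp [CycleGraph, SimpleGraph.fromRel_adj]

namespace EdgeRep

variable {Ω : BForm V} {n : ℕ} {φ : V →ₗ[ZMod 2] ℕ → ZMod 2} {B : Set V}

lemma not_claw (h : EdgeRep Ω n φ B) {x a b c : V} (hx : x ∈ B) (ha : a ∈ B) (hb : b ∈ B)
    (hc : c ∈ B) (hxa : x ≠ a) (hxb : x ≠ b) (hxc : x ≠ c) (hab : a ≠ b) (hac : a ≠ c)
    (hbc : b ≠ c) (hxa1 : Ω x a = 1) (hxb1 : Ω x b = 1) (hxc1 : Ω x c = 1)
    (hab1 : Ω a b ≠ 1) (hac1 : Ω a c ≠ 1) : Ω b c = 1 := by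
  obtain ⟨i, hxi, hai⟩ := (h.form_eq_one_iff hx ha hxa).1 hxa1
  obtain ⟨j, hxj, hbj⟩ := (h.form_eq_one_iff hx hb hxb).1 hxb1
  obtain ⟨k, hxk, hck⟩ := (h.form_eq_one_iff hx hc hxc).1 hxc1
  rw [Ne, h.form_eq_one_iff ha hb hab] at hab1
  rw [Ne, h.form_eq_one_iff ha hc hac] at hac1
  rw [h.form_eq_one_iff hb hc hbc]
  obtain ⟨l, -, -, hl, e⟩ := h.exists_other hx hxi
  rw [e, single_add_single_apply_eq_one hl] at hxj hxk
  grind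

lemma not_diamond (h : EdgeRep Ω n φ B) (hB : LinearIndepOn (ZMod 2) id B) {x y a b : V}
    (hx : x ∈ B) (hy : y ∈ B) (ha : a ∈ B) (hb : b ∈ B) (hxy : x ≠ y) (hxa : x ≠ a) (hya : y ≠ a)
    (hxb : x ≠ b) (hyb : y ≠ b) (hab : a ≠ b) (hxy1 : Ω x y = 1) (hxa1 : Ω x a = 1)
    (hya1 : Ω y a = 1) (hxb1 : Ω x b = 1) (hyb1 : Ω y b = 1) : Ω a b = 1 := by
  obtain ⟨k, hxk, hyk⟩ := (h.form_eq_one_iff hx hy hxy).1 hxy1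
  rw [h.form_eq_one_iff ha hb hab]
  exact ⟨k, h.exists_common hB hx hy ha hxy hxa hya hxk hyk hxa1 hya1,
    h.exists_common hB hx hy hb hxy hxb hyb hxk hyk hxb1 hyb1⟩

lemma not_cycle (h : EdgeRep Ω n φ B) (hB : LinearIndepOn (ZMod 2) id B) {m : ℕ} (hm : 4 ≤ m)
    {f : Fin m → V} (hf : Function.Injective f) (hfB : ∀ i, f i ∈ B)
    (hadj : ∀ i j, Ω (f i) (f j) = 1 ↔ (CycleGraph m).Adj i j) : False := by
  have : NeZero m := ⟨by omega⟩
  have hmod : ∀ a < 2 * m, a % m = if a < m then a else a - m := by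
    intro a ha
    split_ifs with h'
    · exact Nat.mod_eq_of_lt h'
    · rw [Nat.mod_eq_sub_mod (by omega), Nat.mod_eq_of_lt (by omega)]
  have hsucc : ∀ i : Fin m, (i + 1).val = if i.val + 1 < m then i.val + 1 else i.val + 1 - m := by
    intro i
    rw [Fin.val_add, Fin.val_one', Nat.add_mod_mod, hmod _ (by omega)]
  have hne : ∀ i : Fin m, i ≠ i + 1 := fun i hi => by
    have := congrArg Fin.val hi
    rw [hsucc] at this
    split_ifs at this <;> omega
  have hstep : ∀ i, ∃ k, φ (f i) k = 1 ∧ φ (f (i + 1)) k = 1 := by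
    intro i
    rw [← h.form_eq_one_iff (hfB _) (hfB _) (hf.ne (hne i)), hadj, cycleGraph_adj]
    refine ⟨hne i, Or.inl ?_⟩
    rw [hsucc, hmod _ (by omega)]
  choose w hw hw' using hstep
  have hww : ∀ i, w i ≠ w (i + 1) := by
    intro i hi
    have h2 := hsucc (i + 1)
    have h1 := hsucc i
    have hlt := (i + 1 + 1).isLt
    have hne2 : i ≠ i + 1 + 1 := fun hi => by
      have := congrArg Fin.val hi
      rw [h2, h1] at this
      split_ifs at this <;> omega
    have h3 : Ω (f i) (f (i + 1 + 1)) = 1 :=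
      (h.form_eq_one_iff (hfB _) (hfB _) (hf.ne hne2)).2 ⟨w i, hw i, hi ▸ hw' (i + 1)⟩
    rw [hadj, cycleGraph_adj, hmod (i.val + 1) (by omega),
      hmod ((i + 1 + 1).val + 1) (by omega), h2, h1] at h3
    have := h3.2
    split_ifs at this <;> omega
  have hφ : ∀ i, φ (f (i + 1)) =
      Pi.single (w i) (1 : ZMod 2) + Pi.single (w (i + 1)) (1 : ZMod 2) := by
    intro i
    obtain ⟨j, -, -, hj, e⟩ := h.exists_other (hfB (i + 1)) (hw' i)
    have := hw (i + 1)
    rw [e, single_add_single_apply_eq_one hj] at this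
    rw [e, this.resolve_left (hww i).symm]
  have hsum : ∑ i, f (i + 1) = 0 := by
    refine h.inj _ (sum_mem fun i _ => Submodule.subset_span (hfB _)) ?_
    have hshift := Equiv.sum_comp (Equiv.addRight (1 : Fin m)) fun i =>
      (Pi.single (w i) (1 : ZMod 2) : ℕ → ZMod 2)
    simp only [Equiv.coe_addRight] at hshift
    rw [map_sum, Finset.sum_congr rfl fun i _ => hφ i, Finset.sum_add_distrib, hshift,
      ZModModule.add_self]
  have hshift := Equiv.sum_comp (Equiv.addRight (1 : Fin m)) f
  simp only [Equiv.coe_addRight] at hshift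
  rw [hshift] at hsum
  have hli : LinearIndependent (ZMod 2) f :=
    hB.linearIndependent.comp (fun i => (⟨f i, hfB i⟩ : B))
      fun i j hij => hf (congrArg Subtype.val hij)
  have := Fintype.linearIndependent_iff.1 hli (fun _ => 1) (by simpa using hsum) 0
  exact one_ne_zero this

lemma not_inF (h : EdgeRep Ω n φ B) (hΩ : ∀ x : V, Ω x x = 0)
    (hB : LinearIndepOn (ZMod 2) id B) : ¬ ∃ X ⊆ B, InF (Gr Ω X) := by
  rintro ⟨X, hXB, hX⟩
  simp only [InF, nonempty_gr_iso_iff hΩ] at hX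
  rcases hX with ⟨f, hf, rfl, hadj⟩ | ⟨f, hf, rfl, hadj⟩ | ⟨m, hm, f, hf, rfl, hadj⟩
  · have hm : ∀ i, f i ∈ B := fun i => hXB ⟨i, rfl⟩
    have := h.not_claw (hm (.inl 1)) (hm (.inl 0)) (hm (.inr 0)) (hm (.inr 1))
      (hf.ne (by decide)) (hf.ne (by decide)) (hf.ne (by decide)) (hf.ne (by decide))
      (hf.ne (by decide)) (hf.ne (by decide))
    simp [hadj, DmkGraph] at this
  · have hm : ∀ i, f i ∈ B := fun i => hXB ⟨i, rfl⟩
    have := h.not_diamond hB (hm 0) (hm 1) (hm 2) (hm 3)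
      (hf.ne (by decide)) (hf.ne (by decide)) (hf.ne (by decide)) (hf.ne (by decide))
      (hf.ne (by decide)) (hf.ne (by decide))
    simp [hadj, TwoTrianglesGraph] at this
  · exact h.not_cycle hB hm hf (fun i => hXB ⟨i, rfl⟩) hadj

end EdgeRep

/-! ### Recognising the forbidden graphs -/

lemma exists_inF_of_claw {Ω : BForm V} (hΩ : ∀ x : V, Ω x x = 0) {B : Set V} {x a b c : V}
    (hx : x ∈ B) (ha : a ∈ B) (hb : b ∈ B) (hc : c ∈ B) (hab : a ≠ b) (hac : a ≠ c) (hbc : b ≠ c)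
    (hxa1 : Ω x a = 1) (hxb1 : Ω x b = 1) (hxc1 : Ω x c = 1)
    (hab1 : Ω a b ≠ 1) (hac1 : Ω a c ≠ 1) (hbc1 : Ω b c ≠ 1) : ∃ X ⊆ B, InF (Gr Ω X) := by
  have hne : ∀ {y}, Ω x y = 1 → x ≠ y := by rintro y h rfl; simp [hΩ] at h
  have hxa := hne hxa1
  have hxb := hne hxb1
  have hxc := hne hxc1
  have sw := alternating_swap hΩ
  refine ⟨Set.range (Sum.elim ![a, x] ![b, c]), ?_, Or.inl ((nonempty_gr_iso_iff hΩ).2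
    ⟨Sum.elim ![a, x] ![b, c], ?_, rfl, ?_⟩)⟩
  · rintro _ ⟨i | i, rfl⟩ <;> fin_cases i <;> simpa
  · rintro (i | i) (j | j) <;> fin_cases i <;> fin_cases j <;> simp_all [eq_comm]
  · rintro (i | i) (j | j) <;> fin_cases i <;> fin_cases j <;>
      simp [DmkGraph, hΩ, hxa1, hxb1, hxc1, hab1, hac1, hbc1, sw a x, sw b x, sw c x, sw b a,
        sw c a, sw c b]

lemma exists_inF_of_diamond {Ω : BForm V} (hΩ : ∀ x : V, Ω x x = 0) {B : Set V} {x y a b : V}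
    (hx : x ∈ B) (hy : y ∈ B) (ha : a ∈ B) (hb : b ∈ B) (hab : a ≠ b)
    (hxy1 : Ω x y = 1) (hxa1 : Ω x a = 1) (hya1 : Ω y a = 1) (hxb1 : Ω x b = 1)
    (hyb1 : Ω y b = 1) (hab1 : Ω a b ≠ 1) : ∃ X ⊆ B, InF (Gr Ω X) := by
  have hne : ∀ {x y}, Ω x y = 1 → x ≠ y := by rintro x y h rfl; simp [hΩ] at h
  have hxy := hne hxy1
  have hxa := hne hxa1
  have hya := hne hya1
  have hxb := hne hxb1
  have hyb := hne hyb1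
  have sw := alternating_swap hΩ
  refine ⟨Set.range ![x, y, a, b], ?_, Or.inr (Or.inl ((nonempty_gr_iso_iff hΩ).2
    ⟨![x, y, a, b], ?_, rfl, ?_⟩))⟩
  · rintro _ ⟨i, rfl⟩
    fin_cases i <;> simpa
  · intro i j
    fin_cases i <;> fin_cases j <;> simp_all [eq_comm]
  · intro i j
    fin_cases i <;> fin_cases j <;>
      simp [TwoTrianglesGraph, hΩ, hxy1, hxa1, hya1, hxb1, hyb1, hab1, sw y x, sw a x, sw b x,
        sw a y, sw b y, sw b a]

lemma exists_inF_of_cycle {Ω : BForm V} (hΩ : ∀ x : V, Ω x x = 0) {B : Set V} {v : V} {k : ℕ}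
    (hk : 2 ≤ k) {p : ℕ → V} (hv : v ∈ B) (hp : ∀ i ≤ k, p i ∈ B) (hvp : ∀ i ≤ k, v ≠ p i)
    (hinj : ∀ i ≤ k, ∀ j ≤ k, p i = p j → i = j)
    (hadj : ∀ i ≤ k, ∀ j ≤ k, Ω (p i) (p j) = 1 ↔ i + 1 = j ∨ j + 1 = i)
    (hvadj : ∀ i ≤ k, Ω v (p i) = 1 ↔ i = 0 ∨ i = k) : ∃ X ⊆ B, InF (Gr Ω X) := by
  let f : Fin (k + 2) → V := fun i => if i.val ≤ k then p i else v
  have hmod : ∀ a ≤ k + 2, a % (k + 2) = if a < k + 2 then a else 0 := by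
    intro a ha
    split_ifs with h'
    · exact Nat.mod_eq_of_lt h'
    · rw [show a = k + 2 by omega, Nat.mod_self]
  refine ⟨Set.range f, ?_, Or.inr (Or.inr ⟨k + 2, by omega, (nonempty_gr_iso_iff hΩ).2
    ⟨f, ?_, rfl, ?_⟩⟩)⟩
  · rintro _ ⟨i, rfl⟩
    simp only [f]
    split_ifs with h
    exacts [hp _ h, hv]
  · intro i j hij
    simp only [f] at hij
    apply Fin.ext
    split_ifs at hij with hi hj hj
    · exact hinj _ hi _ hj hij
    · exact absurd hij.symm (hvp _ hi)
    · exact absurd hij (hvp _ hj)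
    · omega
  · intro i j
    rw [cycleGraph_adj, hmod _ (by omega), hmod _ (by omega), Ne, Fin.ext_iff]
    simp only [f]
    split_ifs with hi hj _ _ hj
    all_goals first
      | rw [hadj _ ‹_› _ ‹_›]; omega
      | rw [hvadj _ ‹_›]; omega
      | rw [alternating_swap hΩ, hvadj _ ‹_›]; omega
      | simp [hΩ]; omega

/-! ### Attaching a vertex to a connected set -/

/-- Any two elements of `C` are joined by a walk inside `C`. -/
def WalkConnected (Ω : BForm V) (C : Set V) : Prop :=
  ∀ x ∈ C, ∀ y ∈ C, Relation.ReflTransGen (fun a b => a ∈ C ∧ b ∈ C ∧ Ω a b = 1) x y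

lemma WalkConnected.insert {Ω : BForm V} (hΩ : ∀ x : V, Ω x x = 0) {C : Set V}
    (hC : WalkConnected Ω C) {u v : V} (hu : u ∈ C) (huv : Ω u v = 1) :
    WalkConnected Ω (insert v C) := by
  have hmono : ∀ x ∈ C, ∀ y ∈ C, Relation.ReflTransGen
      (fun a b => a ∈ Insert.insert v C ∧ b ∈ Insert.insert v C ∧ Ω a b = 1) x y :=
    fun x hx y hy => (hC x hx y hy).lift id
      fun a b h => ⟨Or.inr h.1, Or.inr h.2.1, h.2.2⟩
  rintro x (rfl | hx) y (rfl | hy)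
  · exact .refl
  · exact .head ⟨Or.inl rfl, Or.inr hu, by rw [alternating_swap hΩ, huv]⟩ (hmono u hu y hy)
  · exact (hmono x hx u hu).tail ⟨Or.inr hu, Or.inl rfl, huv⟩
  · exact hmono x hx y hy

lemma WalkConnected.exists_seq {Ω : BForm V} {C : Set V} (hC : WalkConnected Ω C) {x y : V}
    (hx : x ∈ C) (hy : y ∈ C) : ∃ (k : ℕ) (p : ℕ → V), (∀ i ≤ k, p i ∈ C) ∧
      (∀ i < k, Ω (p i) (p (i + 1)) = 1) ∧ p 0 = x ∧ p k = y := by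
  induction hC x hx y hy with
  | refl => exact ⟨0, fun _ => x, fun _ _ => hx, by simp, rfl, rfl⟩
  | @tail b c _ hbc ih =>
    obtain ⟨k, p, hp, hadj, h0, hk⟩ := ih hbc.1
    refine ⟨k + 1, fun t => if t ≤ k then p t else c, fun i _ => ?_, fun i hi => ?_, ?_, ?_⟩
    · dsimp only
      split_ifs with h
      exacts [hp i h, hbc.2.1]
    · rcases Nat.lt_succ_iff_lt_or_eq.1 hi with h | rfl
      · simpa [h.le, Nat.succ_le_of_lt h] using hadj i h
      · simpa [hk] using hbc.2.2
    · simpa using h0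
    · simp

/-- In the absence of forbidden induced subgraphs, the neighbours of `v` in a connected set not
containing `v` are pairwise adjacent. -/
lemma WalkConnected.neighbors_adj {Ω : BForm V} (hΩ : ∀ x : V, Ω x x = 0) {B C : Set V}
    (hF : ¬ ∃ X ⊆ B, InF (Gr Ω X)) (hCB : C ⊆ B) (hC : WalkConnected Ω C) {v : V} (hv : v ∈ B)
    (hvC : v ∉ C) {x y : V} (hx : x ∈ C) (hy : y ∈ C) (hvx : Ω v x = 1) (hvy : Ω v y = 1)
    (hxy : x ≠ y) : Ω x y = 1 := by
  by_contra hxy1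
  let P : ℕ → Prop := fun k => ∃ p : ℕ → V, (∀ i ≤ k, p i ∈ C) ∧
    (∀ i < k, Ω (p i) (p (i + 1)) = 1) ∧ p 0 ≠ p k ∧ Ω (p 0) (p k) ≠ 1 ∧
      Ω v (p 0) = 1 ∧ Ω v (p k) = 1
  have hex : ∃ k, P k := by
    obtain ⟨k, p, hp, hadj, rfl, rfl⟩ := hC.exists_seq hx hy
    exact ⟨k, p, hp, hadj, hxy, hxy1, hvx, hvy⟩
  classical
  obtain ⟨k, ⟨p, hp, hadj, hne, hnadj, hv0, hvk⟩, hmin⟩ :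
      ∃ k, P k ∧ ∀ l < k, ¬ P l := ⟨Nat.find hex, Nat.find_spec hex, fun _ => Nat.find_min hex⟩
  have hk : 2 ≤ k := by
    by_contra hk
    interval_cases k
    · exact hne rfl
    · exact hnadj (hadj 0 one_pos)
  have hind : ∀ i j, i + 1 < j → j ≤ k → Ω (p i) (p j) ≠ 1 := by
    intro i j hij hj h1
    refine hmin (k - (j - i - 1)) (by omega)
      ⟨fun t => if t ≤ i then p t else p (t + (j - i - 1)), ?_, ?_, ?_⟩
    · intro t ht
      dsimp only
      split_ifs <;> exact hp _ (by omega)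
    · intro t ht
      rcases lt_trichotomy t i with h | rfl | h
      · simpa [h.le, Nat.succ_le_of_lt h] using hadj t (by omega)
      · simpa [show t + 1 + (j - t - 1) = j by omega] using h1
      · simpa [h.not_ge, show ¬ t + 1 ≤ i by omega,
          show t + 1 + (j - i - 1) = t + (j - i - 1) + 1 by omega] using
          hadj (t + (j - i - 1)) (by omega)
    · simpa [show ¬ k - (j - i - 1) ≤ i by omega,
        show k - (j - i - 1) + (j - i - 1) = k by omega] using ⟨hne, hnadj, hv0, hvk⟩
  have hinj : ∀ i j, i < j → j ≤ k → p i ≠ p j := by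
    intro i j hij hj h
    rcases hj.lt_or_eq with hj | rfl
    · exact hind i (j + 1) (by omega) hj (h ▸ hadj j hj)
    · rcases Nat.eq_zero_or_pos i with rfl | hi
      · exact hne h
      · refine hind (i - 1) j (by omega) le_rfl (h ▸ ?_)
        have := hadj (i - 1) (by omega)
        rwa [Nat.sub_add_cancel hi] at this
  have hsub : ∀ i j, i < j → j ≤ k → j - i < k → Ω v (p i) = 1 → Ω v (p j) = 1 →
      Ω (p i) (p j) = 1 := by
    intro i j hij hj hlt hi1 hj1
    by_contra h1
    refine hmin (j - i) hlt ⟨fun t => p (t + i), fun t ht => hp _ (by omega), fun t ht => ?_, ?_⟩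
    · simpa [Nat.add_right_comm] using hadj (t + i) (by omega)
    · simpa [hij.le] using ⟨hinj i j hij hj, h1, hi1, hj1⟩
  have hvp : ∀ i ≤ k, v ≠ p i := fun i hi h => hvC (h ▸ hp i hi)
  apply hF
  by_cases hmid : ∃ i, 0 < i ∧ i < k ∧ Ω v (p i) = 1
  · obtain ⟨i, hi0, hik, hi⟩ := hmid
    have h0i := hsub 0 i hi0 hik.le (by omega) hv0 hi
    have hik' := hsub i k hik le_rfl (by omega) hi hvk
    exact exists_inF_of_diamond hΩ hv (hCB (hp i hik.le)) (hCB (hp 0 (by omega)))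
      (hCB (hp k le_rfl)) hne hi hv0 (by rw [alternating_swap hΩ, h0i]) hvk hik' hnadj
  · push Not at hmid
    refine exists_inF_of_cycle hΩ hk hv (fun i hi => hCB (hp i hi)) hvp ?_ ?_ ?_
    · intro i hi j hj hij
      by_contra hne'
      rcases Nat.lt_or_gt_of_ne hne' with h | h
      · exact hinj i j h hj hij
      · exact hinj j i h hi hij.symm
    · intro i hi j hj
      constructor
      · intro h1
        by_contra hcon
        rcases lt_trichotomy i j with h | rfl | h
        · exact hind i j (by omega) hj h1
        · simp [hΩ] at h1
        · exact hind j i (by omega) hi (by rw [alternating_swap hΩ, h1])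
      · rintro (rfl | rfl)
        · exact hadj i (by omega)
        · rw [alternating_swap hΩ]
          exact hadj j (by omega)
    · intro i hi
      constructor
      · intro h1
        by_contra hcon
        exact hmid i (by omega) (by omega) h1
      · rintro (rfl | rfl)
        exacts [hv0, hvk]

/-- The neighbours of a new vertex `v` are the edges through one vertex `w` of the forest. -/
lemma EdgeRep.exists_vertex {Ω : BForm V} (hΩ : ∀ x : V, Ω x x = 0) {n : ℕ}
    {φ : V →ₗ[ZMod 2] ℕ → ZMod 2} {B C : Set V} (hφ : EdgeRep Ω n φ C)
    (hli : LinearIndepOn (ZMod 2) id C) (hF : ¬ ∃ X ⊆ B, InF (Gr Ω X)) (hCB : C ⊆ B)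
    (hC : WalkConnected Ω C) {u v : V} (hv : v ∈ B) (hvC : v ∉ C) (hu : u ∈ C)
    (hvu : Ω v u = 1) : ∃ w ≤ n, ∀ b ∈ C, Ω v b = φ b w := by
  have sw := alternating_swap hΩ
  have clique := fun {x y : V} => hC.neighbors_adj hΩ hF hCB hv hvC (x := x) (y := y)
  suffices ∃ w ≤ n, ∀ b ∈ C, Ω v b = 1 ↔ φ b w = 1 by
    obtain ⟨w, hw, h⟩ := this
    refine ⟨w, hw, fun b hb => ?_⟩
    by_cases h1 : Ω v b = 1
    · rw [h1, (h b hb).1 h1]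
    · rw [ZMod.two_ne_one_iff.1 h1, ZMod.two_ne_one_iff.1 fun h2 => h1 ((h b hb).2 h2)]
  by_cases hsingle : ∀ x ∈ C, Ω v x = 1 → x = u
  · obtain ⟨i, j, hi, hj, hij, e⟩ := hφ.pair u hu
    have hui : φ u i = 1 := by rw [e, single_add_single_apply_eq_one hij]; simp
    have huj : φ u j = 1 := by rw [e, single_add_single_apply_eq_one hij]; simp
    by_cases hi' : ∀ b ∈ C, φ b i = 1 → b = u
    · exact ⟨i, hi, fun b hb => ⟨fun h => hsingle b hb h ▸ hui, fun h => hi' b hb h ▸ hvu⟩⟩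
    by_cases hj' : ∀ b ∈ C, φ b j = 1 → b = u
    · exact ⟨j, hj, fun b hb => ⟨fun h => hsingle b hb h ▸ huj, fun h => hj' b hb h ▸ hvu⟩⟩
    push Not at hi' hj'
    obtain ⟨b, hb, hbi, hbu⟩ := hi'
    obtain ⟨c, hc, hcj, hcu⟩ := hj'
    have hub : Ω u b = 1 := (hφ.form_eq_one_iff hu hb hbu.symm).2 ⟨i, hui, hbi⟩
    have huc : Ω u c = 1 := (hφ.form_eq_one_iff hu hc hcu.symm).2 ⟨j, huj, hcj⟩
    have hbc : b ≠ c := by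
      rintro rfl
      exact hbu (hφ.eq_of_apply_eq_one hb hu hij hbi hcj hui huj)
    have hbc1 : Ω b c ≠ 1 := by
      intro h
      have := hφ.exists_common hli hu hb hc hbu.symm hcu.symm hbc hui hbi huc h
      exact hcu (hφ.eq_of_apply_eq_one hc hu hij this hcj hui huj)
    exact absurd (exists_inF_of_claw hΩ (hCB hu) hv (hCB hb) (hCB hc)
      (fun h => hvC (h ▸ hb)) (fun h => hvC (h ▸ hc)) hbc (by rw [sw, hvu]) hub huc
      (fun h => hbu (hsingle b hb h)) (fun h => hcu (hsingle c hc h)) hbc1) hF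
  · push Not at hsingle
    obtain ⟨x, hx, hvx, hxu⟩ := hsingle
    have hxu1 := clique hx hu hvx hvu hxu
    obtain ⟨w, hxw, huw⟩ := (hφ.form_eq_one_iff hx hu hxu).1 hxu1
    obtain ⟨-, hw, -⟩ := hφ.exists_other hx hxw
    refine ⟨w, hw, fun b hb => ?_⟩
    rcases eq_or_ne b x with rfl | hbx
    · simp [hvx, hxw]
    rcases eq_or_ne b u with rfl | hbu
    · simp [hvu, huw]
    constructor
    · intro h
      exact hφ.exists_common hli hx hu hb hxu hbx.symm hbu.symm hxw huw
        (clique hx hb hvx h hbx.symm) (clique hu hb hvu h hbu.symm)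
    · intro h
      by_contra hvb
      exact hF (exists_inF_of_diamond hΩ (hCB hx) (hCB hu) hv (hCB hb) (fun h => hvC (h ▸ hb))
        hxu1 (by rw [sw, hvx]) (by rw [sw, hvu])
        ((hφ.form_eq_one_iff hx hb hbx.symm).2 ⟨w, hxw, h⟩)
        ((hφ.form_eq_one_iff hu hb hbu.symm).2 ⟨w, huw, h⟩) hvb)

/-! ### Reduction to a path -/

/-- A vector attached to a path at position `w` can be moved to the end of the path. -/
lemma IsPathSeq.exists_equivSets_insert {Ω : BForm V} (hΩ : ∀ x : V, Ω x x = 0) {n : ℕ}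
    {p : ℕ → V} (hp : IsPathSeq Ω n p) {w : ℕ} (hw : w ≤ n) {v : V}
    (hv : v ∉ Submodule.span (ZMod 2) (p '' Set.Iio n))
    (hvp : ∀ i < n, Ω v (p i) = if w = i ∨ w = i + 1 then 1 else 0) :
    ∃ q, EquivSets Ω (insert v (p '' Set.Iio n)) (q '' Set.Iio (n + 1)) ∧
      IsPathSeq Ω (n + 1) q := by
  induction hw using Nat.decreasingInduction generalizing v with
  | self =>
    have hvP : v ∉ p '' Set.Iio n := fun h => hv (Submodule.subset_span h)
    have hq : ∀ i < n, Function.update p n v i = p i := fun i hi =>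
      Function.update_of_ne hi.ne _ _
    have himg : Function.update p n v '' Set.Iio n = p '' Set.Iio n :=
      Set.image_congr fun i hi => hq i hi
    have hIio : Set.Iio (n + 1) = insert n (Set.Iio n) := by
      ext i
      simp only [Set.mem_Iio, Set.mem_insert_iff]
      omega
    refine ⟨Function.update p n v, ?_, ?_, ?_⟩
    · rw [hIio, Set.image_insert_eq, himg, Function.update_self]
      exact .refl
    · rw [hIio, Set.injOn_insert (by simp), himg, Function.update_self]
      exact ⟨hp.injOn.congr fun i hi => (hq i hi).symm, hvP⟩
    · intro i hi j hj
      rcases Nat.lt_succ_iff_lt_or_eq.1 hi with hi | rfl <;>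
        rcases Nat.lt_succ_iff_lt_or_eq.1 hj with hj | rfl
      · rw [hq i hi, hq j hj, hp.form i hi j hj]
      · rw [hq i hi, Function.update_self, alternating_swap hΩ, hvp i hi]
        grind
      · rw [hq j hj, Function.update_self, hvp j hj]
        grind
      · simp [hΩ]
  | of_succ w hw ih =>
    have hwP : p w ∈ p '' Set.Iio n := ⟨w, hw, rfl⟩
    have hvP : v ∉ p '' Set.Iio n := fun h => hv (Submodule.subset_span h)
    obtain ⟨q, hq, hq'⟩ := ih (v := v + p w)
      (fun h => hv ((Submodule.add_mem_iff_left _ (Submodule.subset_span hwP)).1 h)) (by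
        intro i hi
        rw [map_add, LinearMap.add_apply, hvp i hi, hp.form w hw i hi]
        rcases eq_or_ne w (i + 1) with rfl | h
        · simp [CharTwo.add_self_eq_zero]
          omega
        · grind)
    refine ⟨q, .head ⟨p w, v, Or.inr hwP, Or.inl rfl, fun h => hvP (h ▸ hwP), ?_, ?_⟩ hq, hq'⟩
    · rw [alternating_swap hΩ, hvp w hw]
      simp
    · rw [Set.insert_sdiff_self_of_notMem hvP]

/-- A connected set without forbidden induced subgraphs is equivalent to a path. -/
lemma exists_equivSets_isPathSeq {Ω : BForm V} (hΩ : ∀ x : V, Ω x x = 0) {B : Set V}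
    (hfin : B.Finite) (hli : LinearIndepOn (ZMod 2) id B) (hconn : (Gr Ω B).Connected)
    (hF : ¬ ∃ X ⊆ B, InF (Gr Ω X)) :
    ∃ p, EquivSets Ω B (p '' Set.Iio B.ncard) ∧ IsPathSeq Ω B.ncard p := by
  obtain ⟨⟨b₀, hb₀⟩⟩ := hconn.nonempty
  have hpos : 1 ≤ B.ncard := (Set.ncard_pos hfin).2 ⟨b₀, hb₀⟩
  suffices ∀ m, 1 ≤ m → m ≤ B.ncard → ∃ C ⊆ B, C.ncard = m ∧ WalkConnected Ω C ∧
      ∃ p, EquivSets Ω C (p '' Set.Iio m) ∧ IsPathSeq Ω m p by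
    obtain ⟨C, hCB, hcard, -, p, hp⟩ := this _ hpos le_rfl
    obtain rfl := Set.eq_of_subset_of_ncard_le hCB hcard.ge hfin
    exact ⟨p, hp⟩
  intro m hm
  induction m, hm using Nat.le_induction with
  | base =>
    intro _
    refine ⟨{b₀}, by simpa using hb₀, by simp, ?_, fun _ => b₀, ?_, ?_, ?_⟩
    · rintro x rfl y rfl
      exact .refl
    · rw [Set.Nonempty.image_const ⟨0, by simp⟩]
      exact .refl
    · intro i hi j hj _
      simp only [Set.mem_Iio] at hi hj
      omega
    · intro i hi j hj
      rw [hΩ, if_neg (by omega)]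
  | succ m hm ih =>
    intro hmB
    obtain ⟨C, hCB, hcard, hC, p, hCp, hp⟩ := ih (by omega)
    have hCne : C.Nonempty := Set.nonempty_of_ncard_ne_zero (by omega)
    obtain ⟨x, hx⟩ := hCne
    obtain ⟨y, hy, hyC⟩ : ∃ y ∈ B, y ∉ C := Set.exists_mem_notMem_of_ncard_lt_ncard
      (by omega) (hfin.subset hCB)
    obtain ⟨W⟩ := hconn.preconnected ⟨x, hCB hx⟩ ⟨y, hy⟩
    obtain ⟨d, -, hu, hvC⟩ := W.exists_boundary_dart {z | z.1 ∈ C} hx hyC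
    have huv : Ω d.fst.1 d.snd.1 = 1 := (gr_adj hΩ).1 d.adj
    obtain ⟨u, hu, v, hv, hvC, huv⟩ : ∃ u ∈ C, ∃ v ∈ B, v ∉ C ∧ Ω u v = 1 :=
      ⟨_, hu, _, d.snd.2, hvC, huv⟩
    have hCli : LinearIndepOn (ZMod 2) id C := hli.mono hCB
    have hvspan : v ∉ Submodule.span (ZMod 2) C := by
      have := (linearIndepOn_id_insert hvC).1 (hli.mono (Set.insert_subset hv hCB))
      exact this.2
    obtain ⟨φ, hφ, hφp⟩ := hp.exists_edgeRep (hCp.linearIndepOn hCli)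
    obtain ⟨w, hw, hvw⟩ := (hφ.equivSets (hCp.symm hΩ hCli)).exists_vertex hΩ hCli hF hCB hC hv
      hvC hu (by rw [alternating_swap hΩ, huv])
    have hvw' : ∀ z ∈ Submodule.span (ZMod 2) C, Ω v z = φ z w := by
      intro z hz
      induction hz using Submodule.span_induction with
      | mem z hz => exact hvw z hz
      | zero => simp
      | add y z _ _ h₁ h₂ => simp [h₁, h₂]
      | smul r z _ h => simp [h]
    obtain ⟨q, hq, hq'⟩ := hp.exists_equivSets_insert hΩ hw (v := v)
      (fun h => hvspan (hCp.span_le h)) (by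
        intro i hi
        rw [hvw' _ (hCp.span_le (Submodule.subset_span ⟨i, hi, rfl⟩)), hφp i hi]
        by_cases h1 : w = i <;> by_cases h2 : w = i + 1 <;> simp_all)
    exact ⟨insert v C, Set.insert_subset hv hCB,
      by rw [Set.ncard_insert_of_notMem hvC (hfin.subset hCB), hcard],
      hC.insert hΩ hu huv, q, (hCp.insert hvspan).trans hq, hq'⟩

/-- A tree of type `D_{m,1}` is a path on `m + 1` vertices. -/
lemma nonempty_gr_iso_dmkGraph_one_iff {Ω : BForm V} (hΩ : ∀ x : V, Ω x x = 0) {X : Set V}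
    {m : ℕ} : Nonempty (Gr Ω X ≃g DmkGraph m 1) ↔
      ∃ p, p '' Set.Iio (m + 1) = X ∧ IsPathSeq Ω (m + 1) p := by
  rw [nonempty_gr_iso_iff hΩ]
  constructor
  · rintro ⟨f, hf, rfl, hadj⟩
    let p : ℕ → V := fun i => if h : i < m then f (.inl ⟨i, h⟩) else f (.inr 0)
    refine ⟨p, ?_, ?_, ?_⟩
    · ext x
      constructor
      · rintro ⟨i, -, rfl⟩
        simp only [p]
        split_ifs <;> exact ⟨_, rfl⟩
      · rintro ⟨i | i, rfl⟩
        · exact ⟨i, i.2.trans (Nat.lt_succ_self m), by simp [p]⟩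
        · exact ⟨m, Nat.lt_succ_self m, by simp [p, Subsingleton.elim i 0]⟩
    · intro i hi j hj hij
      simp only [Set.mem_Iio] at hi hj
      simp only [p] at hij
      split_ifs at hij
      · simpa using hf hij
      · simpa using hf hij
      · simpa using hf hij
      · omega
    · intro i hi j hj
      have key : Ω (p i) (p j) = 1 ↔ i + 1 = j ∨ j + 1 = i := by
        simp only [p]
        split_ifs <;> rw [hadj] <;> simp [DmkGraph] <;> omega
      split_ifs with h
      · exact key.2 h
      · exact ZMod.two_ne_one_iff.1 fun h' => h (key.1 h')
  · rintro ⟨p, rfl, hp⟩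
    let g : Fin m ⊕ Fin 1 → ℕ := Sum.elim (fun i => i.val) (fun _ => m)
    have hg : ∀ i, g i < m + 1 := by
      rintro (i | i) <;> simp only [g, Sum.elim_inl, Sum.elim_inr] <;> omega
    have hginj : Function.Injective g := by
      rintro (i | i) (j | j) h <;> simp only [g, Sum.elim_inl, Sum.elim_inr] at h
      · rw [Fin.ext h]
      · omega
      · omega
      · rw [Subsingleton.elim i j]
    refine ⟨p ∘ g, fun i j h => hginj (hp.injOn (hg i) (hg j) h), ?_, ?_⟩
    · rw [Set.range_comp]
      congr 1
      ext i
      constructor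
      · rintro ⟨i, rfl⟩
        exact hg i
      · intro hi
        rcases Nat.lt_succ_iff_lt_or_eq.1 hi with hi | rfl
        · exact ⟨.inl ⟨i, hi⟩, rfl⟩
        · exact ⟨.inr 0, rfl⟩
    · intro i j
      rw [Function.comp_apply, Function.comp_apply, hp.form _ (hg i) _ (hg j)]
      have key : (DmkGraph m 1).Adj i j ↔ g i + 1 = g j ∨ g j + 1 = g i := by
        rcases i with i | i <;> rcases j with j | j <;>
          simp [DmkGraph, g, Fin.ext_iff] <;> omega
      rw [key]
      split_ifs with h <;> simp [h]

/-- A connected `B` with `|B| ≥ 3` is equivalent to a set whose graph is a tree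
of type `D_{m,1}` (`m ≥ 2`) iff `Gr(B)` has no induced subgraph isomorphic to a member
of the family `F`. -/
theorem stmt_3 {V : Type*} [AddCommGroup V] [Module (ZMod 2) V]
    [FiniteDimensional (ZMod 2) V]
    (Ω : BForm V) (hΩ : ∀ x : V, Ω x x = 0)
    (B : Set V) (hli : LinearIndependent (ZMod 2) (Subtype.val : B → V))
    (hcard : 3 ≤ B.ncard) (hconn : (Gr Ω B).Connected) :
    (∃ m : ℕ, 2 ≤ m ∧ EquivToDmkTree Ω B m 1) ↔ ¬ ∃ X ⊆ B, InF (Gr Ω X) := by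
  have hB : LinearIndepOn (ZMod 2) id B := hli
  constructor
  · rintro ⟨m, -, B', hBB', hB'⟩
    obtain ⟨p, rfl, hp⟩ := (nonempty_gr_iso_dmkGraph_one_iff hΩ).1 hB'
    obtain ⟨φ, hφ, -⟩ := hp.exists_edgeRep (hBB'.linearIndepOn hB)
    exact (hφ.equivSets (hBB'.symm hΩ hB)).not_inF hΩ hB
  · intro hF
    obtain ⟨p, hBp, hp⟩ := exists_equivSets_isPathSeq hΩ
      (Set.finite_of_ncard_pos (by omega)) hB hconn hF
    obtain ⟨m, hm⟩ : ∃ m, B.ncard = m + 1 := ⟨B.ncard - 1, by omega⟩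
    rw [hm] at hBp hp
    exact ⟨m, by omega, _, hBp, (nonempty_gr_iso_dmkGraph_one_iff hΩ).2 ⟨p, rfl, hp⟩⟩
end
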